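/- Let (Ω, μ) be a probability space, 1 ≤ p ≤ 2, and let f ∈ V^p_2(Ω^n) with f(x) = ∑_{i<j} f_{i,j}(x_i, x_j). Then ‖f‖_{L^p(Ω^n)} is equivalent, with absolute constants, to the infimum over all decompositions f_{i,j} = a_{i,j} + b_{i,j} + c_{i,j} + d_{i,j} of (∑_{i<j} ∫_{Ω²} |a_{i,j}|² )^{1/2} + (∑_{i<j} ∫_{Ω²} |b_{i,j}|^p )^{1/p} + ( ∑_i ∫_Ω ( ∑_{j>i} ∫_Ω |c_{i,j}(ξ,υ)|² dυ )^{p/2} dξ )^{1/p} + ( ∑_j ∫_Ω ( ∑_{i<j} ∫_Ω |d_{i,j}(ξ,υ)|² dξ )^{p/2} dυ )^{1/p}; moreover the decomposition can be chosen so that all a_{i,j}, b_{i,j}, c_{i,j}, d_{i,j} are of mean zero in each variable. -/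

import Mathlib

open MeasureTheory
open scoped ENNReal

universe u

variable {Ω : Type u} [MeasurableSpace Ω]

/-- The values `‖a‖_{ℓ²(L²)} + ‖b‖_{ℓᵖ(Lᵖ)} + ‖c‖_{L^p(⨿Ω,L²(⨿Ω))} + ‖d‖` over all
decompositions `f i j = a + b + c + d` into pieces supported on `i < j` (all of mean zero
in each variable when `mz = true`). -/
noncomputable def fourDecompVals (μ : Measure Ω) (p : ℝ) {n : ℕ}
    (f : Fin n → Fin n → Ω → Ω → ℝ) (mz : Bool) : Set ℝ≥0∞ :=
  {s | ∃ a b c d : Fin n → Fin n → Ω → Ω → ℝ,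
    (∀ i j, Measurable (Function.uncurry (a i j))) ∧
    (∀ i j, Measurable (Function.uncurry (b i j))) ∧
    (∀ i j, Measurable (Function.uncurry (c i j))) ∧
    (∀ i j, Measurable (Function.uncurry (d i j))) ∧
    (∀ i j, ¬ i < j → a i j = 0 ∧ b i j = 0 ∧ c i j = 0 ∧ d i j = 0) ∧
    (∀ i j ξ υ, f i j ξ υ = a i j ξ υ + b i j ξ υ + c i j ξ υ + d i j ξ υ) ∧
    (mz = true → ∀ g ∈ [a, b, c, d], ∀ i j,
      (∀ᵐ υ ∂μ, ∫ ξ, g i j ξ υ ∂μ = 0) ∧ (∀ᵐ ξ ∂μ, ∫ υ, g i j ξ υ ∂μ = 0)) ∧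
    s = (∑ i, ∑ j, ∫⁻ ξ, ∫⁻ υ, ENNReal.ofReal (a i j ξ υ ^ 2) ∂μ ∂μ) ^ ((1:ℝ)/2)
      + (∑ i, ∑ j, ∫⁻ ξ, ∫⁻ υ, ENNReal.ofReal (|b i j ξ υ| ^ p) ∂μ ∂μ) ^ (1/p)
      + (∑ i, ∫⁻ ξ, (∑ j, ∫⁻ υ, ENNReal.ofReal (c i j ξ υ ^ 2) ∂μ) ^ (p/2) ∂μ) ^ (1/p)
      + (∑ j, ∫⁻ υ, (∑ i, ∫⁻ ξ, ENNReal.ofReal (d i j ξ υ ^ 2) ∂μ) ^ (p/2) ∂μ) ^ (1/p)}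

section Pi
variable {Ω : Type u} [MeasurableSpace Ω] (μ : Measure Ω) [IsProbabilityMeasure μ] {n : ℕ}

lemma mp_update (i : Fin n) :
    MeasurePreserving (fun z : Ω × (Fin n → Ω) => Function.update z.2 i z.1)
      (μ.prod (Measure.pi fun _ => μ)) (Measure.pi fun _ => μ) := by
  have hm : Measurable (fun z : Ω × (Fin n → Ω) => Function.update z.2 i z.1) := by
    rw [measurable_pi_iff]
    intro j
    by_cases h : j = i
    · subst h; simpa using measurable_fst
    · simp only [Function.update_of_ne h]; fun_prop
  refine ⟨hm, ?_⟩
  symm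
  refine Measure.pi_eq fun s hs => ?_
  rw [Measure.map_apply hm (MeasurableSet.univ_pi hs)]
  have : (fun z : Ω × (Fin n → Ω) => Function.update z.2 i z.1) ⁻¹' (Set.univ.pi s)
      = (s i) ×ˢ (Set.univ.pi (Function.update s i Set.univ)) := by
    ext z
    simp only [Set.mem_preimage, Set.mem_pi, Set.mem_univ, true_imp_iff, Set.mem_prod]
    constructor
    · intro h
      refine ⟨by simpa using h i, fun j => ?_⟩
      by_cases hj : j = i
      · subst hj; simp
      · simpa [Function.update_of_ne hj] using h j
    · rintro ⟨h1, h2⟩ j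
      by_cases hj : j = i
      · subst hj; simpa using h1
      · simpa [Function.update_of_ne hj] using h2 j
  rw [this, Measure.prod_prod, Measure.pi_pi, ← Finset.mul_prod_erase _ _ (Finset.mem_univ i),
    ← Finset.mul_prod_erase Finset.univ (fun j => μ (s j)) (Finset.mem_univ i)]
  simp only [Function.update_self, measure_univ, one_mul]
  congr 1
  refine Finset.prod_congr rfl fun j hj => ?_
  rw [Function.update_of_ne (Finset.ne_of_mem_erase hj)]

lemma lintegral_upd (i : Fin n) {h : (Fin n → Ω) → ℝ≥0∞} (hh : Measurable h) :
    ∫⁻ x, h x ∂(Measure.pi fun _ : Fin n => μ)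
      = ∫⁻ ξ, ∫⁻ x, h (Function.update x i ξ) ∂(Measure.pi fun _ : Fin n => μ) ∂μ := by
  rw [← (mp_update μ i).lintegral_comp hh, lintegral_prod]
  exact (hh.comp (mp_update μ i).measurable).aemeasurable

lemma lintegral_ev (i : Fin n) {h : Ω → ℝ≥0∞} (hh : Measurable h) :
    ∫⁻ x, h (x i) ∂(Measure.pi fun _ : Fin n => μ) = ∫⁻ ξ, h ξ ∂μ :=
  (measurePreserving_eval (fun _ : Fin n => μ) i).lintegral_comp hh

lemma mp_pair {i j : Fin n} (hij : i ≠ j) :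
    MeasurePreserving (fun x : Fin n → Ω => (x i, x j)) (Measure.pi fun _ => μ) (μ.prod μ) := by
  have hm : Measurable (fun x : Fin n → Ω => (x i, x j)) := by fun_prop
  refine ⟨hm, ?_⟩
  rw [← (mp_update μ i).map_eq, Measure.map_map hm (mp_update μ i).measurable]
  have h2 := (MeasurePreserving.id μ).prod (measurePreserving_eval (fun _ : Fin n => μ) j)
  rw [← h2.map_eq]
  congr 1
  ext z <;> simp [Function.update_of_ne hij.symm]

lemma lintegral_pair {i j : Fin n} (hij : i ≠ j) {h : Ω → Ω → ℝ≥0∞}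
    (hh : Measurable (Function.uncurry h)) :
    ∫⁻ x, h (x i) (x j) ∂(Measure.pi fun _ : Fin n => μ) = ∫⁻ ξ, ∫⁻ υ, h ξ υ ∂μ ∂μ := by
  have := (mp_pair μ hij).lintegral_comp hh
  rw [lintegral_prod _ hh.aemeasurable] at this
  exact this

lemma mp_piecewise (S : Finset (Fin n)) :
    MeasurePreserving (fun z : (Fin n → Ω) × (Fin n → Ω) => S.piecewise z.1 z.2)
      ((Measure.pi fun _ => μ).prod (Measure.pi fun _ => μ)) (Measure.pi fun _ => μ) := by
  have hm : Measurable (fun z : (Fin n → Ω) × (Fin n → Ω) => S.piecewise z.1 z.2) := by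
    rw [measurable_pi_iff]
    intro j
    by_cases h : j ∈ S
    · simp only [Finset.piecewise_eq_of_mem _ _ _ h]; fun_prop
    · simp only [Finset.piecewise_eq_of_notMem _ _ _ h]; fun_prop
  refine ⟨hm, ?_⟩
  symm
  refine Measure.pi_eq fun s hs => ?_
  rw [Measure.map_apply hm (MeasurableSet.univ_pi hs)]
  have : (fun z : (Fin n → Ω) × (Fin n → Ω) => S.piecewise z.1 z.2) ⁻¹' (Set.univ.pi s)
      = (Set.univ.pi (fun i => if i ∈ S then s i else Set.univ)) ×ˢ
        (Set.univ.pi (fun i => if i ∈ S then Set.univ else s i)) := by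
    ext z
    simp only [Set.mem_preimage, Set.mem_pi, Set.mem_univ, true_imp_iff, Set.mem_prod]
    rw [← forall_and]
    refine forall_congr' fun j => ?_
    by_cases h : j ∈ S <;> simp [h]
  rw [this, Measure.prod_prod, Measure.pi_pi, Measure.pi_pi, ← Finset.prod_mul_distrib]
  refine Finset.prod_congr rfl fun j _ => ?_
  by_cases h : j ∈ S <;> simp [h]

end Pi

section FO

lemma amgm_enn (X e : ℝ≥0∞) (he0 : e ≠ 0) (he : e ≠ ⊤) : X ≤ X ^ 2 / (40 * e) + 10 * e := by
  rcases eq_or_ne X ⊤ with rfl | hX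
  · have : (⊤:ℝ≥0∞) ^ 2 / (40 * e) = ⊤ := by
      rw [ENNReal.top_pow (by norm_num), ENNReal.top_div_of_ne_top]
      exact ENNReal.mul_ne_top (by norm_num) he
    rw [this]; simp
  · have h40 : 40 * e ≠ 0 := by simp [he0]
    have h40t : 40 * e ≠ ⊤ := ENNReal.mul_ne_top (by norm_num) he
    rw [← ENNReal.mul_le_mul_iff_right h40 h40t, mul_add, ENNReal.mul_div_cancel h40 h40t]
    lift X to NNReal using hX
    lift e to NNReal using he
    norm_cast
    rw [← NNReal.coe_le_coe]
    push_cast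
    nlinarith [sq_nonneg ((X:ℝ) - 20 * e)]

lemma paley {α : Type*} [MeasurableSpace α] (P : Measure α) [IsProbabilityMeasure P]
    {X Y : α → ℝ≥0∞} (hX : Measurable X) (hY : Measurable Y) (hYX : ∀ x, Y x ≤ X x)
    {e : ℝ≥0∞} (he0 : e ≠ 0) (he : e ≠ ⊤) (h1 : e / 2 ≤ ∫⁻ x, Y x ∂P)
    (h2 : ∫⁻ x, X x ^ 2 ∂P ≤ 5 * e ^ 2) : 1 / 80 ≤ P {x | e / 4 < Y x} := by
  have hB : MeasurableSet {x | e / 4 < Y x} := measurableSet_lt measurable_const hY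
  have key : e / 2 ≤ e / 4 + (5 * e ^ 2) / (40 * e) + 10 * e * P {x | e / 4 < Y x} := by
    calc e / 2 ≤ ∫⁻ x, Y x ∂P := h1
      _ ≤ ∫⁻ x, (e / 4 + X x ^ 2 / (40 * e)) + {x | e / 4 < Y x}.indicator (fun _ => 10 * e) x ∂P := by
          refine lintegral_mono fun x => ?_
          by_cases hx : e / 4 < Y x
          · rw [Set.indicator_of_mem (by exact hx)]
            calc Y x ≤ X x := hYX x
              _ ≤ _ := amgm_enn _ e he0 he
              _ ≤ _ := by rw [add_assoc]; exact le_add_self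
          · rw [Set.indicator_of_notMem (by exact hx), add_zero]
            exact (not_lt.1 hx).trans le_self_add
      _ = e / 4 + (∫⁻ x, X x ^ 2 ∂P) / (40 * e) + 10 * e * P {x | e / 4 < Y x} := by
          rw [lintegral_add_right _ (measurable_const.indicator hB),
            lintegral_add_left measurable_const, lintegral_indicator_const hB]
          simp only [lintegral_const, measure_univ, mul_one, div_eq_mul_inv]
          rw [lintegral_mul_const _ (hX.pow_const 2)]
      _ ≤ _ := by gcongr
  have hPt : P {x | e / 4 < Y x} ≠ ⊤ := measure_ne_top _ _
  generalize P {x | e / 4 < Y x} = Q at key hPt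
  lift Q to NNReal using hPt
  lift e to NNReal using he
  have he0' : (0:ℝ) < e := by
    have : e ≠ 0 := by simpa using he0
    positivity
  have e1 := ENNReal.toReal_mono (by
    refine ENNReal.add_ne_top.2 ⟨ENNReal.add_ne_top.2 ⟨?_, ?_⟩, ?_⟩
    · exact ENNReal.div_ne_top ENNReal.coe_ne_top (by norm_num)
    · refine ENNReal.div_ne_top ?_ ?_
      · exact ENNReal.mul_ne_top (by norm_num) (by simp)
      · simp [he0]
    · exact ENNReal.mul_ne_top (ENNReal.mul_ne_top (by norm_num) (by simp)) (by simp)) key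
  rw [ENNReal.toReal_add, ENNReal.toReal_add] at e1
  rotate_left
  · exact ENNReal.div_ne_top ENNReal.coe_ne_top (by norm_num)
  · refine ENNReal.div_ne_top ?_ ?_
    · exact ENNReal.mul_ne_top (by norm_num) (by simp)
    · simp [he0]
  · refine ENNReal.add_ne_top.2 ⟨?_, ?_⟩
    · exact ENNReal.div_ne_top ENNReal.coe_ne_top (by norm_num)
    · refine ENNReal.div_ne_top ?_ ?_
      · exact ENNReal.mul_ne_top (by norm_num) (by simp)
      · simp [he0]
  · exact ENNReal.mul_ne_top (ENNReal.mul_ne_top (by norm_num) (by simp)) (by simp)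
  simp only [ENNReal.toReal_div, ENNReal.toReal_mul, ENNReal.toReal_pow, ENNReal.coe_toReal,
    ENNReal.toReal_ofNat] at e1
  have h3 : (5 * (e:ℝ) ^ 2) / (40 * e) = e / 8 := by field_simp; norm_num
  rw [h3] at e1
  have h4 : (1:ℝ) / 80 ≤ Q := by
    by_contra h
    push Not at h
    nlinarith
  have : ((1 / 80 : NNReal) : ℝ≥0∞) ≤ Q := by
    rw [ENNReal.coe_le_coe, ← NNReal.coe_le_coe]; simpa using h4
  refine le_trans (le_of_eq ?_) this
  rw [ENNReal.coe_div (by norm_num)]; simp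

variable {Ω : Type u} [MeasurableSpace Ω] (μ : Measure Ω) [IsProbabilityMeasure μ] {n : ℕ}

lemma second_moment (X : Fin n → Ω → ℝ≥0∞) (hX : ∀ i, Measurable (X i)) (τ : ℝ≥0∞)
    (hτ : ∀ i ξ, X i ξ ≤ τ) :
    ∫⁻ x, (∑ i, X i (x i)) ^ 2 ∂(Measure.pi fun _ : Fin n => μ)
      ≤ (∑ i, ∫⁻ ξ, X i ξ ∂μ) ^ 2 + τ * ∑ i, ∫⁻ ξ, X i ξ ∂μ := by
  have h1 : ∀ x : Fin n → Ω, (∑ i, X i (x i)) ^ 2 = ∑ i, ∑ j, X i (x i) * X j (x j) := by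
    intro x; rw [sq, Finset.sum_mul_sum]
  simp_rw [h1]
  rw [lintegral_finsetSum _ (fun i _ => by fun_prop)]
  have h2 : ∀ i, ∫⁻ x, ∑ j, X i (x i) * X j (x j) ∂(Measure.pi fun _ : Fin n => μ)
      ≤ (∫⁻ ξ, X i ξ ∂μ) * (∑ j, ∫⁻ ξ, X j ξ ∂μ) + τ * ∫⁻ ξ, X i ξ ∂μ := by
    intro i
    rw [lintegral_finsetSum _ (fun i _ => by fun_prop)]
    have h3 : ∀ j, ∫⁻ x, X i (x i) * X j (x j) ∂(Measure.pi fun _ : Fin n => μ)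
        ≤ (∫⁻ ξ, X i ξ ∂μ) * (∫⁻ ξ, X j ξ ∂μ) + if j = i then τ * ∫⁻ ξ, X i ξ ∂μ else 0 := by
      intro j
      by_cases hj : j = i
      · subst hj
        rw [if_pos rfl]
        refine le_trans ?_ le_add_self
        rw [← lintegral_const_mul _ (hX j), ← lintegral_ev μ j ((hX j).const_mul τ)]
        exact lintegral_mono fun x => mul_le_mul_left (hτ _ _) _
      · rw [if_neg hj, add_zero]
        rw [lintegral_pair μ (Ne.symm hj) (h := fun ξ υ => X i ξ * X j υ) (by
          unfold Function.uncurry; fun_prop)]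
        simp_rw [lintegral_const_mul _ (hX j)]
        rw [lintegral_mul_const _ (hX i)]
    refine (Finset.sum_le_sum fun j _ => h3 j).trans ?_
    rw [Finset.sum_add_distrib, ← Finset.mul_sum]
    simp
  refine (Finset.sum_le_sum fun j _ => h2 j).trans ?_
  rw [Finset.sum_add_distrib, ← Finset.sum_mul, ← Finset.mul_sum, sq]

end FO

section FO
variable {Ω : Type u} [MeasurableSpace Ω] (μ : Measure Ω) [IsProbabilityMeasure μ] {n : ℕ}

lemma first_order_small {q : ℝ} (hq : 1 / 2 ≤ q)
    (W : Fin n → Ω → ℝ≥0∞) (hW : ∀ i, Measurable (W i))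
    (U : Fin n → (Fin n → Ω) → ℝ≥0∞) (hU : ∀ i, Measurable (U i))
    (hUW : ∀ i x, U i x ≤ W i (x i))
    (H : ∀ i ξ (t : ℝ≥0∞), t ≠ ⊤ → min (W i ξ) t / 2 ≤
      ∫⁻ x, min (U i (Function.update x i ξ)) t ∂(Measure.pi fun _ : Fin n => μ))
    (τ : ℝ≥0∞)
    (hτ : ∫⁻ x, (∑ i, U i x) ^ q ∂(Measure.pi fun _ : Fin n => μ) ≤ (τ / 2 ^ 20) ^ q) :
    ∑ i, ∫⁻ ξ, min (W i ξ) τ ∂μ ≤ τ / 4 := by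
  rcases eq_or_ne τ ⊤ with rfl | hτt
  · rw [ENNReal.top_div_of_ne_top (by norm_num)]; exact le_top
  by_contra hcon
  push Not at hcon
  set e := ∑ i, ∫⁻ ξ, min (W i ξ) τ ∂μ with he
  have he0 : e ≠ 0 := (lt_of_le_of_lt zero_le hcon).ne'
  have het : e ≠ ⊤ := by
    rw [he]
    refine ENNReal.sum_ne_top.2 fun i _ => ?_
    refine ne_top_of_le_ne_top hτt ?_
    calc ∫⁻ ξ, min (W i ξ) τ ∂μ ≤ ∫⁻ ξ, τ ∂μ := lintegral_mono fun _ => min_le_right _ _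
      _ = τ := by simp
  have hmX : ∀ i, Measurable fun ξ => min (W i ξ) τ := fun i => (hW i).min measurable_const
  have hmU : ∀ i, Measurable fun x => min (U i x) τ := fun i => (hU i).min measurable_const
  have hτe : τ ≤ 4 * e := by
    have := (ENNReal.div_le_iff (by norm_num) (by norm_num)).1 hcon.le
    rwa [mul_comm]
  have h2 := second_moment μ (fun i ξ => min (W i ξ) τ) hmX τ (fun _ _ => min_le_right _ _)
  rw [← he] at h2
  have h2' : ∫⁻ x, (∑ i, min (W i (x i)) τ) ^ 2 ∂(Measure.pi fun _ : Fin n => μ) ≤ 5 * e ^ 2 := by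
    refine h2.trans ?_
    calc e ^ 2 + τ * e ≤ e ^ 2 + (4 * e) * e := by gcongr
      _ = 5 * e ^ 2 := by ring
  have h1 : e / 2 ≤ ∫⁻ x, ∑ i, min (U i x) τ ∂(Measure.pi fun _ : Fin n => μ) := by
    rw [lintegral_finsetSum _ (fun i _ => hmU i), he, div_eq_mul_inv, Finset.sum_mul]
    refine Finset.sum_le_sum fun i _ => ?_
    rw [lintegral_upd μ i (hmU i), ← lintegral_mul_const _ (hmX i)]
    exact lintegral_mono fun ξ => H i ξ τ hτt
  have hp := paley (Measure.pi fun _ : Fin n => μ) (X := fun x => ∑ i, min (W i (x i)) τ)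
    (Y := fun x => ∑ i, min (U i x) τ) (by
      refine Finset.measurable_sum _ fun i _ => (hmX i).comp (measurable_pi_apply i))
      (Finset.measurable_sum _ fun i _ => hmU i)
    (fun x => Finset.sum_le_sum fun i _ => min_le_min_right _ (hUW i x)) he0 het h1 h2'
  have hq0 : 0 < q := by linarith
  have hmark : (e / 4) ^ q * (1 / 80) ≤ (e / 4) ^ q * (1 / 2 ^ 8) := by
    calc (e / 4) ^ q * (1 / 80)
        ≤ (e / 4) ^ q * (Measure.pi fun _ : Fin n => μ) {x | e / 4 < ∑ i, min (U i x) τ} := by gcongr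
      _ ≤ (e / 4) ^ q * (Measure.pi fun _ : Fin n => μ) {x | (e / 4) ^ q ≤ (∑ i, U i x) ^ q} := by
          gcongr
          intro hx
          exact ENNReal.rpow_le_rpow
            (hx.le.trans (Finset.sum_le_sum fun i _ => min_le_left _ _)) hq0.le
      _ ≤ ∫⁻ x, (∑ i, U i x) ^ q ∂(Measure.pi fun _ : Fin n => μ) :=
          mul_meas_ge_le_lintegral ((Finset.measurable_sum _ fun i _ => hU i).pow_const q) _
      _ ≤ _ := hτ
      _ ≤ ((e / 4) * (1 / 2 ^ 16)) ^ q := by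
          refine ENNReal.rpow_le_rpow ?_ hq0.le
          rw [ENNReal.div_le_iff (by norm_num) (by norm_num)]
          refine hτe.trans (le_of_eq ?_)
          have : (4:ℝ≥0∞) = 4⁻¹ * (1 / 2 ^ 16) * 2 ^ 20 := by
            rw [← ENNReal.toReal_eq_toReal_iff' (by norm_num) (by
              refine ENNReal.mul_ne_top (ENNReal.mul_ne_top (by norm_num) ?_) (by norm_num)
              exact ENNReal.div_ne_top (by norm_num) (by norm_num))]
            simp [ENNReal.toReal_mul, ENNReal.toReal_inv, ENNReal.toReal_pow]
            norm_num
          calc 4 * e = (4⁻¹ * (1 / 2 ^ 16) * 2 ^ 20) * e := by rw [← this]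
            _ = _ := by rw [div_eq_mul_inv e 4]; ring
      _ = (e / 4) ^ q * (1 / 2 ^ 16) ^ q := ENNReal.mul_rpow_of_nonneg _ _ hq0.le
      _ ≤ _ := by
          gcongr
          calc (1 / 2 ^ 16 : ℝ≥0∞) ^ q ≤ (1 / 2 ^ 16 : ℝ≥0∞) ^ (1 / 2 : ℝ) :=
                ENNReal.rpow_le_rpow_of_exponent_ge (by
                  rw [ENNReal.div_le_iff (by norm_num) (by norm_num)]; norm_num) hq
            _ = ((1 / 2 ^ 8 : ℝ≥0∞) ^ (2 : ℝ)) ^ (1 / 2 : ℝ) := by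
                congr 1
                rw [ENNReal.rpow_ofNat]
                simp only [one_div, ← ENNReal.inv_pow]
                rw [← pow_mul]
            _ = 1 / 2 ^ 8 := by rw [← ENNReal.rpow_mul]; norm_num
  have he4 : (e / 4) ^ q ≠ 0 := by
    rw [Ne, ENNReal.rpow_eq_zero_iff_of_pos hq0]
    simp [he0]
  have he4t : (e / 4) ^ q ≠ ⊤ := by
    rw [Ne, ENNReal.rpow_eq_top_iff_of_pos hq0]
    exact ENNReal.div_ne_top het (by norm_num)
  rw [ENNReal.mul_le_mul_iff_right he4 he4t] at hmark
  have := ENNReal.toReal_mono (ENNReal.div_ne_top (by norm_num) (by norm_num)) hmark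
  norm_num [ENNReal.toReal_div, ENNReal.toReal_inv, ENNReal.toReal_pow] at this

lemma first_order_large {q : ℝ} (hq : 1 / 2 ≤ q) (hq1 : q ≤ 1)
    (W : Fin n → Ω → ℝ≥0∞) (hW : ∀ i, Measurable (W i))
    (U : Fin n → (Fin n → Ω) → ℝ≥0∞) (hU : ∀ i, Measurable (U i))
    (hUW : ∀ i x, U i x ≤ W i (x i))
    (H : ∀ i ξ (t : ℝ≥0∞), t ≠ ⊤ → min (W i ξ) t / 2 ≤
      ∫⁻ x, min (U i (Function.update x i ξ)) t ∂(Measure.pi fun _ : Fin n => μ))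
    (τ : ℝ≥0∞)
    (hτ : ∫⁻ x, (∑ i, U i x) ^ q ∂(Measure.pi fun _ : Fin n => μ) ≤ (τ / 2 ^ 20) ^ q) :
    ∑ i, ∫⁻ ξ, {ξ | τ < W i ξ}.indicator (fun ξ => W i ξ ^ q) ξ ∂μ
      ≤ 4 * ∫⁻ x, (∑ i, U i x) ^ q ∂(Measure.pi fun _ : Fin n => μ) := by
  have hq0 : 0 < q := by linarith
  rcases eq_or_ne τ ⊤ with rfl | hτt
  · simp
  have hsm := first_order_small μ hq W hW U hU hUW H τ hτ
  rcases eq_or_ne τ 0 with rfl | hτ0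
  · -- everything vanishes
    have hz : ∫⁻ x, (∑ i, U i x) ^ q ∂(Measure.pi fun _ : Fin n => μ) = 0 := by
      rw [ENNReal.zero_div, ENNReal.zero_rpow_of_pos hq0] at hτ
      exact le_antisymm hτ zero_le
    rw [lintegral_eq_zero_iff ((Finset.measurable_sum _ fun i _ => hU i).pow_const q)] at hz
    have hUz : ∀ i, ∀ᵐ x ∂(Measure.pi fun _ : Fin n => μ), U i x = 0 := by
      intro i
      filter_upwards [hz] with x hx
      simp only [Pi.zero_apply, ENNReal.rpow_eq_zero_iff_of_pos hq0, Finset.sum_eq_zero_iff,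
        Finset.mem_univ, true_imp_iff] at hx
      exact hx i
    have hWz : ∀ i, ∀ᵐ ξ ∂μ, W i ξ = 0 := by
      intro i
      have h0 : ∫⁻ x, min (U i x) 1 ∂(Measure.pi fun _ : Fin n => μ) = 0 := by
        rw [lintegral_eq_zero_iff ((hU i).min measurable_const)]
        filter_upwards [hUz i] with x hx
        simp [hx]
      rw [lintegral_upd μ i ((hU i).min measurable_const)] at h0
      have h1 : ∫⁻ ξ, min (W i ξ) 1 / 2 ∂μ = 0 :=
        le_antisymm ((lintegral_mono fun ξ => H i ξ 1 (by norm_num)).trans h0.le) zero_le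
      rw [lintegral_eq_zero_iff (((hW i).min measurable_const).div_const 2)] at h1
      filter_upwards [h1] with ξ hξ
      simp only [Pi.zero_apply, ENNReal.div_eq_zero_iff] at hξ
      rcases hξ with hξ | hξ
      · rcases min_eq_bot.1 hξ with h | h
        · exact h
        · simp at h
      · simp at hξ
    refine le_trans (le_of_eq ?_) zero_le
    refine Finset.sum_eq_zero fun i _ => ?_
    rw [lintegral_congr_ae (g := fun _ => 0)]
    · simp
    · filter_upwards [hWz i] with ξ hξ
      rw [Set.indicator_of_notMem]
      simp [hξ]
  have hPB : ∑ i, μ {ξ | τ < W i ξ} ≤ 1 / 4 := by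
    rw [← ENNReal.mul_le_mul_iff_right hτ0 hτt, Finset.mul_sum]
    calc ∑ i, τ * μ {ξ | τ < W i ξ} ≤ ∑ i, ∫⁻ ξ, min (W i ξ) τ ∂μ := by
          refine Finset.sum_le_sum fun i _ => ?_
          rw [← lintegral_indicator_const (measurableSet_lt measurable_const (hW i))]
          refine lintegral_mono fun ξ => ?_
          by_cases h : τ < W i ξ
          · rw [Set.indicator_of_mem (by exact h)]; exact le_min h.le le_rfl
          · rw [Set.indicator_of_notMem (by exact h)]; exact zero_le
      _ ≤ τ / 4 := hsm
      _ = τ * (1 / 4) := by rw [one_div, div_eq_mul_inv]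
  set π := (Measure.pi fun _ : Fin n => μ) with hπ
  set G : Fin n → Set (Fin n → Ω) := fun i => {x | ∀ j, j ≠ i → W j (x j) ≤ τ} with hG
  have hGm : ∀ i, MeasurableSet (G i) := by
    intro i
    have : G i = ⋂ j, ⋂ (_ : j ≠ i), {x | W j (x j) ≤ τ} := by ext; simp [hG]
    rw [this]
    refine MeasurableSet.iInter fun j => MeasurableSet.iInter fun _ => ?_
    exact measurableSet_le ((hW j).comp (measurable_pi_apply j)) measurable_const
  have hGc : ∀ i, π (G i)ᶜ ≤ 1 / 4 := by
    intro i
    refine le_trans ?_ hPB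
    calc π (G i)ᶜ ≤ π (⋃ j, {x | τ < W j (x j)}) := by
          refine measure_mono fun x hx => ?_
          simp only [hG, Set.mem_compl_iff, Set.mem_ofPred_eq, not_forall, not_le] at hx
          obtain ⟨j, _, hj⟩ := hx
          exact Set.mem_iUnion.2 ⟨j, hj⟩
      _ ≤ ∑ j, π {x | τ < W j (x j)} := measure_iUnion_fintype_le _ _
      _ = ∑ j, μ {ξ | τ < W j ξ} := by
          refine Finset.sum_congr rfl fun j _ => ?_
          exact (measurePreserving_eval (fun _ : Fin n => μ) j).measure_preimage
            (measurableSet_lt measurable_const (hW j)).nullMeasurableSet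
  have hupdm : ∀ i (ξ : Ω), Measurable fun x : Fin n → Ω => Function.update x i ξ := by
    intro i ξ
    exact (mp_update μ i).measurable.comp (measurable_const.prodMk measurable_id)
  have hfin : ∀ i ξ (t : ℝ≥0∞), t ≠ ⊤ → t ≤ W i ξ →
      t ^ q / 4 ≤ ∫⁻ x, (G i).indicator (fun x => U i (Function.update x i ξ) ^ q) x ∂π := by
    intro i ξ t ht htW
    rcases eq_or_ne t 0 with rfl | ht0
    · simp [hq0]
    have h1 := H i ξ t ht
    rw [min_eq_right htW] at h1
    have hm : Measurable fun x => min (U i (Function.update x i ξ)) t :=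
      ((hU i).comp (hupdm i ξ)).min measurable_const
    have h2 : t / 2 ≤ t ^ (1 - q) *
        ∫⁻ x, (G i).indicator (fun x => U i (Function.update x i ξ) ^ q) x ∂π + t / 4 := by
      calc t / 2 ≤ _ := h1
        _ ≤ ∫⁻ x, t ^ (1 - q) * (G i).indicator (fun x => U i (Function.update x i ξ) ^ q) x
              + (G i)ᶜ.indicator (fun _ => t) x ∂π := by
            refine lintegral_mono fun x => ?_
            by_cases hx : x ∈ G i
            · rw [Set.indicator_of_mem hx, Set.indicator_of_notMem (by simpa using hx), add_zero]
              set v := U i (Function.update x i ξ)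
              calc min v t = min v t ^ ((1 - q) + q) := by norm_num
                _ = min v t ^ (1 - q) * min v t ^ q :=
                    ENNReal.rpow_add_of_nonneg _ _ (by linarith) hq0.le
                _ ≤ t ^ (1 - q) * v ^ q := by
                    refine mul_le_mul' (ENNReal.rpow_le_rpow (min_le_right _ _) (by linarith))
                      (ENNReal.rpow_le_rpow (min_le_left _ _) hq0.le)
            · rw [Set.indicator_of_notMem hx, Set.indicator_of_mem (by simpa using hx)]
              simp
        _ = t ^ (1 - q) * ∫⁻ x, (G i).indicator (fun x => U i (Function.update x i ξ) ^ q) x ∂π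
              + t * π (G i)ᶜ := by
            rw [lintegral_add_right _ (measurable_const.indicator (hGm i).compl),
              lintegral_const_mul' _ _ (ENNReal.rpow_ne_top_of_nonneg (by linarith) ht),
              lintegral_indicator_const (hGm i).compl]
        _ ≤ _ := by
            gcongr
            calc t * π (G i)ᶜ ≤ t * (1 / 4) := by gcongr; exact hGc i
              _ = t / 4 := by rw [one_div, div_eq_mul_inv]
    have h3 : t / 4 ≤ t ^ (1 - q) *
        ∫⁻ x, (G i).indicator (fun x => U i (Function.update x i ξ) ^ q) x ∂π := by
      have h4 : t / 2 = t / 4 + t / 4 := by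
        rw [← ENNReal.add_div, ← two_mul, mul_comm 2 t, div_eq_mul_inv, div_eq_mul_inv, mul_assoc]
        congr 1
        rw [← ENNReal.toReal_eq_toReal_iff' (by norm_num) (by
          exact ENNReal.mul_ne_top (by norm_num) (by norm_num))]
        simp [ENNReal.toReal_mul, ENNReal.toReal_inv]
        norm_num
      rw [h4] at h2
      exact (ENNReal.add_le_add_iff_right (ENNReal.div_ne_top ht (by norm_num))).1 h2
    have h5 : t = t ^ (1 - q) * t ^ q := by
      rw [← ENNReal.rpow_add_of_nonneg _ _ (by linarith) hq0.le]; norm_num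
    have h6 : t ^ (1 - q) ≠ 0 := by
      intro h
      rw [h, zero_mul] at h5; exact ht0 h5
    have h7 : t ^ (1 - q) ≠ ⊤ := ENNReal.rpow_ne_top_of_nonneg (by linarith) ht
    rw [← ENNReal.mul_le_mul_iff_right h6 h7]
    refine le_trans (le_of_eq ?_) h3
    conv_rhs => rw [h5]
    rw [mul_div_assoc]
  have hpt : ∀ i ξ, W i ξ ^ q ≤
      4 * ∫⁻ x, (G i).indicator (fun x => U i (Function.update x i ξ) ^ q) x ∂π := by
    intro i ξ
    rw [mul_comm, ← ENNReal.div_le_iff (by norm_num) (by norm_num)]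
    rcases eq_or_ne (W i ξ) ⊤ with hWt | hWt
    · set I := ∫⁻ x, (G i).indicator (fun x => U i (Function.update x i ξ) ^ q) x ∂π with hI
      have : I = ⊤ := by
        by_contra hIt
        have h1 := hfin i ξ ((I * 4 + 1) ^ (1 / q)) (by
          refine ENNReal.rpow_ne_top_of_nonneg (by positivity) ?_
          exact ENNReal.add_ne_top.2 ⟨ENNReal.mul_ne_top hIt (by norm_num), by norm_num⟩)
          (by rw [hWt]; exact le_top)
        rw [← hI, ← ENNReal.rpow_mul, one_div, inv_mul_cancel₀ hq0.ne', ENNReal.rpow_one,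
          ENNReal.div_le_iff (by norm_num) (by norm_num)] at h1
        exact absurd h1 (not_le.2 (ENNReal.lt_add_right (ENNReal.mul_ne_top hIt (by norm_num))
          (by norm_num)))
      rw [this]; exact le_top
    · exact hfin i ξ _ hWt le_rfl
  -- assemble
  have hVm : ∀ i, Measurable fun x : Fin n → Ω =>
      {x : Fin n → Ω | τ < W i (x i)}.indicator ((G i).indicator fun x => U i x ^ q) x := by
    intro i
    refine Measurable.indicator (Measurable.indicator ((hU i).pow_const q) (hGm i)) ?_
    exact measurableSet_lt measurable_const ((hW i).comp (measurable_pi_apply i))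
  have hone : ∀ i, ∫⁻ ξ, {ξ | τ < W i ξ}.indicator (fun ξ => W i ξ ^ q) ξ ∂μ ≤
      4 * ∫⁻ x, {x : Fin n → Ω | τ < W i (x i)}.indicator ((G i).indicator fun x => U i x ^ q) x ∂π := by
    intro i
    rw [lintegral_upd μ i (hVm i), ← lintegral_const_mul' _ _ (by norm_num)]
    refine lintegral_mono fun ξ => ?_
    by_cases h : τ < W i ξ
    · rw [Set.indicator_of_mem (by exact h)]
      refine (hpt i ξ).trans (le_of_eq ?_)
      congr 1
      refine lintegral_congr fun x => ?_
      rw [Set.indicator_of_mem (a := Function.update x i ξ) (by simpa using h)]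
      have hiff : Function.update x i ξ ∈ G i ↔ x ∈ G i := by
        simp only [hG, Set.mem_ofPred_eq]
        refine forall_congr' fun j => forall_congr' fun hj => ?_
        rw [Function.update_of_ne hj]
      by_cases hx : x ∈ G i
      · rw [Set.indicator_of_mem hx, Set.indicator_of_mem (hiff.2 hx)]
      · rw [Set.indicator_of_notMem hx, Set.indicator_of_notMem (fun h => hx (hiff.1 h))]
    · rw [Set.indicator_of_notMem (by exact h)]; exact zero_le
  refine (Finset.sum_le_sum fun i _ => hone i).trans ?_
  rw [← Finset.mul_sum]
  gcongr
  rw [← lintegral_finsetSum _ (fun i _ => hVm i)]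
  refine lintegral_mono fun x => ?_
  by_cases hex : ∃ i, τ < W i (x i) ∧ x ∈ G i
  · obtain ⟨i, hi, hGi⟩ := hex
    rw [Finset.sum_eq_single i]
    · rw [Set.indicator_of_mem (by exact hi), Set.indicator_of_mem hGi]
      exact ENNReal.rpow_le_rpow (Finset.single_le_sum (f := fun i => U i x)
        (fun _ _ => zero_le) (Finset.mem_univ i)) hq0.le
    · intro j _ hj
      rw [Set.indicator_of_notMem]
      exact not_lt.2 (hGi j hj)
    · simp
  · refine le_trans (le_of_eq ?_) zero_le
    refine Finset.sum_eq_zero fun i _ => ?_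
    by_cases h1 : τ < W i (x i)
    · rw [Set.indicator_of_mem (by exact h1), Set.indicator_of_notMem]
      exact fun h2 => hex ⟨i, h1, h2⟩
    · rw [Set.indicator_of_notMem (by exact h1)]

end FO

section DEC

lemma trunc_half_fin {α β : Type*} [MeasurableSpace α] [MeasurableSpace β]
    (P : Measure α) [IsProbabilityMeasure P] (ν : Measure β) [IsFiniteMeasure ν]
    (Z : β → ℝ≥0∞) (hZ : Measurable Z) (Θ : Set (α × β)) (hΘ : MeasurableSet Θ)
    (h : ∀ y, Z y ≠ 0 → 1 / 2 ≤ P {x | (x, y) ∈ Θ}) (t : ℝ≥0∞) (hI : ∫⁻ y, Z y ∂ν ≠ ⊤) :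
    min (∫⁻ y, Z y ∂ν) t / 2 ≤
      ∫⁻ x, min (∫⁻ y, Θ.indicator (fun z => Z z.2) (x, y) ∂ν) t ∂P := by
  set I := ∫⁻ y, Z y ∂ν with hIdef
  rcases eq_or_ne I 0 with h0 | h0
  · simp [h0]
  set r := min I t / I with hr
  have hr1 : r ≤ 1 := by
    rw [hr]; exact ENNReal.div_le_of_le_mul (by simp)
  have hrI : r * I = min I t := ENNReal.div_mul_cancel h0 hI
  have hrt : r ≠ ⊤ := ne_top_of_le_ne_top (by norm_num) hr1
  have hm : Measurable (Θ.indicator fun z : α × β => Z z.2) :=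
    (hZ.comp measurable_snd).indicator hΘ
  calc min I t / 2 = r * (I / 2) := by rw [← hrI, mul_div_assoc]
    _ ≤ r * ∫⁻ y, ∫⁻ x, Θ.indicator (fun z => Z z.2) (x, y) ∂P ∂ν := by
        gcongr
        rw [hIdef, div_eq_mul_inv, ← lintegral_mul_const _ hZ]
        refine lintegral_mono fun y => ?_
        have e1 : ∀ x, Θ.indicator (fun z : α × β => Z z.2) (x, y)
            = {x | (x, y) ∈ Θ}.indicator (fun _ => Z y) x := by
          intro x; simp [Set.indicator]
        simp_rw [e1]
        have hms : MeasurableSet {x | (x, y) ∈ Θ} := hΘ.preimage measurable_prodMk_right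
        rw [lintegral_indicator_const hms]
        rcases eq_or_ne (Z y) 0 with hz | hz
        · simp [hz]
        · have := h y hz
          rw [one_div] at this
          gcongr
    _ = r * ∫⁻ x, ∫⁻ y, Θ.indicator (fun z => Z z.2) (x, y) ∂ν ∂P := by
        rw [lintegral_lintegral_swap]
        exact (hm.comp measurable_swap).aemeasurable
    _ = ∫⁻ x, r * ∫⁻ y, Θ.indicator (fun z => Z z.2) (x, y) ∂ν ∂P :=
        (lintegral_const_mul' _ _ hrt).symm
    _ ≤ _ := by
        refine lintegral_mono fun x => le_min ?_ ?_
        · exact (mul_le_mul_left hr1 _).trans (by rw [one_mul])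
        · calc r * ∫⁻ y, Θ.indicator (fun z => Z z.2) (x, y) ∂ν ≤ r * I := by
                gcongr
                exact lintegral_mono fun y => Set.indicator_le_self Θ (fun z => Z z.2) (x, y)
            _ ≤ t := by rw [hrI]; exact min_le_right _ _

lemma trunc_half {α β : Type*} [MeasurableSpace α] [MeasurableSpace β]
    (P : Measure α) [IsProbabilityMeasure P] (ν : Measure β) [IsFiniteMeasure ν]
    (Z : β → ℝ≥0∞) (hZ : Measurable Z) (Θ : Set (α × β)) (hΘ : MeasurableSet Θ)
    (h : ∀ y, Z y ≠ 0 → 1 / 2 ≤ P {x | (x, y) ∈ Θ}) (t : ℝ≥0∞) (ht : t ≠ ⊤) :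
    min (∫⁻ y, Z y ∂ν) t / 2 ≤
      ∫⁻ x, min (∫⁻ y, Θ.indicator (fun z => Z z.2) (x, y) ∂ν) t ∂P := by
  rcases eq_or_ne (∫⁻ y, Z y ∂ν) ⊤ with hI | hI
  swap
  · exact trunc_half_fin P ν Z hZ Θ hΘ h t hI
  have hsup : ∫⁻ y, Z y ∂ν = ⨆ k : ℕ, ∫⁻ y, min (Z y) k ∂ν := by
    rw [← lintegral_iSup (fun k => hZ.min measurable_const)]
    · refine lintegral_congr fun y => ?_
      rw [← inf_iSup_eq (Z y) (fun k : ℕ => (k : ℝ≥0∞)), ENNReal.iSup_natCast]; simp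
    · intro a b hab y
      exact min_le_min_left _ (by exact_mod_cast hab)
  have hlt : t < ⨆ k : ℕ, ∫⁻ y, min (Z y) k ∂ν := by
    rw [← hsup, hI]; exact ht.lt_top
  obtain ⟨k, hk⟩ := lt_iSup_iff.1 hlt
  have hfin : ∫⁻ y, min (Z y) k ∂ν ≠ ⊤ := by
    refine ne_top_of_le_ne_top ?_ (lintegral_mono fun y => min_le_right (Z y) (k:ℝ≥0∞))
    rw [lintegral_const]
    exact ENNReal.mul_ne_top (by simp) (measure_ne_top _ _)
  have := trunc_half_fin P ν (fun y => min (Z y) k) (hZ.min measurable_const) Θ hΘ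
    (fun y hy => h y (fun h0 => hy (by simp [h0]))) t hfin
  rw [hI, min_eq_right le_top]
  rw [min_eq_right hk.le] at this
  refine this.trans (lintegral_mono fun x => min_le_min_right _ (lintegral_mono fun y => ?_))
  exact Set.indicator_le_indicator (min_le_left _ _)

variable {Ω : Type u} [MeasurableSpace Ω] (μ : Measure Ω) [IsProbabilityMeasure μ] {n : ℕ}

lemma meas_fin_prod {γ : Type*} [MeasurableSpace γ] {h : Fin n → Ω → γ} (hh : ∀ j, Measurable (h j)) :
    Measurable fun z : Fin n × Ω => h z.1 z.2 :=
  measurable_from_prod_countable_right hh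

lemma sum_lint_eq {h : Fin n → Ω → ℝ≥0∞} (hh : ∀ j, Measurable (h j)) :
    ∑ j, ∫⁻ υ, h j υ ∂μ = ∫⁻ z, h z.1 z.2 ∂((Measure.count : Measure (Fin n)).prod μ) := by
  rw [lintegral_prod _ (meas_fin_prod hh).aemeasurable, lintegral_count, tsum_fintype]

lemma rpow_div_K {q : ℝ} (hq0 : 0 < q) (M : ℝ≥0∞) :
    ((2 ^ 20 * M ^ (1 / q)) / 2 ^ 20) ^ q = M := by
  rw [mul_comm, ENNReal.mul_div_cancel_right (by norm_num) (by norm_num), ← ENNReal.rpow_mul,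
    one_div, inv_mul_cancel₀ hq0.ne', ENNReal.rpow_one]

lemma rpow_four_K {q : ℝ} (hq0 : 0 < q) (hq1 : q ≤ 1) (M : ℝ≥0∞) :
    ((2 ^ 20 * M ^ (1 / q)) / 4) ^ q ≤ 2 ^ 20 * M := by
  calc ((2 ^ 20 * M ^ (1 / q)) / 4) ^ q ≤ (2 ^ 20 * M ^ (1 / q)) ^ q := by
        refine ENNReal.rpow_le_rpow ?_ hq0.le
        refine ENNReal.div_le_of_le_mul ?_
        exact le_mul_of_one_le_right zero_le (by norm_num)
    _ = (2 ^ 20) ^ q * M := by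
        rw [ENNReal.mul_rpow_of_nonneg _ _ hq0.le, ← ENNReal.rpow_mul,
          one_div, inv_mul_cancel₀ hq0.ne', ENNReal.rpow_one]
    _ ≤ (2 ^ 20) ^ (1:ℝ) * M := by
        gcongr
        · norm_num
    _ = _ := by rw [ENNReal.rpow_one]

end DEC

section DEC
variable {Ω : Type u} [MeasurableSpace Ω] (μ : Measure Ω) [IsProbabilityMeasure μ] {n : ℕ}

lemma nonneg_decomp {q : ℝ} (hq : 1 / 2 ≤ q) (hq1 : q ≤ 1)
    (F : Fin n → Fin n → Ω × Ω → ℝ≥0∞) (hF : ∀ i j, Measurable (F i j)) (E : ℝ≥0∞)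
    (hE : E = ∫⁻ x, ∫⁻ y, (∑ j, ∑ i, F i j (x i, y j)) ^ q ∂(Measure.pi fun _ : Fin n => μ)
      ∂(Measure.pi fun _ : Fin n => μ)) :
    ∃ R S1 S2 : Fin n → Fin n → Set (Ω × Ω),
      (∀ i j, MeasurableSet (R i j)) ∧ (∀ i j, MeasurableSet (S1 i j)) ∧
      (∀ i j, MeasurableSet (S2 i j)) ∧
      (∑ i, ∑ j, ∫⁻ ξ, ∫⁻ υ, (R i j ∩ S1 i j).indicator (F i j) (ξ, υ) ∂μ ∂μ
        ≤ 2 ^ 20 * (2 ^ 20 * E) ^ (1 / q)) ∧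
      (∑ i, ∑ j, ∫⁻ ξ, ∫⁻ υ, ((R i j)ᶜ ∩ (S2 i j)ᶜ).indicator (F i j) (ξ, υ) ^ q ∂μ ∂μ
        ≤ 16 * E) ∧
      (∑ i, ∫⁻ ξ, (∑ j, ∫⁻ υ, (R i j ∩ (S1 i j)ᶜ).indicator (F i j) (ξ, υ) ∂μ) ^ q ∂μ
        ≤ 2 ^ 22 * E) ∧
      (∑ j, ∫⁻ υ, (∑ i, ∫⁻ ξ, ((R i j)ᶜ ∩ S2 i j).indicator (F i j) (ξ, υ) ∂μ) ^ q ∂μ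
        ≤ 2 ^ 22 * E) := by
  have hq0 : 0 < q := by linarith
  set π := (Measure.pi fun _ : Fin n => μ) with hπ
  -- column sums
  set G : Fin n → (Fin n → Ω) → Ω → ℝ≥0∞ := fun j x υ => ∑ i, F i j (x i, υ) with hGdef
  have hGm : ∀ j, Measurable fun z : (Fin n → Ω) × Ω => G j z.1 z.2 := by
    intro j
    refine Finset.measurable_sum _ fun i _ => ?_
    exact (hF i j).comp (by fun_prop)
  have hGm' : ∀ j x, Measurable (G j x) := fun j x =>
    (hGm j).comp (measurable_const.prodMk measurable_id)
  set M : (Fin n → Ω) → ℝ≥0∞ := fun x => ∫⁻ y, (∑ j, G j x (y j)) ^ q ∂π with hMdef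
  have hMm : Measurable M := by
    refine Measurable.lintegral_prod_right' (f := fun z : (Fin n → Ω) × (Fin n → Ω) =>
      (∑ j, G j z.1 (z.2 j)) ^ q) ?_
    refine Measurable.pow_const (Finset.measurable_sum _ fun j _ => ?_) q
    exact (hGm j).comp (f := fun z : (Fin n → Ω) × (Fin n → Ω) => (z.1, z.2 j)) (by fun_prop)
  have hEM : ∫⁻ x, M x ∂π = E := by rw [hE]
  set t : (Fin n → Ω) → ℝ≥0∞ := fun x => 2 ^ 20 * M x ^ (1 / q) with htdef
  have htm : Measurable t := (hMm.pow_const _).const_mul _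
  -- step A
  have hHA : ∀ x : Fin n → Ω, ∀ j υ (s : ℝ≥0∞), s ≠ ⊤ → min (G j x υ) s / 2 ≤
      ∫⁻ y, min (G j x (Function.update y j υ j)) s ∂π := by
    intro x j υ s _
    simp only [Function.update_self, lintegral_const, measure_univ, mul_one]
    exact ENNReal.half_le_self
  have hA1 : ∀ x, ∑ j, ∫⁻ υ, min (G j x υ) (t x) ∂μ ≤ t x / 4 := fun x =>
    first_order_small μ hq (fun j => G j x) (fun j => hGm' j x) (fun j y => G j x (y j))
      (fun j => (hGm' j x).comp (measurable_pi_apply j)) (fun _ _ => le_rfl) (hHA x) (t x)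
      (by rw [htdef, rpow_div_K hq0])
  have hA2 : ∀ x, ∑ j, ∫⁻ υ, {υ | t x < G j x υ}.indicator (fun υ => G j x υ ^ q) υ ∂μ
      ≤ 4 * M x := fun x =>
    first_order_large μ hq hq1 (fun j => G j x) (fun j => hGm' j x) (fun j y => G j x (y j))
      (fun j => (hGm' j x).comp (measurable_pi_apply j)) (fun _ _ => le_rfl) (hHA x) (t x)
      (by rw [htdef, rpow_div_K hq0])
  -- the sets
  set T : Fin n → Set ((Fin n → Ω) × Ω) := fun j => {z | G j z.1 z.2 ≤ t z.1} with hTdef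
  have hTm : ∀ j, MeasurableSet (T j) := fun j =>
    measurableSet_le (hGm j) (htm.comp measurable_fst)
  have hupm : ∀ i, Measurable fun z : Ω × (Fin n → Ω) => Function.update z.2 i z.1 :=
    fun i => (mp_update μ i).measurable
  have hρT : ∀ i j, MeasurableSet {z : (Ω × Ω) × (Fin n → Ω) |
      (Function.update z.2 i z.1.1, z.1.2) ∈ T j} := by
    intro i j
    refine (hTm j).preimage (f := fun z : (Ω × Ω) × (Fin n → Ω) =>
      (Function.update z.2 i z.1.1, z.1.2)) ?_
    refine Measurable.prodMk ?_ (by fun_prop)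
    exact (hupm i).comp (f := fun z : (Ω × Ω) × (Fin n → Ω) => (z.1.1, z.2)) (by fun_prop)
  set ρ : Fin n → Fin n → Ω × Ω → ℝ≥0∞ := fun i j z =>
    π {x | (Function.update x i z.1, z.2) ∈ T j} with hρdef
  have hρm : ∀ i j, Measurable (ρ i j) := fun i j =>
    measurable_measure_prodMk_left (ν := π) (hρT i j)
  set R : Fin n → Fin n → Set (Ω × Ω) := fun i j => {z | 1 / 2 ≤ ρ i j z} with hRdef
  have hRm : ∀ i j, MeasurableSet (R i j) := fun i j => measurableSet_le measurable_const (hρm i j)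
  -- step B1
  set F1 : Fin n → Fin n → Ω × Ω → ℝ≥0∞ := fun i j => (R i j).indicator (F i j) with hF1def
  have hF1m : ∀ i j, Measurable (F1 i j) := fun i j => (hF i j).indicator (hRm i j)
  set W1 : Fin n → Ω → ℝ≥0∞ := fun i ξ => ∑ j, ∫⁻ υ, F1 i j (ξ, υ) ∂μ with hW1def
  have hW1m : ∀ i, Measurable (W1 i) := fun i =>
    Finset.measurable_sum _ fun j _ => (hF1m i j).lintegral_prod_right'
  set U1 : Fin n → (Fin n → Ω) → ℝ≥0∞ := fun i x =>
    ∑ j, ∫⁻ υ, (T j).indicator (fun _ => F1 i j (x i, υ)) (x, υ) ∂μ with hU1def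
  have hU1j : ∀ i j, Measurable fun z : (Fin n → Ω) × Ω =>
      (T j).indicator (fun _ => F1 i j (z.1 i, z.2)) z := by
    intro i j
    have : (fun z : (Fin n → Ω) × Ω => (T j).indicator (fun _ => F1 i j (z.1 i, z.2)) z)
        = (T j).indicator (fun z => F1 i j (z.1 i, z.2)) := by
      ext z; simp [Set.indicator]
    rw [this]
    exact ((hF1m i j).comp (by fun_prop)).indicator (hTm j)
  have hU1m : ∀ i, Measurable (U1 i) := fun i =>
    Finset.measurable_sum _ fun j _ => (hU1j i j).lintegral_prod_right'
  have hUW1 : ∀ i x, U1 i x ≤ W1 i (x i) := by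
    intro i x
    refine Finset.sum_le_sum fun j _ => lintegral_mono fun υ => ?_
    exact Set.indicator_le_self (T j) (fun _ => F1 i j (x i, υ)) (x, υ)
  have hH1 : ∀ i ξ (s : ℝ≥0∞), s ≠ ⊤ → min (W1 i ξ) s / 2 ≤
      ∫⁻ x, min (U1 i (Function.update x i ξ)) s ∂π := by
    intro i ξ s hs
    have hmeas1 : ∀ j, Measurable fun υ => F1 i j (ξ, υ) := fun j =>
      (hF1m i j).comp (measurable_const.prodMk measurable_id)
    have hΘ : MeasurableSet {z : (Fin n → Ω) × (Fin n × Ω) |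
        (Function.update z.1 i ξ, z.2.2) ∈ T z.2.1} := by
      have : {z : (Fin n → Ω) × (Fin n × Ω) | (Function.update z.1 i ξ, z.2.2) ∈ T z.2.1}
        = ⋃ j, ({z | z.2.1 = j} ∩ {z | (Function.update z.1 i ξ, z.2.2) ∈ T j}) := by
        ext z; simp
      rw [this]
      refine MeasurableSet.iUnion fun j => MeasurableSet.inter ?_ ?_
      · exact (measurableSet_singleton j).preimage (f := fun z : (Fin n → Ω) × (Fin n × Ω) => z.2.1)
          (by fun_prop)
      · refine (hTm j).preimage (f := fun z : (Fin n → Ω) × (Fin n × Ω) =>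
          (Function.update z.1 i ξ, z.2.2)) ?_
        refine Measurable.prodMk ?_ (by fun_prop)
        exact (hupm i).comp (f := fun z : (Fin n → Ω) × (Fin n × Ω) => (ξ, z.1)) (by fun_prop)
    have := trunc_half π ((Measure.count : Measure (Fin n)).prod μ)
      (fun z => F1 i z.1 (ξ, z.2)) (meas_fin_prod hmeas1) _ hΘ (by
        rintro ⟨j, υ⟩ hne
        by_contra hlt
        refine hne ?_
        exact Set.indicator_of_notMem (s := R i j) (f := F i j) (a := (ξ, υ)) hlt) s hs
    rw [← sum_lint_eq μ hmeas1] at this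
    refine this.trans (le_of_eq (lintegral_congr fun x => ?_))
    congr 1
    rw [hU1def]
    simp only [Function.update_self]
    rw [sum_lint_eq μ]
    · refine lintegral_congr fun z => ?_
      simp [Set.indicator]
    · intro j
      have h9 : Measurable fun υ : Ω => (Function.update x i ξ, υ) := by fun_prop
      have h10 := (hU1j i j).comp h9
      simp only [Function.comp_def, Function.update_self] at h10
      exact h10
  have hU1sum : ∀ x, ∑ i, U1 i x ≤ t x / 4 := by
    intro x
    refine le_trans ?_ (hA1 x)
    rw [hU1def]
    simp only
    rw [Finset.sum_comm]
    refine Finset.sum_le_sum fun j _ => ?_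
    have h9 : Measurable fun υ : Ω => (x, υ) := by fun_prop
    have h10 : ∀ i, Measurable fun υ : Ω => (T j).indicator (fun _ => F1 i j (x i, υ)) (x, υ) :=
      fun i => (hU1j i j).comp h9
    rw [← lintegral_finsetSum _ (fun i _ => h10 i)]
    refine lintegral_mono fun υ => ?_
    by_cases h : (x, υ) ∈ T j
    · simp only [Set.indicator_of_mem h]
      have hle : ∑ i, F1 i j (x i, υ) ≤ G j x υ :=
        Finset.sum_le_sum fun i _ => Set.indicator_le_self _ _ _
      exact le_min hle (hle.trans h)
    · simp [Set.indicator_of_notMem h]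
  have hU1q : ∫⁻ x, (∑ i, U1 i x) ^ q ∂π ≤ 2 ^ 20 * E := by
    rw [← hEM, ← lintegral_const_mul _ hMm]
    refine lintegral_mono fun x => ?_
    exact (ENNReal.rpow_le_rpow (hU1sum x) hq0.le).trans (rpow_four_K hq0 hq1 _)
  set τ1 : ℝ≥0∞ := 2 ^ 20 * (2 ^ 20 * E) ^ (1 / q) with hτ1
  have hB1s := first_order_small μ hq W1 hW1m U1 hU1m hUW1 hH1 τ1
    (by rw [hτ1, rpow_div_K hq0]; exact hU1q)
  have hB1l := first_order_large μ hq hq1 W1 hW1m U1 hU1m hUW1 hH1 τ1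
    (by rw [hτ1, rpow_div_K hq0]; exact hU1q)
  -- step B2
  set F2 : Fin n → Fin n → Ω × Ω → ℝ≥0∞ := fun i j => (R i j)ᶜ.indicator (F i j) with hF2def
  have hF2m : ∀ i j, Measurable (F2 i j) := fun i j => (hF i j).indicator (hRm i j).compl
  have hGT : ∀ j, Measurable ((T j)ᶜ.indicator (fun z : (Fin n → Ω) × Ω => G j z.1 z.2)) :=
    fun j => (hGm j).indicator (hTm j).compl
  set M2 : Fin n → Ω → ℝ≥0∞ := fun j υ =>
    ∫⁻ x, ((T j)ᶜ.indicator (fun z => G j z.1 z.2) (x, υ)) ^ q ∂π with hM2def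
  have hM2m : ∀ j, Measurable (M2 j) := fun j => by
    exact ((hGT j).pow_const q).lintegral_prod_left'
  set τ2 : Fin n → Ω → ℝ≥0∞ := fun j υ => 2 ^ 20 * M2 j υ ^ (1 / q) with hτ2
  have hτ2m : ∀ j, Measurable (τ2 j) := fun j => ((hM2m j).pow_const _).const_mul _
  have hM2sum : ∑ j, ∫⁻ υ, M2 j υ ∂μ ≤ 4 * E := by
    have e1 : ∀ j, ∫⁻ υ, M2 j υ ∂μ
        = ∫⁻ x, ∫⁻ υ, ((T j)ᶜ.indicator (fun z => G j z.1 z.2) (x, υ)) ^ q ∂μ ∂π := by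
      intro j
      rw [hM2def]
      rw [lintegral_lintegral_swap]
      exact (((hGT j).pow_const q).comp measurable_swap).aemeasurable
    simp_rw [e1]
    rw [← lintegral_finsetSum _ (fun j _ => ((hGT j).pow_const q).lintegral_prod_right'), ← hEM,
      ← lintegral_const_mul _ hMm]
    refine lintegral_mono fun x => le_trans (le_of_eq ?_) (hA2 x)
    refine Finset.sum_congr rfl fun j _ => lintegral_congr fun υ => ?_
    by_cases h : t x < G j x υ
    · rw [Set.indicator_of_mem (a := υ) (by exact h), Set.indicator_of_mem]
      exact not_le.2 h
    · rw [Set.indicator_of_notMem (a := υ) (by exact h), Set.indicator_of_notMem,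
        ENNReal.zero_rpow_of_pos hq0]
      exact fun hc => hc (not_lt.1 h)
  have hmeasc : ∀ i j υ, Measurable fun ξ => F2 i j (ξ, υ) := fun i j υ =>
    (hF2m i j).comp (measurable_id.prodMk measurable_const)
  have hB2 : ∀ j υ, (∑ i, ∫⁻ ξ, min (F2 i j (ξ, υ)) (τ2 j υ) ∂μ ≤ τ2 j υ / 4) ∧
      (∑ i, ∫⁻ ξ, {ξ | τ2 j υ < F2 i j (ξ, υ)}.indicator (fun ξ => F2 i j (ξ, υ) ^ q) ξ ∂μ
        ≤ 4 * M2 j υ) := by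
    intro j υ
    set U2 : Fin n → (Fin n → Ω) → ℝ≥0∞ := fun i x =>
      {x | (x, υ) ∈ (T j)ᶜ}.indicator (fun x => F2 i j (x i, υ)) x with hU2
    have hTυ : MeasurableSet {x : Fin n → Ω | (x, υ) ∈ (T j)ᶜ} :=
      (hTm j).compl.preimage measurable_prodMk_right
    have hU2m : ∀ i, Measurable (U2 i) := fun i =>
      ((hmeasc i j υ).comp (measurable_pi_apply i)).indicator hTυ
    have hUW2 : ∀ i x, U2 i x ≤ F2 i j (x i, υ) := fun i x =>
      Set.indicator_le_self {x | (x, υ) ∈ (T j)ᶜ} (fun x => F2 i j (x i, υ)) x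
    have hsum : ∫⁻ x, (∑ i, U2 i x) ^ q ∂π ≤ M2 j υ := by
      refine lintegral_mono fun x => ENNReal.rpow_le_rpow ?_ hq0.le
      by_cases h : (x, υ) ∈ (T j)ᶜ
      · rw [Set.indicator_of_mem h]
        refine Finset.sum_le_sum fun i _ => (hUW2 i x).trans (Set.indicator_le_self _ _ _)
      · refine le_trans (le_of_eq ?_) zero_le
        refine Finset.sum_eq_zero fun i _ => ?_
        exact Set.indicator_of_notMem (s := {x | (x, υ) ∈ (T j)ᶜ}) (a := x) h _
    have hH2 : ∀ i ξ (s : ℝ≥0∞), s ≠ ⊤ → min (F2 i j (ξ, υ)) s / 2 ≤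
        ∫⁻ x, min (U2 i (Function.update x i ξ)) s ∂π := by
      intro i ξ s _
      rcases eq_or_ne (F2 i j (ξ, υ)) 0 with h0 | h0
      · simp [h0]
      have hnR : (ξ, υ) ∉ R i j := fun hR => h0 (Set.indicator_of_notMem (s := (R i j)ᶜ) (fun h => h hR) _)
      have hlt : ρ i j (ξ, υ) < 1 / 2 := not_le.1 hnR
      have hTs : MeasurableSet {x : Fin n → Ω | (Function.update x i ξ, υ) ∈ T j} := by
        exact (hρT i j).preimage (f := fun x => ((ξ, υ), x)) (by fun_prop)
      have hc : 1 / 2 ≤ π {x : Fin n → Ω | (Function.update x i ξ, υ) ∈ T j}ᶜ := by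
        rw [prob_compl_eq_one_sub hTs]
        have : (1:ℝ≥0∞) / 2 = 1 - 1 / 2 := by simp
        rw [this]
        exact tsub_le_tsub_left hlt.le _
      calc min (F2 i j (ξ, υ)) s / 2 = min (F2 i j (ξ, υ)) s * (1 / 2) := by
            rw [one_div, div_eq_mul_inv]
        _ ≤ min (F2 i j (ξ, υ)) s * π {x : Fin n → Ω | (Function.update x i ξ, υ) ∈ T j}ᶜ := by
            gcongr
        _ = ∫⁻ x, {x : Fin n → Ω | (Function.update x i ξ, υ) ∈ T j}ᶜ.indicator
              (fun _ => min (F2 i j (ξ, υ)) s) x ∂π := (lintegral_indicator_const hTs.compl _).symm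
        _ ≤ _ := by
            refine lintegral_mono fun x => ?_
            by_cases h : (Function.update x i ξ, υ) ∈ T j
            · rw [Set.indicator_of_notMem (by exact fun hh => hh h)]; exact zero_le
            · rw [Set.indicator_of_mem (by exact h)]
              rw [hU2]
              simp only
              rw [Set.indicator_of_mem (by exact h)]
              simp
    have hle : ∫⁻ x, (∑ i, U2 i x) ^ q ∂π ≤ (τ2 j υ / 2 ^ 20) ^ q := by
      rw [hτ2, rpow_div_K hq0]; exact hsum
    refine ⟨first_order_small μ hq (fun i ξ => F2 i j (ξ, υ)) (fun i => hmeasc i j υ) U2 hU2m hUW2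
      hH2 (τ2 j υ) hle, ?_⟩
    refine (first_order_large μ hq hq1 (fun i ξ => F2 i j (ξ, υ)) (fun i => hmeasc i j υ) U2 hU2m
      hUW2 hH2 (τ2 j υ) hle).trans ?_
    gcongr
  -- conclusion
  refine ⟨R, fun i j => {z | W1 i z.1 ≤ τ1}, fun i j => {z | F2 i j z ≤ τ2 j z.2}, hRm,
    fun i j => measurableSet_le ((hW1m i).comp measurable_fst) measurable_const,
    fun i j => measurableSet_le (hF2m i j) ((hτ2m j).comp measurable_snd), ?_, ?_, ?_, ?_⟩
  · calc _ ≤ ∑ i, ∫⁻ ξ, min (W1 i ξ) τ1 ∂μ := by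
          refine Finset.sum_le_sum fun i _ => ?_
          have hS1 : MeasurableSet {z : Ω × Ω | W1 i z.1 ≤ τ1} :=
            measurableSet_le ((hW1m i).comp measurable_fst) measurable_const
          rw [← lintegral_finsetSum]
          · refine lintegral_mono fun ξ => ?_
            by_cases h : W1 i ξ ≤ τ1
            · rw [min_eq_left h]
              refine Finset.sum_le_sum fun j _ => lintegral_mono fun υ => ?_
              exact Set.indicator_le_indicator_of_subset Set.inter_subset_left (fun _ => zero_le) _
            · refine le_trans (le_of_eq ?_) zero_le
              refine Finset.sum_eq_zero fun j _ => ?_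
              refine (lintegral_congr fun υ => ?_).trans lintegral_zero
              exact Set.indicator_of_notMem (fun hh => h hh.2) _
          · intro j _
            exact ((hF i j).indicator ((hRm i j).inter hS1)).lintegral_prod_right'
      _ ≤ τ1 / 4 := hB1s
      _ ≤ τ1 := ENNReal.div_le_of_le_mul (le_mul_of_one_le_right zero_le (by norm_num))
  · calc _ = ∑ i, ∑ j, ∫⁻ υ, ∫⁻ ξ, {ξ | τ2 j υ < F2 i j (ξ, υ)}.indicator
            (fun ξ => F2 i j (ξ, υ) ^ q) ξ ∂μ ∂μ := by
          refine Finset.sum_congr rfl fun i _ => Finset.sum_congr rfl fun j _ => ?_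
          rw [lintegral_lintegral_swap]
          · refine lintegral_congr fun υ => lintegral_congr fun ξ => ?_
            by_cases h : τ2 j υ < F2 i j (ξ, υ)
            · rw [Set.indicator_of_mem (a := ξ) (by exact h)]
              have hR : (ξ, υ) ∈ (R i j)ᶜ := by
                by_contra hc
                have : F2 i j (ξ, υ) = 0 := Set.indicator_of_notMem hc _
                rw [this] at h; exact not_lt_zero h
              rw [Set.indicator_of_mem (by exact ⟨hR, not_le.2 h⟩)]
              congr 1
              exact (Set.indicator_of_mem hR _).symm
            · rw [Set.indicator_of_notMem (a := ξ) (by exact h), Set.indicator_of_notMem,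
                ENNReal.zero_rpow_of_pos hq0]
              exact fun hc => hc.2 (not_lt.1 h)
          · refine Measurable.aemeasurable ?_
            refine (Measurable.indicator (hF i j) ?_).pow_const q
            exact (hRm i j).compl.inter
              (measurableSet_le (hF2m i j) ((hτ2m j).comp measurable_snd)).compl
      _ = ∑ j, ∫⁻ υ, ∑ i, ∫⁻ ξ, {ξ | τ2 j υ < F2 i j (ξ, υ)}.indicator
            (fun ξ => F2 i j (ξ, υ) ^ q) ξ ∂μ ∂μ := by
          rw [Finset.sum_comm]
          refine Finset.sum_congr rfl fun j _ => ?_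
          rw [lintegral_finsetSum]
          intro i _
          have : Measurable ({z : Ω × Ω | τ2 j z.2 < F2 i j z}.indicator (fun z => F2 i j z ^ q)) :=
            ((hF2m i j).pow_const q).indicator
              (measurableSet_lt ((hτ2m j).comp measurable_snd) (hF2m i j))
          exact this.lintegral_prod_left'
      _ ≤ ∑ j, ∫⁻ υ, 4 * M2 j υ ∂μ :=
          Finset.sum_le_sum fun j _ => lintegral_mono fun υ => (hB2 j υ).2
      _ = 4 * ∑ j, ∫⁻ υ, M2 j υ ∂μ := by
          rw [Finset.mul_sum]
          exact Finset.sum_congr rfl fun j _ => lintegral_const_mul _ (hM2m j)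
      _ ≤ 4 * (4 * E) := by gcongr
      _ = 16 * E := by rw [← mul_assoc]; norm_num
  · calc _ = ∑ i, ∫⁻ ξ, {ξ | τ1 < W1 i ξ}.indicator (fun ξ => W1 i ξ ^ q) ξ ∂μ := by
          refine Finset.sum_congr rfl fun i _ => lintegral_congr fun ξ => ?_
          by_cases h : τ1 < W1 i ξ
          · rw [Set.indicator_of_mem (a := ξ) (by exact h)]
            congr 1
            refine Finset.sum_congr rfl fun j _ => lintegral_congr fun υ => ?_
            by_cases hR : (ξ, υ) ∈ R i j
            · rw [Set.indicator_of_mem (by exact ⟨hR, not_le.2 h⟩)]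
              exact (Set.indicator_of_mem hR _).symm
            · rw [Set.indicator_of_notMem (fun hc => hR hc.1)]
              exact (Set.indicator_of_notMem hR _).symm
          · rw [Set.indicator_of_notMem (a := ξ) (by exact h)]
            rw [Finset.sum_eq_zero, ENNReal.zero_rpow_of_pos hq0]
            intro j _
            refine (lintegral_congr fun υ => ?_).trans lintegral_zero
            exact Set.indicator_of_notMem (fun hh => hh.2 (not_lt.1 h)) _
      _ ≤ _ := hB1l
      _ ≤ 4 * (2 ^ 20 * E) := by gcongr
      _ = 2 ^ 22 * E := by rw [← mul_assoc]; norm_num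
  · calc _ ≤ ∑ j, ∫⁻ υ, 2 ^ 20 * M2 j υ ∂μ := by
          refine Finset.sum_le_sum fun j _ => lintegral_mono fun υ => ?_
          refine le_trans (ENNReal.rpow_le_rpow (le_trans ?_ (hB2 j υ).1) hq0.le)
            (rpow_four_K hq0 hq1 _)
          refine Finset.sum_le_sum fun i _ => lintegral_mono fun ξ => ?_
          by_cases hR : (ξ, υ) ∈ (R i j)ᶜ ∩ {z | F2 i j z ≤ τ2 j z.2}
          · rw [Set.indicator_of_mem hR]
            have h1 : F2 i j (ξ, υ) = F i j (ξ, υ) := Set.indicator_of_mem hR.1 _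
            rw [← h1]
            exact le_min le_rfl hR.2
          · rw [Set.indicator_of_notMem hR]; exact zero_le
      _ = 2 ^ 20 * ∑ j, ∫⁻ υ, M2 j υ ∂μ := by
          rw [Finset.mul_sum]
          exact Finset.sum_congr rfl fun j _ => lintegral_const_mul _ (hM2m j)
      _ ≤ 2 ^ 20 * (4 * E) := by gcongr
      _ = 2 ^ 22 * E := by rw [← mul_assoc]; norm_num

end DEC

section CHAOS
variable {n : ℕ}

/-- sign of a boolean -/
def bsgn (b : Bool) : ℝ := if b then 1 else -1

/-- average over all sign patterns -/
noncomputable def bav (g : (Fin n → Bool) → ℝ) : ℝ := (∑ ε, g ε) / 2 ^ n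

lemma bsgn_sq (b : Bool) : bsgn b ^ 2 = 1 := by cases b <;> simp [bsgn]

lemma bsgn_not (b : Bool) : bsgn (!b) = - bsgn b := by cases b <;> simp [bsgn]

/-- flip coordinate `a` -/
def bflip (a : Fin n) (ε : Fin n → Bool) : Fin n → Bool := Function.update ε a (!ε a)

lemma bflip_invol (a : Fin n) : Function.Involutive (bflip a) := by
  intro ε
  simp [bflip]

lemma bav_flip (a : Fin n) (g : (Fin n → Bool) → ℝ) : bav (fun ε => g (bflip a ε)) = bav g := by
  unfold bav
  congr 1
  exact Equiv.sum_comp ((bflip_invol a).toPerm) g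

lemma bav_add (g h : (Fin n → Bool) → ℝ) : bav (fun ε => g ε + h ε) = bav g + bav h := by
  unfold bav; rw [Finset.sum_add_distrib, add_div]

lemma bav_mul (c : ℝ) (g : (Fin n → Bool) → ℝ) : bav (fun ε => c * g ε) = c * bav g := by
  unfold bav; rw [← Finset.mul_sum, mul_div_assoc]

lemma bav_const (c : ℝ) : bav (fun _ : Fin n → Bool => c) = c := by
  unfold bav; simp

lemma bav_mono {g h : (Fin n → Bool) → ℝ} (H : ∀ ε, g ε ≤ h ε) : bav g ≤ bav h := by
  unfold bav
  gcongr with ε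
  exact H ε

lemma bav_odd (a : Fin n) (g : (Fin n → Bool) → ℝ) (h : ∀ ε, g (bflip a ε) = - g ε) : bav g = 0 := by
  have h1 := bav_flip a g
  have h2 : bav (fun ε => g (bflip a ε)) = - bav g := by
    rw [show (fun ε => g (bflip a ε)) = fun ε => (-1) * g ε from by ext ε; rw [h]; ring, bav_mul]
    ring
  linarith

lemma bsgn_flip_self (a : Fin n) (ε : Fin n → Bool) : bsgn (bflip a ε a) = - bsgn (ε a) := by
  simp [bflip, bsgn_not]

lemma bsgn_flip_ne {a i : Fin n} (h : i ≠ a) (ε : Fin n → Bool) : bflip a ε i = ε i := by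
  simp [bflip, h]

lemma bav_lin (s : Finset (Fin n)) (v : Fin n → ℝ) :
    bav (fun ε => (∑ i ∈ s, v i * bsgn (ε i)) ^ 2) = ∑ i ∈ s, v i ^ 2 ∧
    bav (fun ε => (∑ i ∈ s, v i * bsgn (ε i)) ^ 4) ≤ 3 * (∑ i ∈ s, v i ^ 2) ^ 2 := by
  induction s using Finset.induction_on with
  | empty => simp [bav_const]
  | insert a s ha ih =>
    set L : (Fin n → Bool) → ℝ := fun ε => ∑ i ∈ s, v i * bsgn (ε i) with hL
    have hLf : ∀ ε, L (bflip a ε) = L ε := by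
      intro ε
      refine Finset.sum_congr rfl fun i hi => ?_
      have hne : i ≠ a := fun h => ha (h ▸ hi)
      rw [bsgn_flip_ne hne]
    simp only [Finset.sum_insert ha]
    obtain ⟨ih1, ih2⟩ := ih
    have e2 : bav (fun ε => (v a * bsgn (ε a) + L ε) ^ 2) = v a ^ 2 + bav (fun ε => L ε ^ 2) := by
      rw [show (fun ε : Fin n → Bool => (v a * bsgn (ε a) + L ε) ^ 2) = fun ε =>
        (v a ^ 2 + L ε ^ 2) + 2 * v a * (bsgn (ε a) * L ε) from by
          ext ε
          linear_combination (v a ^ 2) * bsgn_sq (ε a)]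
      rw [bav_add, bav_add, bav_const, bav_mul, bav_odd a (fun ε => bsgn (ε a) * L ε)]
      · ring
      · intro ε; rw [bsgn_flip_self, hLf]; ring
    have e4 : bav (fun ε => (v a * bsgn (ε a) + L ε) ^ 4)
        = v a ^ 4 + 6 * v a ^ 2 * bav (fun ε => L ε ^ 2) + bav (fun ε => L ε ^ 4) := by
      rw [show (fun ε : Fin n → Bool => (v a * bsgn (ε a) + L ε) ^ 4) = fun ε =>
        (v a ^ 4 + 6 * v a ^ 2 * L ε ^ 2 + L ε ^ 4)
          + 4 * (bsgn (ε a) * (v a ^ 3 * L ε + v a * L ε ^ 3)) from by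
          ext ε
          linear_combination (v a ^ 4 * (bsgn (ε a) ^ 2 + 1) + 6 * v a ^ 2 * L ε ^ 2
            + 4 * v a ^ 3 * bsgn (ε a) * L ε) * bsgn_sq (ε a)]
      rw [bav_add, bav_add, bav_add, bav_const, bav_mul, bav_mul,
        bav_odd a (fun ε => bsgn (ε a) * (v a ^ 3 * L ε + v a * L ε ^ 3))]
      · ring
      · intro ε; rw [bsgn_flip_self, hLf]; ring
    rw [e2, e4, ih1]
    refine ⟨rfl, ?_⟩
    nlinarith [sq_nonneg (v a ^ 2)]

lemma bav_nonneg {g : (Fin n → Bool) → ℝ} (H : ∀ ε, 0 ≤ g ε) : 0 ≤ bav g := by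
  have := bav_mono (g := fun _ => 0) (h := g) H
  rwa [bav_const] at this

lemma bav_cs (g h : (Fin n → Bool) → ℝ) :
    bav (fun ε => g ε * h ε) ^ 2 ≤ bav (fun ε => g ε ^ 2) * bav (fun ε => h ε ^ 2) := by
  unfold bav
  rw [div_pow, div_mul_div_comm, ← sq]
  gcongr
  exact Finset.sum_mul_sq_le_sq_mul_sq _ _ _

lemma bav_quad (w : Fin n → Fin n → ℝ) (hw : ∀ i j, ¬ i < j → w i j = 0) (s : Finset (Fin n)) :
    bav (fun ε => (∑ i ∈ s, ∑ j ∈ s, bsgn (ε i) * bsgn (ε j) * w i j) ^ 2)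
      = ∑ i ∈ s, ∑ j ∈ s, w i j ^ 2 ∧
    bav (fun ε => (∑ i ∈ s, ∑ j ∈ s, bsgn (ε i) * bsgn (ε j) * w i j) ^ 4)
      ≤ 81 * (∑ i ∈ s, ∑ j ∈ s, w i j ^ 2) ^ 2 := by
  induction s using Finset.induction_on with
  | empty => simp [bav_const]
  | insert a s ha ih =>
    obtain ⟨ih1, ih2⟩ := ih
    set Q : (Fin n → Bool) → ℝ := fun ε => ∑ i ∈ s, ∑ j ∈ s, bsgn (ε i) * bsgn (ε j) * w i j with hQ
    set v : Fin n → ℝ := fun i => w i a + w a i with hv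
    set L : (Fin n → Bool) → ℝ := fun ε => ∑ i ∈ s, v i * bsgn (ε i) with hL
    have hne : ∀ i ∈ s, i ≠ a := fun i hi h => ha (h ▸ hi)
    have hLf : ∀ ε, L (bflip a ε) = L ε := by
      intro ε
      refine Finset.sum_congr rfl fun i hi => ?_
      rw [bsgn_flip_ne (hne i hi)]
    have hQf : ∀ ε, Q (bflip a ε) = Q ε := by
      intro ε
      refine Finset.sum_congr rfl fun i hi => Finset.sum_congr rfl fun j hj => ?_
      rw [bsgn_flip_ne (hne i hi), bsgn_flip_ne (hne j hj)]
    have haa : w a a = 0 := hw a a (lt_irrefl a)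
    have hexp : ∀ ε : Fin n → Bool, ∑ i ∈ insert a s, ∑ j ∈ insert a s,
        bsgn (ε i) * bsgn (ε j) * w i j = Q ε + bsgn (ε a) * L ε := by
      intro ε
      simp only [Finset.sum_insert ha, Finset.sum_add_distrib, haa, hQ, hL, hv, add_mul,
        Finset.mul_sum, mul_add]
      simp only [mul_zero, zero_add]
      rw [add_comm (∑ i ∈ s, ∑ j ∈ s, _) _]
      have e1 : ∑ i ∈ s, bsgn (ε a) * bsgn (ε i) * w a i = ∑ i ∈ s, bsgn (ε a) * (w a i * bsgn (ε i)) :=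
        Finset.sum_congr rfl fun i _ => by ring
      have e2 : ∑ i ∈ s, bsgn (ε i) * bsgn (ε a) * w i a = ∑ i ∈ s, bsgn (ε a) * (w i a * bsgn (ε i)) :=
        Finset.sum_congr rfl fun i _ => by ring
      rw [e1, e2]; ring
    have hsq : ∑ i ∈ insert a s, ∑ j ∈ insert a s, w i j ^ 2
        = ∑ i ∈ s, ∑ j ∈ s, w i j ^ 2 + ∑ i ∈ s, v i ^ 2 := by
      simp only [Finset.sum_insert ha, Finset.sum_add_distrib, haa]
      have e3 : ∑ i ∈ s, v i ^ 2 = ∑ i ∈ s, w a i ^ 2 + ∑ i ∈ s, w i a ^ 2 := by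
        rw [← Finset.sum_add_distrib]
        refine Finset.sum_congr rfl fun i _ => ?_
        by_cases h : i < a
        · rw [hv]; simp only; rw [hw a i (not_lt.2 h.le)]; ring
        · rw [hv]; simp only; rw [hw i a h]; ring
      rw [e3]; ring
    obtain ⟨l1, l2⟩ := bav_lin s v
    have e2 : bav (fun ε => (Q ε + bsgn (ε a) * L ε) ^ 2)
        = bav (fun ε => Q ε ^ 2) + bav (fun ε => L ε ^ 2) := by
      rw [show (fun ε : Fin n → Bool => (Q ε + bsgn (ε a) * L ε) ^ 2) = fun ε =>
        (Q ε ^ 2 + L ε ^ 2) + 2 * (bsgn (ε a) * (Q ε * L ε)) from by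
          ext ε
          linear_combination (L ε ^ 2) * bsgn_sq (ε a)]
      rw [bav_add, bav_add, bav_mul, bav_odd a (fun ε => bsgn (ε a) * (Q ε * L ε))]
      · ring
      · intro ε; rw [bsgn_flip_self, hLf, hQf]; ring
    have e4 : bav (fun ε => (Q ε + bsgn (ε a) * L ε) ^ 4)
        = bav (fun ε => Q ε ^ 4) + 6 * bav (fun ε => Q ε ^ 2 * L ε ^ 2) + bav (fun ε => L ε ^ 4) := by
      rw [show (fun ε : Fin n → Bool => (Q ε + bsgn (ε a) * L ε) ^ 4) = fun ε =>
        (Q ε ^ 4 + 6 * (Q ε ^ 2 * L ε ^ 2) + L ε ^ 4)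
          + 4 * (bsgn (ε a) * (Q ε ^ 3 * L ε + Q ε * L ε ^ 3)) from by
          ext ε
          linear_combination (L ε ^ 4 * (bsgn (ε a) ^ 2 + 1) + 6 * Q ε ^ 2 * L ε ^ 2
            + 4 * L ε ^ 3 * bsgn (ε a) * Q ε) * bsgn_sq (ε a)]
      rw [bav_add, bav_add, bav_add, bav_mul, bav_mul,
        bav_odd a (fun ε => bsgn (ε a) * (Q ε ^ 3 * L ε + Q ε * L ε ^ 3))]
      · ring
      · intro ε; rw [bsgn_flip_self, hLf, hQf]; ring
    simp only [hexp]
    rw [hsq, e2, e4, ih1, l1]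
    refine ⟨rfl, ?_⟩
    set A := ∑ i ∈ s, ∑ j ∈ s, w i j ^ 2
    set B := ∑ i ∈ s, v i ^ 2
    have hA : 0 ≤ A := Finset.sum_nonneg fun i _ => Finset.sum_nonneg fun j _ => sq_nonneg _
    have hB : 0 ≤ B := Finset.sum_nonneg fun i _ => sq_nonneg _
    have hcs := bav_cs (fun ε => Q ε ^ 2) (fun ε => L ε ^ 2)
    have e5 : ∀ x : ℝ, (x ^ 2) ^ 2 = x ^ 4 := fun x => by ring
    simp only [e5] at hcs
    have hcs2 : bav (fun ε => Q ε ^ 2 * L ε ^ 2) ≤ 27 * A * B := by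
      refine abs_le_of_sq_le_sq' ?_ (by positivity) |>.2
      refine hcs.trans ?_
      calc _ ≤ (81 * A ^ 2) * (3 * B ^ 2) := by
            refine mul_le_mul ih2 l2 (bav_nonneg fun ε => by positivity) (by positivity)
        _ ≤ (27 * A * B) ^ 2 := by nlinarith [mul_nonneg (sq_nonneg A) (sq_nonneg B)]
    nlinarith

lemma khin_real {p : ℝ} (hp1 : 1 ≤ p) (hp2 : p ≤ 2) (Q : (Fin n → Bool) → ℝ) (A : ℝ)
    (h2 : bav (fun ε => Q ε ^ 2) = A) (h4 : bav (fun ε => Q ε ^ 4) ≤ 81 * A ^ 2) :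
    A ^ (p / 2) ≤ 26 * bav (fun ε => |Q ε| ^ p) ∧ bav (fun ε => |Q ε| ^ p) ≤ 2 * A ^ (p / 2) := by
  have hA : 0 ≤ A := by rw [← h2]; exact bav_nonneg fun ε => sq_nonneg _
  rcases eq_or_lt_of_le hA with h0 | h0
  · have hQ0 : ∀ ε, Q ε = 0 := by
      rw [← h0] at h2
      unfold bav at h2
      have h3 : ∑ ε, Q ε ^ 2 = 0 := by
        rcases div_eq_zero_iff.1 h2 with h | h
        · exact h
        · exact absurd h (by positivity)
      rw [Finset.sum_eq_zero_iff_of_nonneg (fun _ _ => sq_nonneg _)] at h3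
      intro ε
      simpa using h3 ε (Finset.mem_univ _)
    have hz : ∀ ε, |Q ε| ^ p = 0 := fun ε => by
      rw [hQ0 ε, abs_zero, Real.zero_rpow (by linarith)]
    simp only [hz, bav_const, ← h0]
    rw [Real.zero_rpow (by linarith)]; simp
  · set s := Real.sqrt A with hs
    have hs0 : 0 < s := Real.sqrt_pos.2 h0
    have hs2 : s ^ 2 = A := Real.sq_sqrt hA
    have hsp : A ^ (p / 2) = s ^ p := by
      rw [← hs2, ← Real.rpow_natCast, ← Real.rpow_mul hs0.le]; congr 1; push_cast; ring
    have hun : ∀ ε, |Q ε| = s * (|Q ε| / s) := fun ε => by field_simp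
    have hsplit : ∀ ε, |Q ε| ^ p = s ^ p * (|Q ε| / s) ^ p := fun ε => by
      conv_lhs => rw [hun ε]
      rw [Real.mul_rpow hs0.le (by positivity)]
    have hu2 : bav (fun ε => (|Q ε| / s) ^ 2) = 1 := by
      rw [show (fun ε => (|Q ε| / s) ^ 2) = fun ε => (1 / A) * Q ε ^ 2 from by
        ext ε; rw [div_pow, sq_abs, hs2]; ring, bav_mul, h2]
      field_simp
    have hu4 : bav (fun ε => (|Q ε| / s) ^ 4) ≤ 81 := by
      rw [show (fun ε => (|Q ε| / s) ^ 4) = fun ε => (1 / A ^ 2) * Q ε ^ 4 from by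
        ext ε
        rw [div_pow, show s ^ 4 = A ^ 2 by rw [← hs2]; ring,
          show |Q ε| ^ 4 = Q ε ^ 4 by rw [show |Q ε| ^ 4 = (|Q ε| ^ 2) ^ 2 by ring, sq_abs]; ring]
        ring, bav_mul]
      rw [one_div, inv_mul_le_iff₀ (by positivity)]
      linarith
    simp only [hsplit]
    rw [bav_mul, hsp]
    have hsp0 : 0 < s ^ p := Real.rpow_pos_of_pos hs0 p
    have lower : 1 ≤ 26 * bav (fun ε => (|Q ε| / s) ^ p) := by
      have : bav (fun ε => (|Q ε| / s) ^ 2) ≤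
          bav (fun ε => 13 * (|Q ε| / s) ^ p + (1 / 169) * (|Q ε| / s) ^ 4) := by
        refine bav_mono fun ε => ?_
        have hu : 0 ≤ |Q ε| / s := by positivity
        generalize |Q ε| / s = x at hu
        rcases le_total x 13 with h | h
        · have : x ^ 2 ≤ 13 * x ^ p := by
            rcases eq_or_lt_of_le hu with hx | hx
            · rw [← hx, Real.zero_rpow (by linarith)]; norm_num
            calc x ^ 2 = x ^ (2 - p) * x ^ p := by
                  rw [← Real.rpow_add hx, ← Real.rpow_natCast]; norm_num
              _ ≤ 13 * x ^ p := by
                  gcongr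
                  calc x ^ (2 - p) ≤ 13 ^ (2 - p) := by
                        exact Real.rpow_le_rpow hu h (by linarith)
                    _ ≤ 13 ^ (1:ℝ) := Real.rpow_le_rpow_of_exponent_le (by norm_num) (by linarith)
                    _ = 13 := by norm_num
          have h0 : 0 ≤ x ^ 4 := by positivity
          linarith
        · have h1 : 0 ≤ x ^ p := Real.rpow_nonneg hu p
          nlinarith [mul_nonneg (sq_nonneg x) (show 0 ≤ x ^ 2 - 169 by nlinarith)]
      rw [bav_add, bav_mul, bav_mul, hu2] at this
      linarith
    have upper : bav (fun ε => (|Q ε| / s) ^ p) ≤ 2 := by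
      have : bav (fun ε => (|Q ε| / s) ^ p) ≤ bav (fun ε => 1 + (|Q ε| / s) ^ 2) := by
        refine bav_mono fun ε => ?_
        have hu : 0 ≤ |Q ε| / s := by positivity
        generalize |Q ε| / s = x at hu
        rcases le_total x 1 with h | h
        · have := Real.rpow_le_one hu h (by linarith : 0 ≤ p)
          nlinarith [sq_nonneg x]
        · have := Real.rpow_le_rpow_of_exponent_le h hp2
          rw [Real.rpow_two] at this
          linarith
      rw [bav_add, bav_const, hu2] at this
      linarith
    constructor
    · nlinarith
    · nlinarith

lemma count_split {i j : Fin n} (hij : i ≠ j) :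
    4 * (∑ ε : Fin n → Bool, if ε i = true ∧ ε j = false then (1:ℝ) else 0) = 2 ^ n := by
  have h1 : bav (fun ε : Fin n → Bool => if ε i = true ∧ ε j = false then (1:ℝ) else 0) = 1 / 4 := by
    rw [show (fun ε : Fin n → Bool => if ε i = true ∧ ε j = false then (1:ℝ) else 0) = fun ε =>
      1 / 4 + (1 / 4) * (bsgn (ε i) * (1 - bsgn (ε j))) + (-1 / 4) * bsgn (ε j) from by
        ext ε
        cases ε i <;> cases ε j <;> norm_num [bsgn]]
    rw [bav_add, bav_add, bav_const, bav_mul, bav_mul, bav_odd i, bav_odd j]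
    · ring
    · intro ε; rw [bsgn_flip_self]
    · intro ε; rw [bsgn_flip_self, bsgn_flip_ne hij.symm]; ring
  unfold bav at h1
  rw [div_eq_iff (by positivity)] at h1
  rw [h1]; ring

end CHAOS

section DECOUP
variable {Ω : Type u} [MeasurableSpace Ω] (μ : Measure Ω) [IsProbabilityMeasure μ] {n : ℕ}

lemma count_split_enn {i j : Fin n} (hij : i ≠ j) :
    4 * (∑ ε : Fin n → Bool, if ε i = true ∧ ε j = false then (1:ℝ≥0∞) else 0) = 2 ^ n := by
  have h := count_split hij
  rw [Finset.sum_boole] at h ⊢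
  exact_mod_cast h

lemma decoup_pt {q : ℝ} (hq : 1 / 2 ≤ q) (hq1 : q ≤ 1) (w : Fin n → Fin n → ℝ≥0∞)
    (hw : ∀ i j, w i j ≠ ⊤) (hd : ∀ i, w i i = 0) :
    2 ^ n * (∑ i, ∑ j, w i j) ^ q
      ≤ 4 * ∑ ε : Fin n → Bool, (∑ i, ∑ j, if ε i = true ∧ ε j = false then w i j else 0) ^ q := by
  set W := ∑ i, ∑ j, w i j with hW
  set Z : (Fin n → Bool) → ℝ≥0∞ := fun ε => ∑ i, ∑ j, if ε i = true ∧ ε j = false then w i j else 0 with hZ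
  have hq0 : 0 < q := by linarith
  have hWt : W ≠ ⊤ := by
    rw [hW]; exact ENNReal.sum_ne_top.2 fun i _ => ENNReal.sum_ne_top.2 fun j _ => hw i j
  have hZW : ∀ ε, Z ε ≤ W := by
    intro ε
    refine Finset.sum_le_sum fun i _ => Finset.sum_le_sum fun j _ => ?_
    split_ifs <;> simp
  have hsum : 4 * ∑ ε, Z ε = 2 ^ n * W := by
    rw [hZ, hW]
    simp only
    rw [Finset.sum_comm, Finset.mul_sum, Finset.mul_sum]
    refine Finset.sum_congr rfl fun i _ => ?_
    rw [Finset.sum_comm, Finset.mul_sum, Finset.mul_sum]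
    refine Finset.sum_congr rfl fun j _ => ?_
    by_cases hij : i = j
    · subst hij; simp [hd]
    · rw [← count_split_enn hij, mul_assoc, Finset.sum_mul]
      simp
  by_cases hW0 : W = 0
  · rw [hW0, ENNReal.zero_rpow_of_pos hq0]; simp
  have hZq : ∀ ε, Z ε ≤ Z ε ^ q * W ^ (1 - q) := by
    intro ε
    calc Z ε = Z ε ^ (q + (1 - q)) := by simp
      _ = Z ε ^ q * Z ε ^ (1 - q) := ENNReal.rpow_add_of_nonneg _ _ hq0.le (by linarith)
      _ ≤ _ := mul_le_mul_right (ENNReal.rpow_le_rpow (hZW ε) (by linarith)) _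
  have hc0 : W ^ (1 - q) ≠ 0 := by
    intro h; rw [ENNReal.rpow_eq_zero_iff] at h; rcases h with h | h
    · exact hW0 h.1
    · exact hWt h.1
  have hct : W ^ (1 - q) ≠ ⊤ := ENNReal.rpow_ne_top_of_nonneg (by linarith) hWt
  rw [← ENNReal.mul_le_mul_iff_left hc0 hct]
  calc 2 ^ n * W ^ q * W ^ (1 - q) = 2 ^ n * W := by
        rw [mul_assoc, ← ENNReal.rpow_add_of_nonneg _ _ hq0.le (by linarith)]; simp
    _ = 4 * ∑ ε, Z ε := hsum.symm
    _ ≤ 4 * ∑ ε, Z ε ^ q * W ^ (1 - q) := by gcongr with ε; exact hZq ε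
    _ = _ := by rw [← Finset.sum_mul, mul_assoc]

lemma decoup {q : ℝ} (hq : 1 / 2 ≤ q) (hq1 : q ≤ 1) (F : Fin n → Fin n → Ω × Ω → ℝ≥0∞)
    (hF : ∀ i j, Measurable (F i j)) (hFt : ∀ i j z, F i j z ≠ ⊤) (hd : ∀ i z, F i i z = 0) :
    ∫⁻ x, ∫⁻ y, (∑ j, ∑ i, F i j (x i, y j)) ^ q ∂(Measure.pi fun _ : Fin n => μ)
        ∂(Measure.pi fun _ : Fin n => μ)
      ≤ 4 * ∫⁻ x, (∑ i, ∑ j, F i j (x i, x j)) ^ q ∂(Measure.pi fun _ : Fin n => μ) := by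
  have hq0 : 0 < q := by linarith
  set P := Measure.pi fun _ : Fin n => μ with hP
  set G : (Fin n → Bool) → (Fin n → Ω) × (Fin n → Ω) → ℝ≥0∞ := fun ε z =>
    (∑ i, ∑ j, if ε i = true ∧ ε j = false then F i j (z.1 i, z.2 j) else 0) ^ q with hG
  have hGm : ∀ ε, Measurable (G ε) := by
    intro ε
    refine Measurable.pow_const (Finset.measurable_fun_sum _ fun i _ =>
      Finset.measurable_fun_sum _ fun j _ => ?_) _
    split_ifs
    · exact (hF i j).comp (by fun_prop)
    · exact measurable_const
  have hHm : Measurable (fun x : Fin n → Ω => (∑ i, ∑ j, F i j (x i, x j)) ^ q) := by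
    refine Measurable.pow_const (Finset.measurable_fun_sum _ fun i _ =>
      Finset.measurable_fun_sum _ fun j _ => ?_) _
    exact (hF i j).comp (by fun_prop)
  have hHm2 : Measurable (fun z : (Fin n → Ω) × (Fin n → Ω) => (∑ i, ∑ j, F i j (z.1 i, z.2 j)) ^ q) := by
    refine Measurable.pow_const (Finset.measurable_fun_sum _ fun i _ =>
      Finset.measurable_fun_sum _ fun j _ => ?_) _
    exact (hF i j).comp (by fun_prop)
  have hGle : ∀ ε, ∫⁻ z, G ε z ∂(P.prod P) ≤ ∫⁻ x, (∑ i, ∑ j, F i j (x i, x j)) ^ q ∂P := by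
    intro ε
    rw [← (mp_piecewise μ (Finset.univ.filter fun i => ε i = true)).lintegral_comp hHm]
    refine lintegral_mono fun z => ?_
    simp only [hG]
    refine ENNReal.rpow_le_rpow ?_ hq0.le
    refine Finset.sum_le_sum fun i _ => Finset.sum_le_sum fun j _ => ?_
    split_ifs with h
    · simp [Finset.piecewise, h.1, h.2]
    · simp
  have e1 : ∫⁻ x, ∫⁻ y, (∑ j, ∑ i, F i j (x i, y j)) ^ q ∂P ∂P
      = ∫⁻ z, (∑ i, ∑ j, F i j (z.1 i, z.2 j)) ^ q ∂(P.prod P) := by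
    rw [lintegral_prod _ hHm2.aemeasurable]
    refine lintegral_congr fun x => lintegral_congr fun y => ?_
    rw [Finset.sum_comm]
  rw [e1]
  have h2 : (2:ℝ≥0∞) ^ n ≠ 0 := by positivity
  have h2t : (2:ℝ≥0∞) ^ n ≠ ⊤ := by finiteness
  rw [← ENNReal.mul_le_mul_iff_right h2 h2t]
  calc 2 ^ n * ∫⁻ z, (∑ i, ∑ j, F i j (z.1 i, z.2 j)) ^ q ∂(P.prod P)
      = ∫⁻ z, 2 ^ n * (∑ i, ∑ j, F i j (z.1 i, z.2 j)) ^ q ∂(P.prod P) := by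
        rw [lintegral_const_mul _ hHm2]
    _ ≤ ∫⁻ z, 4 * ∑ ε, G ε z ∂(P.prod P) := by
        refine lintegral_mono fun z => ?_
        exact decoup_pt hq hq1 (fun i j => F i j (z.1 i, z.2 j)) (fun i j => hFt _ _ _) (fun i => hd _ _)
    _ = 4 * ∑ ε, ∫⁻ z, G ε z ∂(P.prod P) := by
        rw [lintegral_const_mul _ (Finset.measurable_fun_sum _ fun ε _ => hGm ε),
          lintegral_finsetSum _ fun ε _ => hGm ε]
    _ ≤ 4 * ∑ ε : Fin n → Bool, ∫⁻ x, (∑ i, ∑ j, F i j (x i, x j)) ^ q ∂P := by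
        gcongr with ε; exact hGle ε
    _ = _ := by simp; ring

end DECOUP

section SIGNS
variable {Ω : Type u} [MeasurableSpace Ω] (μ : Measure Ω) [IsProbabilityMeasure μ] {n : ℕ}

lemma ofReal_abs_rpow {p : ℝ} (hp : 0 ≤ p) (t : ℝ) : ENNReal.ofReal (|t| ^ p) = ‖t‖ₑ ^ p := by
  rw [← Real.norm_eq_abs, ← ENNReal.ofReal_rpow_of_nonneg (norm_nonneg _) hp, ofReal_norm]

lemma jensen_gen {α : Type*} [MeasurableSpace α] (P : Measure α) [IsProbabilityMeasure P]
    {g : α → ℝ≥0∞} (hg : AEMeasurable g P) {r s : ℝ} (hr : 0 < r) (hrs : r ≤ s) :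
    (∫⁻ a, g a ^ r ∂P) ^ (1 / r) ≤ (∫⁻ a, g a ^ s ∂P) ^ (1 / s) := by
  have h := eLpNorm'_le_eLpNorm'_of_exponent_le hr hrs P hg.aestronglyMeasurable
  simpa [eLpNorm'_eq_lintegral_enorm] using h

lemma jensen_convex {α : Type*} [MeasurableSpace α] (P : Measure α) [IsProbabilityMeasure P]
    {g : α → ℝ≥0∞} (hg : AEMeasurable g P) {p : ℝ} (hp : 1 ≤ p) :
    (∫⁻ a, g a ∂P) ^ p ≤ ∫⁻ a, g a ^ p ∂P := by
  have h := jensen_gen P hg one_pos hp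
  have h2 := ENNReal.rpow_le_rpow h (by linarith : 0 ≤ p)
  rw [← ENNReal.rpow_mul] at h2
  have hp0 : p ≠ 0 := by linarith
  simpa [hp0, ← ENNReal.rpow_mul] using h2

lemma jensen_concave {α : Type*} [MeasurableSpace α] (P : Measure α) [IsProbabilityMeasure P]
    {g : α → ℝ≥0∞} (hg : AEMeasurable g P) {q : ℝ} (hq0 : 0 < q) (hq : q ≤ 1) :
    ∫⁻ a, g a ^ q ∂P ≤ (∫⁻ a, g a ∂P) ^ q := by
  have h := jensen_gen P hg hq0 hq
  have h2 := ENNReal.rpow_le_rpow h hq0.le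
  rw [← ENNReal.rpow_mul] at h2
  simpa [hq0.ne', ← ENNReal.rpow_mul] using h2

lemma integrable_of_p {α : Type*} [MeasurableSpace α] (P : Measure α) [IsProbabilityMeasure P]
    {g : α → ℝ} (hg : Measurable g) {p : ℝ} (hp : 1 ≤ p)
    (hfin : ∫⁻ a, ENNReal.ofReal (|g a| ^ p) ∂P < ⊤) : Integrable g P := by
  refine ⟨hg.aestronglyMeasurable, ?_⟩
  simp_rw [ofReal_abs_rpow (by linarith : 0 ≤ p)] at hfin
  have h := (jensen_convex P hg.enorm.aemeasurable hp).trans_lt hfin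
  rw [hasFiniteIntegral_iff_enorm]
  by_contra hc
  rw [not_lt, top_le_iff] at hc
  rw [hc, ENNReal.top_rpow_of_pos (by linarith)] at h
  exact lt_irrefl _ h

lemma mp_integral {α β : Type*} [MeasurableSpace α] [MeasurableSpace β] {P : Measure α} {Q : Measure β}
    {φ : α → β} (h : MeasurePreserving φ P Q) {g : β → ℝ} (hg : Measurable g) :
    ∫ x, g (φ x) ∂P = ∫ y, g y ∂Q := by
  rw [← h.map_eq, integral_map h.measurable.aemeasurable hg.aestronglyMeasurable]

lemma cond_exp_pair (f : Ω → Ω → ℝ) (hm : Measurable (Function.uncurry f))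
    (hint : Integrable (Function.uncurry f) (μ.prod μ))
    (h1 : ∀ᵐ υ ∂μ, ∫ ξ, f ξ υ ∂μ = 0) (h2 : ∀ᵐ ξ ∂μ, ∫ υ, f ξ υ ∂μ = 0)
    {i j : Fin n} (hij : i ≠ j) (S : Finset (Fin n)) :
    ∀ᵐ x ∂(Measure.pi fun _ : Fin n => μ),
      Integrable (fun y : Fin n → Ω => f (S.piecewise x y i) (S.piecewise x y j))
        (Measure.pi fun _ : Fin n => μ) ∧
      ∫ y, f (S.piecewise x y i) (S.piecewise x y j) ∂(Measure.pi fun _ : Fin n => μ)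
        = if i ∈ S ∧ j ∈ S then f (x i) (x j) else 0 := by
  have ev : ∀ k : Fin n, MeasurePreserving (fun x : Fin n → Ω => x k) (Measure.pi fun _ => μ) μ :=
    fun k => measurePreserving_eval (fun _ : Fin n => μ) k
  by_cases hi : i ∈ S <;> by_cases hj : j ∈ S
  · refine Filter.Eventually.of_forall fun x => ?_
    simp [hi, hj]
  · have hs := hint.prod_right_ae
    filter_upwards [(ev i).quasiMeasurePreserving.ae hs, (ev i).quasiMeasurePreserving.ae h2] with x hx1 hx2
    simp only [hi, hj, Finset.piecewise_eq_of_mem, Finset.piecewise_eq_of_notMem, not_false_eq_true,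
      and_false, if_false]
    have hmx : Measurable (fun υ => f (x i) υ) := hm.comp (measurable_prodMk_left)
    refine ⟨(ev j).integrable_comp_of_integrable hx1, ?_⟩
    rw [mp_integral (ev j) hmx]; exact hx2
  · have hs := hint.prod_left_ae
    filter_upwards [(ev j).quasiMeasurePreserving.ae hs, (ev j).quasiMeasurePreserving.ae h1] with x hx1 hx2
    simp only [hi, hj, Finset.piecewise_eq_of_mem, Finset.piecewise_eq_of_notMem, not_false_eq_true,
      false_and, if_false]
    have hmx : Measurable (fun ξ => f ξ (x j)) := hm.comp (measurable_prodMk_right)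
    refine ⟨(ev i).integrable_comp_of_integrable hx1, ?_⟩
    rw [mp_integral (ev i) hmx]; exact hx2
  · refine Filter.Eventually.of_forall fun x => ?_
    simp only [hi, hj, Finset.piecewise_eq_of_notMem, not_false_eq_true,
      false_and, if_false]
    refine ⟨(mp_pair μ hij).integrable_comp_of_integrable hint, ?_⟩
    have := mp_integral (mp_pair μ hij) hm
    simp only [Function.uncurry] at this
    rw [this]
    have h3 := integral_prod _ hint
    simp only [Function.uncurry] at h3
    rw [h3]
    exact integral_eq_zero_of_ae h2

lemma meas_pairsum (f : Fin n → Fin n → Ω → Ω → ℝ) (hm : ∀ i j, Measurable (Function.uncurry (f i j))) :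
    Measurable (fun x : Fin n → Ω => ∑ i, ∑ j, f i j (x i) (x j)) := by
  refine Finset.measurable_fun_sum _ fun i _ => Finset.measurable_fun_sum _ fun j _ => ?_
  exact (hm i j).comp (by fun_prop : Measurable fun x : Fin n → Ω => (x i, x j))

lemma restrict_le {p : ℝ} (hp : 1 ≤ p) (f : Fin n → Fin n → Ω → Ω → ℝ)
    (hm : ∀ i j, Measurable (Function.uncurry (f i j)))
    (h0 : ∀ i, f i i = 0)
    (hint : ∀ i j, Integrable (Function.uncurry (f i j)) (μ.prod μ))
    (hz : ∀ i j, (∀ᵐ υ ∂μ, ∫ ξ, f i j ξ υ ∂μ = 0) ∧ (∀ᵐ ξ ∂μ, ∫ υ, f i j ξ υ ∂μ = 0))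
    (S : Finset (Fin n)) :
    ∫⁻ x, ‖∑ i, ∑ j, if i ∈ S ∧ j ∈ S then f i j (x i) (x j) else 0‖ₑ ^ p ∂(Measure.pi fun _ : Fin n => μ)
      ≤ ∫⁻ x, ‖∑ i, ∑ j, f i j (x i) (x j)‖ₑ ^ p ∂(Measure.pi fun _ : Fin n => μ) := by
  set P := Measure.pi fun _ : Fin n => μ with hP
  have hTm := meas_pairsum f hm
  have hTm2 : Measurable fun x : Fin n → Ω => ‖∑ i, ∑ j, f i j (x i) (x j)‖ₑ ^ p :=
    hTm.enorm.pow_const _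
  have hae : ∀ᵐ x ∂P, ∀ i j,
      Integrable (fun y : Fin n → Ω => f i j (S.piecewise x y i) (S.piecewise x y j)) P ∧
      ∫ y, f i j (S.piecewise x y i) (S.piecewise x y j) ∂P
        = if i ∈ S ∧ j ∈ S then f i j (x i) (x j) else 0 := by
    rw [ae_all_iff]; intro i
    rw [ae_all_iff]; intro j
    by_cases hij : i = j
    · subst hij
      refine Filter.Eventually.of_forall fun x => ?_
      simp [h0]
    · exact cond_exp_pair μ (f i j) (hm i j) (hint i j) (hz i j).1 (hz i j).2 hij S
  have hc : Measurable (fun z : (Fin n → Ω) × (Fin n → Ω) =>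
      ‖∑ i, ∑ j, f i j (S.piecewise z.1 z.2 i) (S.piecewise z.1 z.2 j)‖ₑ ^ p) :=
    hTm2.comp (mp_piecewise μ S).measurable
  rw [← (mp_piecewise μ S).lintegral_comp hTm2, lintegral_prod _ hc.aemeasurable]
  refine lintegral_mono_ae ?_
  filter_upwards [hae] with x hx
  have e : ∫ y, ∑ i, ∑ j, f i j (S.piecewise x y i) (S.piecewise x y j) ∂P
      = ∑ i, ∑ j, if i ∈ S ∧ j ∈ S then f i j (x i) (x j) else 0 := by
    rw [integral_finsetSum _ fun i _ => integrable_finsetSum _ fun j _ => (hx i j).1]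
    refine Finset.sum_congr rfl fun i _ => ?_
    rw [integral_finsetSum _ fun j _ => (hx i j).1]
    exact Finset.sum_congr rfl fun j _ => (hx i j).2
  rw [← e]
  have hmy : Measurable fun y => ∑ i, ∑ j, f i j (S.piecewise x y i) (S.piecewise x y j) :=
    hTm.comp ((mp_piecewise μ S).measurable.comp measurable_prodMk_left)
  calc _ ≤ (∫⁻ y, ‖∑ i, ∑ j, f i j (S.piecewise x y i) (S.piecewise x y j)‖ₑ ∂P) ^ p := by
        gcongr; exact enorm_integral_le_lintegral_enorm _
    _ ≤ _ := jensen_convex P hmy.enorm.aemeasurable hp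

lemma three_pow {p : ℝ} (hp : 0 < p) (hp2 : p ≤ 2) (a b c : ℝ≥0∞) :
    (a + b + c) ^ p ≤ 9 * (a ^ p + b ^ p + c ^ p) := by
  have h3 : (3:ℝ≥0∞) ^ p ≤ 9 := by
    calc (3:ℝ≥0∞) ^ p ≤ 3 ^ (2:ℝ) := ENNReal.rpow_le_rpow_of_exponent_le (by norm_num) hp2
      _ = 9 := by norm_num
  have key : ∀ m : ℝ≥0∞, a ≤ m → b ≤ m → c ≤ m → (a + b + c) ^ p ≤ 9 * m ^ p := by
    intro m ha hb hc
    calc (a + b + c) ^ p ≤ (3 * m) ^ p := by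
          gcongr
          calc a + b + c ≤ m + m + m := by gcongr
            _ = 3 * m := by ring
      _ = 3 ^ p * m ^ p := ENNReal.mul_rpow_of_nonneg _ _ hp.le
      _ ≤ _ := by gcongr
  rcases le_total a b with h1 | h1 <;> rcases le_total b c with h2 | h2 <;>
    rcases le_total a c with h3 | h3
  · refine (key c (by assumption) (by assumption) le_rfl).trans ?_; gcongr; exact le_add_self
  · refine (key a le_rfl (h2.trans h3) h3).trans ?_; gcongr; rw [add_assoc]; exact le_self_add
  · refine (key b (by assumption) le_rfl h2).trans ?_; gcongr; rw [add_right_comm]; exact le_add_self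
  · refine (key b (by assumption) le_rfl h2).trans ?_; gcongr; rw [add_right_comm]; exact le_add_self
  · refine (key c (by assumption) (by assumption) le_rfl).trans ?_; gcongr; exact le_add_self
  · refine (key a le_rfl h1 h3).trans ?_; gcongr; rw [add_assoc]; exact le_self_add
  · refine (key a le_rfl h1 (h2.trans h1)).trans ?_; gcongr; rw [add_assoc]; exact le_self_add
  · refine (key a le_rfl h1 h3).trans ?_; gcongr; rw [add_assoc]; exact le_self_add

lemma lint_lin3 {α : Type*} [MeasurableSpace α] (P : Measure α) {u v w : α → ℝ≥0∞}
    (hu : Measurable u) (hv : Measurable v) (hw : Measurable w) :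
    ∫⁻ x, 9 * (4 * u x + 4 * v x + w x) ∂P
      = 9 * (4 * ∫⁻ x, u x ∂P + 4 * ∫⁻ x, v x ∂P + ∫⁻ x, w x ∂P) := by
  rw [lintegral_const_mul _ (by fun_prop), lintegral_add_left (by fun_prop),
    lintegral_add_left (by fun_prop), lintegral_const_mul _ hu, lintegral_const_mul _ hv]

lemma sign_le {p : ℝ} (hp : 1 ≤ p) (hp2 : p ≤ 2) (f : Fin n → Fin n → Ω → Ω → ℝ)
    (hm : ∀ i j, Measurable (Function.uncurry (f i j)))
    (h0 : ∀ i, f i i = 0)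
    (hint : ∀ i j, Integrable (Function.uncurry (f i j)) (μ.prod μ))
    (hz : ∀ i j, (∀ᵐ υ ∂μ, ∫ ξ, f i j ξ υ ∂μ = 0) ∧ (∀ᵐ ξ ∂μ, ∫ υ, f i j ξ υ ∂μ = 0))
    (ε : Fin n → Bool) :
    ∫⁻ x, ‖∑ i, ∑ j, bsgn (ε i) * bsgn (ε j) * f i j (x i) (x j)‖ₑ ^ p ∂(Measure.pi fun _ : Fin n => μ)
      ≤ 81 * ∫⁻ x, ‖∑ i, ∑ j, f i j (x i) (x j)‖ₑ ^ p ∂(Measure.pi fun _ : Fin n => μ) := by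
  set P := Measure.pi fun _ : Fin n => μ with hP
  set S : Finset (Fin n) := Finset.univ.filter fun i => ε i = true with hS
  set I := ∫⁻ x, ‖∑ i, ∑ j, f i j (x i) (x j)‖ₑ ^ p ∂P with hI
  have h2p : (2:ℝ≥0∞) ^ p ≤ 4 := by
    calc (2:ℝ≥0∞) ^ p ≤ 2 ^ (2:ℝ) := ENNReal.rpow_le_rpow_of_exponent_le (by norm_num) hp2
      _ = 4 := by norm_num
  have hmT : ∀ T : Finset (Fin n), Measurable fun x : Fin n → Ω =>
      ‖∑ i, ∑ j, if i ∈ T ∧ j ∈ T then f i j (x i) (x j) else 0‖ₑ ^ p := by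
    intro T
    refine (Finset.measurable_fun_sum _ fun i _ => Finset.measurable_fun_sum _ fun j _ => ?_).enorm.pow_const _
    split_ifs
    · exact (hm i j).comp (by fun_prop : Measurable fun x : Fin n → Ω => (x i, x j))
    · exact measurable_const
  calc _ ≤ ∫⁻ x, 9 * (4 * ‖∑ i, ∑ j, if i ∈ S ∧ j ∈ S then f i j (x i) (x j) else 0‖ₑ ^ p
          + 4 * ‖∑ i, ∑ j, if i ∈ Sᶜ ∧ j ∈ Sᶜ then f i j (x i) (x j) else 0‖ₑ ^ p
          + ‖∑ i, ∑ j, f i j (x i) (x j)‖ₑ ^ p) ∂P := by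
        refine lintegral_mono fun x => ?_
        set A := ∑ i, ∑ j, if i ∈ S ∧ j ∈ S then f i j (x i) (x j) else 0 with hA
        set B := ∑ i, ∑ j, if i ∈ Sᶜ ∧ j ∈ Sᶜ then f i j (x i) (x j) else 0 with hB
        set C := ∑ i, ∑ j, f i j (x i) (x j) with hC
        have e : ∑ i, ∑ j, bsgn (ε i) * bsgn (ε j) * f i j (x i) (x j) = 2 * A + 2 * B + (- C) := by
          rw [hA, hB, hC]
          simp only [Finset.mul_sum, ← Finset.sum_add_distrib, ← Finset.sum_neg_distrib]
          refine Finset.sum_congr rfl fun i _ => Finset.sum_congr rfl fun j _ => ?_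
          simp only [hS, Finset.mem_compl, Finset.mem_filter, Finset.mem_univ, true_and]
          cases ε i <;> cases ε j <;> simp [bsgn] <;> ring
        rw [e]
        have e2 : ∀ t : ℝ, ‖2 * t‖ₑ = 2 * ‖t‖ₑ := by
          intro t; rw [enorm_mul]; congr 1; simp [Real.enorm_eq_ofReal_abs]
        have e4 : ∀ t : ℝ, ‖2 * t‖ₑ ^ p ≤ 4 * ‖t‖ₑ ^ p := by
          intro t; rw [e2, ENNReal.mul_rpow_of_nonneg _ _ (by linarith)]; gcongr
        calc ‖2 * A + 2 * B + (- C)‖ₑ ^ p ≤ (‖2 * A‖ₑ + ‖2 * B‖ₑ + ‖C‖ₑ) ^ p := by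
              gcongr
              refine (enorm_add_le _ _).trans ?_
              rw [enorm_neg]; gcongr; exact enorm_add_le _ _
          _ ≤ 9 * (‖2 * A‖ₑ ^ p + ‖2 * B‖ₑ ^ p + ‖C‖ₑ ^ p) := three_pow (by linarith) hp2 _ _ _
          _ ≤ _ := by gcongr <;> exact e4 _
    _ = 9 * (4 * ∫⁻ x, ‖∑ i, ∑ j, if i ∈ S ∧ j ∈ S then f i j (x i) (x j) else 0‖ₑ ^ p ∂P
          + 4 * ∫⁻ x, ‖∑ i, ∑ j, if i ∈ Sᶜ ∧ j ∈ Sᶜ then f i j (x i) (x j) else 0‖ₑ ^ p ∂P + I) := by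
        have hmS := hmT S
        have hmSc := hmT Sᶜ
        have hmf := (meas_pairsum f hm).enorm.pow_const p
        exact lint_lin3 P hmS hmSc hmf
    _ ≤ 9 * (4 * I + 4 * I + I) := by
        gcongr
        · exact restrict_le μ hp f hm h0 hint hz S
        · exact restrict_le μ hp f hm h0 hint hz Sᶜ
    _ = 81 * I := by ring

lemma khin_enn {p : ℝ} (hp1 : 1 ≤ p) (hp2 : p ≤ 2) (w : Fin n → Fin n → ℝ)
    (hw : ∀ i j, ¬ i < j → w i j = 0) :
    2 ^ n * (∑ i, ∑ j, ENNReal.ofReal (w i j ^ 2)) ^ (p / 2)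
      ≤ 26 * ∑ ε : Fin n → Bool, ‖∑ i, ∑ j, bsgn (ε i) * bsgn (ε j) * w i j‖ₑ ^ p ∧
    ∑ ε : Fin n → Bool, ‖∑ i, ∑ j, bsgn (ε i) * bsgn (ε j) * w i j‖ₑ ^ p
      ≤ 2 * (2 ^ n * (∑ i, ∑ j, ENNReal.ofReal (w i j ^ 2)) ^ (p / 2)) := by
  obtain ⟨h2, h4⟩ := bav_quad w hw Finset.univ
  obtain ⟨k1, k2⟩ := khin_real hp1 hp2 _ _ h2 h4
  set A := ∑ i, ∑ j, w i j ^ 2 with hA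
  have hA0 : 0 ≤ A := Finset.sum_nonneg fun i _ => Finset.sum_nonneg fun j _ => sq_nonneg _
  have eA : (∑ i, ∑ j, ENNReal.ofReal (w i j ^ 2)) ^ (p / 2) = ENNReal.ofReal (A ^ (p / 2)) := by
    rw [← ENNReal.ofReal_rpow_of_nonneg hA0 (by linarith), hA,
      ENNReal.ofReal_sum_of_nonneg fun i _ => Finset.sum_nonneg fun j _ => sq_nonneg _]
    congr 1
    refine Finset.sum_congr rfl fun i _ => ?_
    rw [ENNReal.ofReal_sum_of_nonneg fun j _ => sq_nonneg _]
  set Q : (Fin n → Bool) → ℝ := fun ε => ∑ i, ∑ j, bsgn (ε i) * bsgn (ε j) * w i j with hQ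
  have eQ : ∑ ε : Fin n → Bool, ‖∑ i, ∑ j, bsgn (ε i) * bsgn (ε j) * w i j‖ₑ ^ p
      = ENNReal.ofReal (∑ ε, |Q ε| ^ p) := by
    rw [ENNReal.ofReal_sum_of_nonneg fun ε _ => by positivity]
    refine Finset.sum_congr rfl fun ε _ => ?_
    rw [ofReal_abs_rpow (by linarith)]
  have e2 : (2:ℝ≥0∞) ^ n = ENNReal.ofReal (2 ^ n) := by
    rw [ENNReal.ofReal_pow (by norm_num)]; norm_num
  have e26 : (26:ℝ≥0∞) = ENNReal.ofReal 26 := by norm_num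
  have e2' : (2:ℝ≥0∞) = ENNReal.ofReal 2 := by norm_num
  unfold bav at k1 k2
  have hpos : (0:ℝ) < 2 ^ n := by positivity
  rw [eA, eQ]
  constructor
  · rw [e2, e26, ← ENNReal.ofReal_mul (by positivity), ← ENNReal.ofReal_mul (by positivity)]
    refine ENNReal.ofReal_le_ofReal ?_
    rw [← mul_div_assoc, le_div_iff₀ hpos] at k1
    linarith
  · rw [e2]
    nth_rewrite 1 [e2']
    rw [← ENNReal.ofReal_mul (by positivity), ← ENNReal.ofReal_mul (by positivity)]
    refine ENNReal.ofReal_le_ofReal ?_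
    rw [div_le_iff₀ hpos] at k2
    linarith

lemma chaos_equiv {p : ℝ} (hp : 1 ≤ p) (hp2 : p ≤ 2) (f : Fin n → Fin n → Ω → Ω → ℝ)
    (hm : ∀ i j, Measurable (Function.uncurry (f i j)))
    (h0 : ∀ i j, ¬ i < j → f i j = 0)
    (hint : ∀ i j, Integrable (Function.uncurry (f i j)) (μ.prod μ))
    (hz : ∀ i j, (∀ᵐ υ ∂μ, ∫ ξ, f i j ξ υ ∂μ = 0) ∧ (∀ᵐ ξ ∂μ, ∫ υ, f i j ξ υ ∂μ = 0)) :
    ∫⁻ x, (∑ i, ∑ j, ENNReal.ofReal (f i j (x i) (x j) ^ 2)) ^ (p / 2) ∂(Measure.pi fun _ : Fin n => μ)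
      ≤ 2106 * ∫⁻ x, ‖∑ i, ∑ j, f i j (x i) (x j)‖ₑ ^ p ∂(Measure.pi fun _ : Fin n => μ) ∧
    ∫⁻ x, ‖∑ i, ∑ j, f i j (x i) (x j)‖ₑ ^ p ∂(Measure.pi fun _ : Fin n => μ)
      ≤ 162 * ∫⁻ x, (∑ i, ∑ j, ENNReal.ofReal (f i j (x i) (x j) ^ 2)) ^ (p / 2)
          ∂(Measure.pi fun _ : Fin n => μ) := by
  set P := Measure.pi fun _ : Fin n => μ with hP
  set I := ∫⁻ x, ‖∑ i, ∑ j, f i j (x i) (x j)‖ₑ ^ p ∂P with hI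
  have hpw := fun x : Fin n → Ω => khin_enn hp hp2 (fun i j => f i j (x i) (x j))
    (fun i j hij => by rw [h0 i j hij]; rfl)
  have h2 : (2:ℝ≥0∞) ^ n ≠ 0 := by positivity
  have h2t : (2:ℝ≥0∞) ^ n ≠ ⊤ := by finiteness
  have hgm : ∀ ε : Fin n → Bool, ∀ i j,
      Measurable (Function.uncurry fun ξ υ => bsgn (ε i) * bsgn (ε j) * f i j ξ υ) := by
    intro ε i j
    exact (hm i j).const_mul _
  have hQm : ∀ ε : Fin n → Bool, Measurable fun x : Fin n → Ω =>
      ‖∑ i, ∑ j, bsgn (ε i) * bsgn (ε j) * f i j (x i) (x j)‖ₑ ^ p := by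
    intro ε
    exact (meas_pairsum (fun i j ξ υ => bsgn (ε i) * bsgn (ε j) * f i j ξ υ) (hgm ε)).enorm.pow_const _
  have hEm : Measurable fun x : Fin n → Ω =>
      (∑ i, ∑ j, ENNReal.ofReal (f i j (x i) (x j) ^ 2)) ^ (p / 2) := by
    refine (Finset.measurable_fun_sum _ fun i _ => Finset.measurable_fun_sum _ fun j _ => ?_).pow_const _
    exact (((hm i j).comp (by fun_prop : Measurable fun x : Fin n → Ω => (x i, x j))).pow_const 2).ennreal_ofReal
  have h00 : ∀ i, f i i = 0 := fun i => h0 i i (lt_irrefl _)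
  constructor
  · rw [← ENNReal.mul_le_mul_iff_right h2 h2t, ← lintegral_const_mul _ hEm]
    calc _ ≤ ∫⁻ x, 26 * ∑ ε : Fin n → Bool,
          ‖∑ i, ∑ j, bsgn (ε i) * bsgn (ε j) * f i j (x i) (x j)‖ₑ ^ p ∂P :=
          lintegral_mono fun x => (hpw x).1
      _ = 26 * ∑ ε : Fin n → Bool, ∫⁻ x,
          ‖∑ i, ∑ j, bsgn (ε i) * bsgn (ε j) * f i j (x i) (x j)‖ₑ ^ p ∂P := by
          rw [lintegral_const_mul _ (Finset.measurable_fun_sum _ fun ε _ => hQm ε),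
            lintegral_finsetSum _ fun ε _ => hQm ε]
      _ ≤ 26 * ∑ ε : Fin n → Bool, 81 * I := by
          gcongr with ε
          exact sign_le μ hp hp2 f hm h00 hint hz ε
      _ = _ := by simp; ring
  · have key : ∀ ε : Fin n → Bool, I ≤ 81 * ∫⁻ x,
          ‖∑ i, ∑ j, bsgn (ε i) * bsgn (ε j) * f i j (x i) (x j)‖ₑ ^ p ∂P := by
      intro ε
      have := sign_le μ hp hp2 (fun i j ξ υ => bsgn (ε i) * bsgn (ε j) * f i j ξ υ) (hgm ε)
        (fun i => by ext; simp [h00])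
        (fun i j => (hint i j).const_mul _)
        (fun i j => by
          simp only [integral_const_mul]
          constructor
          · filter_upwards [(hz i j).1] with a ha; rw [ha, mul_zero]
          · filter_upwards [(hz i j).2] with a ha; rw [ha, mul_zero]) ε
      refine le_trans (le_of_eq ?_) this
      rw [hI]
      refine lintegral_congr fun x => ?_
      congr 2
      refine Finset.sum_congr rfl fun i _ => Finset.sum_congr rfl fun j _ => ?_
      have a1 := bsgn_sq (ε i)
      have a2 := bsgn_sq (ε j)
      linear_combination (-(f i j (x i) (x j))) * a1 - (f i j (x i) (x j)) * bsgn (ε i) ^ 2 * a2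
    rw [← ENNReal.mul_le_mul_iff_right h2 h2t]
    calc 2 ^ n * I = ∑ ε : Fin n → Bool, I := by simp
      _ ≤ ∑ ε : Fin n → Bool, 81 * ∫⁻ x,
          ‖∑ i, ∑ j, bsgn (ε i) * bsgn (ε j) * f i j (x i) (x j)‖ₑ ^ p ∂P :=
          Finset.sum_le_sum fun ε _ => key ε
      _ = 81 * ∫⁻ x, ∑ ε : Fin n → Bool,
          ‖∑ i, ∑ j, bsgn (ε i) * bsgn (ε j) * f i j (x i) (x j)‖ₑ ^ p ∂P := by
          rw [← Finset.mul_sum, lintegral_finsetSum _ fun ε _ => hQm ε]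
      _ ≤ 81 * ∫⁻ x, 2 * (2 ^ n * (∑ i, ∑ j, ENNReal.ofReal (f i j (x i) (x j) ^ 2)) ^ (p / 2)) ∂P := by
          gcongr with x; exact (hpw x).2
      _ = _ := by
          rw [lintegral_const_mul _ (hEm.const_mul _), lintegral_const_mul _ hEm]; ring

end SIGNS

section UPPER
variable {Ω : Type u} [MeasurableSpace Ω] (μ : Measure Ω) [IsProbabilityMeasure μ] {n : ℕ}

lemma rpow_sum_sub {q : ℝ} (hq0 : 0 < q) (hq1 : q ≤ 1) {ι : Type*} (s : Finset ι) (g : ι → ℝ≥0∞) :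
    (∑ i ∈ s, g i) ^ q ≤ ∑ i ∈ s, g i ^ q := by
  classical
  induction s using Finset.induction_on with
  | empty => simp [hq0]
  | insert a s ha ih =>
    rw [Finset.sum_insert ha, Finset.sum_insert ha]
    exact (ENNReal.rpow_add_le_add_rpow _ _ hq0.le hq1).trans (by gcongr)

lemma sq_rpow_half {p : ℝ} (hp : 0 ≤ p) (t : ℝ) :
    ENNReal.ofReal (t ^ 2) ^ (p / 2) = ENNReal.ofReal (|t| ^ p) := by
  rw [ofReal_abs_rpow hp, ← sq_abs, ENNReal.ofReal_pow (abs_nonneg _), ← Real.enorm_eq_ofReal_abs,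
    ← ENNReal.rpow_natCast, ← ENNReal.rpow_mul]
  congr 1
  push_cast; ring

lemma meas_ev2 {C : Ω → Ω → ℝ≥0∞} (hC : Measurable (Function.uncurry C)) (i j : Fin n) :
    Measurable fun x : Fin n → Ω => C (x i) (x j) :=
  hC.comp (by fun_prop : Measurable fun x : Fin n → Ω => (x i, x j))

lemma upper_a {q : ℝ} (hq0 : 0 < q) (hq1 : q ≤ 1) (C : Fin n → Fin n → Ω → Ω → ℝ≥0∞)
    (hC : ∀ i j, Measurable (Function.uncurry (C i j))) (h0 : ∀ i, C i i = 0) :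
    ∫⁻ x, (∑ i, ∑ j, C i j (x i) (x j)) ^ q ∂(Measure.pi fun _ : Fin n => μ)
      ≤ (∑ i, ∑ j, ∫⁻ ξ, ∫⁻ υ, C i j ξ υ ∂μ ∂μ) ^ q := by
  have hm : ∀ i j, Measurable fun x : Fin n → Ω => C i j (x i) (x j) := fun i j => meas_ev2 (hC i j) i j
  refine (jensen_concave _ (Finset.measurable_fun_sum _ fun i _ =>
    Finset.measurable_fun_sum _ fun j _ => hm i j).aemeasurable hq0 hq1).trans (le_of_eq ?_)
  congr 1
  rw [lintegral_finsetSum _ fun i _ => Finset.measurable_fun_sum _ fun j _ => hm i j]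
  refine Finset.sum_congr rfl fun i _ => ?_
  rw [lintegral_finsetSum _ fun j _ => hm i j]
  refine Finset.sum_congr rfl fun j _ => ?_
  by_cases hij : i = j
  · subst hij; simp [h0]
  · exact lintegral_pair μ hij (hC i j)

lemma upper_b {q : ℝ} (hq0 : 0 < q) (hq1 : q ≤ 1) (C : Fin n → Fin n → Ω → Ω → ℝ≥0∞)
    (hC : ∀ i j, Measurable (Function.uncurry (C i j))) (h0 : ∀ i, C i i = 0) :
    ∫⁻ x, (∑ i, ∑ j, C i j (x i) (x j)) ^ q ∂(Measure.pi fun _ : Fin n => μ)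
      ≤ ∑ i, ∑ j, ∫⁻ ξ, ∫⁻ υ, C i j ξ υ ^ q ∂μ ∂μ := by
  have hm : ∀ i j, Measurable fun x : Fin n → Ω => C i j (x i) (x j) ^ q :=
    fun i j => (meas_ev2 (hC i j) i j).pow_const _
  calc _ ≤ ∫⁻ x, ∑ i, ∑ j, C i j (x i) (x j) ^ q ∂(Measure.pi fun _ : Fin n => μ) := by
        refine lintegral_mono fun x => ?_
        refine (rpow_sum_sub hq0 hq1 _ _).trans (Finset.sum_le_sum fun i _ => ?_)
        exact rpow_sum_sub hq0 hq1 _ _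
    _ = _ := by
        rw [lintegral_finsetSum _ fun i _ => Finset.measurable_fun_sum _ fun j _ => hm i j]
        refine Finset.sum_congr rfl fun i _ => ?_
        rw [lintegral_finsetSum _ fun j _ => hm i j]
        refine Finset.sum_congr rfl fun j _ => ?_
        by_cases hij : i = j
        · subst hij; simp [h0, hq0]
        · exact lintegral_pair (h := fun ξ υ => C i j ξ υ ^ q) μ hij ((hC i j).pow_const q)

lemma upper_c {q : ℝ} (hq0 : 0 < q) (hq1 : q ≤ 1) (C : Fin n → Fin n → Ω → Ω → ℝ≥0∞)
    (hC : ∀ i j, Measurable (Function.uncurry (C i j))) (h0 : ∀ i, C i i = 0) :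
    ∫⁻ x, (∑ i, ∑ j, C i j (x i) (x j)) ^ q ∂(Measure.pi fun _ : Fin n => μ)
      ≤ ∑ i, ∫⁻ ξ, (∑ j, ∫⁻ υ, C i j ξ υ ∂μ) ^ q ∂μ := by
  have hm : ∀ i, Measurable fun x : Fin n → Ω => (∑ j, C i j (x i) (x j)) ^ q :=
    fun i => (Finset.measurable_fun_sum _ fun j _ => (meas_ev2 (hC i j) i j)).pow_const _
  calc _ ≤ ∫⁻ x, ∑ i, (∑ j, C i j (x i) (x j)) ^ q ∂(Measure.pi fun _ : Fin n => μ) :=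
        lintegral_mono fun x => rpow_sum_sub hq0 hq1 _ _
    _ = ∑ i, ∫⁻ x, (∑ j, C i j (x i) (x j)) ^ q ∂(Measure.pi fun _ : Fin n => μ) :=
        lintegral_finsetSum _ fun i _ => hm i
    _ ≤ _ := by
        refine Finset.sum_le_sum fun i _ => ?_
        rw [lintegral_upd μ i (hm i)]
        refine lintegral_mono fun ξ => ?_
        have hs : ∀ j, Measurable (C i j ξ) := fun j => (hC i j).comp measurable_prodMk_left
        have e : ∀ x : Fin n → Ω, ∑ j, C i j (Function.update x i ξ i) (Function.update x i ξ j)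
            = ∑ j, C i j ξ (x j) := by
          intro x
          refine Finset.sum_congr rfl fun j _ => ?_
          by_cases hij : j = i
          · subst hij; simp [h0]
          · simp [Function.update_of_ne hij]
        simp_rw [e]
        have hsx : ∀ j, Measurable fun x : Fin n → Ω => C i j ξ (x j) :=
          fun j => (hs j).comp (measurable_pi_apply j)
        refine (jensen_concave _ (Finset.measurable_fun_sum _ fun j _ => hsx j).aemeasurable
          hq0 hq1).trans (le_of_eq ?_)
        congr 1
        rw [lintegral_finsetSum _ fun j _ => hsx j]
        exact Finset.sum_congr rfl fun j _ => lintegral_ev μ j (hs j)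

lemma upper_d {q : ℝ} (hq0 : 0 < q) (hq1 : q ≤ 1) (C : Fin n → Fin n → Ω → Ω → ℝ≥0∞)
    (hC : ∀ i j, Measurable (Function.uncurry (C i j))) (h0 : ∀ i, C i i = 0) :
    ∫⁻ x, (∑ i, ∑ j, C i j (x i) (x j)) ^ q ∂(Measure.pi fun _ : Fin n => μ)
      ≤ ∑ j, ∫⁻ υ, (∑ i, ∫⁻ ξ, C i j ξ υ ∂μ) ^ q ∂μ := by
  have := upper_c μ hq0 hq1 (fun i j ξ υ => C j i υ ξ) (fun i j => (hC j i).comp measurable_swap)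
    (fun i => by ext; simp [h0])
  refine le_trans (le_of_eq (lintegral_congr fun x => ?_)) this
  rw [Finset.sum_comm]

lemma le_mul_sInf' {X C : ℝ≥0∞} (hC0 : C ≠ 0) (hC : C ≠ ⊤) {T : Set ℝ≥0∞} (h : ∀ s ∈ T, X ≤ C * s) :
    X ≤ C * sInf T := by
  rw [mul_comm, ← ENNReal.div_le_iff_le_mul (Or.inl hC0) (Or.inl hC)]
  refine le_sInf fun s hs => ?_
  rw [ENNReal.div_le_iff_le_mul (Or.inl hC0) (Or.inl hC), mul_comm]
  exact h s hs

lemma rpow_const_le {p : ℝ} (hp : 1 ≤ p) {K : ℝ≥0∞} (hK : 1 ≤ K) (X : ℝ≥0∞) :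
    (K * X) ^ (1 / p) ≤ K * X ^ (1 / p) := by
  have hp0 : 0 ≤ 1 / p := by positivity
  rw [ENNReal.mul_rpow_of_nonneg _ _ hp0]
  gcongr
  calc K ^ (1 / p) ≤ K ^ (1:ℝ) := ENNReal.rpow_le_rpow_of_exponent_le hK (by
        rw [div_le_one (by linarith)]; exact hp)
    _ = K := by simp

lemma upper_bound {p : ℝ} (hp : 1 ≤ p) (hp2 : p ≤ 2) (f a b c d : Fin n → Fin n → Ω → Ω → ℝ)
    (hm : ∀ i j, Measurable (Function.uncurry (f i j)))
    (h0 : ∀ i j, ¬ i < j → f i j = 0)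
    (hint : ∀ i j, Integrable (Function.uncurry (f i j)) (μ.prod μ))
    (hz : ∀ i j, (∀ᵐ υ ∂μ, ∫ ξ, f i j ξ υ ∂μ = 0) ∧ (∀ᵐ ξ ∂μ, ∫ υ, f i j ξ υ ∂μ = 0))
    (ha : ∀ i j, Measurable (Function.uncurry (a i j)))
    (hb : ∀ i j, Measurable (Function.uncurry (b i j)))
    (hc : ∀ i j, Measurable (Function.uncurry (c i j)))
    (hd : ∀ i j, Measurable (Function.uncurry (d i j)))
    (hs : ∀ i j, ¬ i < j → a i j = 0 ∧ b i j = 0 ∧ c i j = 0 ∧ d i j = 0)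
    (he : ∀ i j ξ υ, f i j ξ υ = a i j ξ υ + b i j ξ υ + c i j ξ υ + d i j ξ υ) :
    (∫⁻ x, ‖∑ i, ∑ j, f i j (x i) (x j)‖ₑ ^ p ∂(Measure.pi fun _ : Fin n => μ)) ^ (1 / p)
      ≤ 2592 * ((∑ i, ∑ j, ∫⁻ ξ, ∫⁻ υ, ENNReal.ofReal (a i j ξ υ ^ 2) ∂μ ∂μ) ^ ((1:ℝ)/2)
      + (∑ i, ∑ j, ∫⁻ ξ, ∫⁻ υ, ENNReal.ofReal (|b i j ξ υ| ^ p) ∂μ ∂μ) ^ (1/p)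
      + (∑ i, ∫⁻ ξ, (∑ j, ∫⁻ υ, ENNReal.ofReal (c i j ξ υ ^ 2) ∂μ) ^ (p/2) ∂μ) ^ (1/p)
      + (∑ j, ∫⁻ υ, (∑ i, ∫⁻ ξ, ENNReal.ofReal (d i j ξ υ ^ 2) ∂μ) ^ (p/2) ∂μ) ^ (1/p)) := by
  set P := Measure.pi fun _ : Fin n => μ with hP
  set Na := ∑ i, ∑ j, ∫⁻ ξ, ∫⁻ υ, ENNReal.ofReal (a i j ξ υ ^ 2) ∂μ ∂μ with hNa
  set Nb := ∑ i, ∑ j, ∫⁻ ξ, ∫⁻ υ, ENNReal.ofReal (|b i j ξ υ| ^ p) ∂μ ∂μ with hNb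
  set Nc := ∑ i, ∫⁻ ξ, (∑ j, ∫⁻ υ, ENNReal.ofReal (c i j ξ υ ^ 2) ∂μ) ^ (p/2) ∂μ with hNc
  set Nd := ∑ j, ∫⁻ υ, (∑ i, ∫⁻ ξ, ENNReal.ofReal (d i j ξ υ ^ 2) ∂μ) ^ (p/2) ∂μ with hNd
  have hq0 : 0 < p / 2 := by linarith
  have hq1 : p / 2 ≤ 1 := by linarith
  have hp0 : 0 < p := by linarith
  have sqm : ∀ g : Fin n → Fin n → Ω → Ω → ℝ, (∀ i j, Measurable (Function.uncurry (g i j))) →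
      ∀ i j, Measurable (Function.uncurry fun ξ υ => ENNReal.ofReal (g i j ξ υ ^ 2)) :=
    fun g hg i j => ((hg i j).pow_const 2).ennreal_ofReal
  have ua := upper_a μ hq0 hq1 (fun i j ξ υ => ENNReal.ofReal (a i j ξ υ ^ 2)) (sqm a ha)
    (fun i => by ext; simp [(hs i i (lt_irrefl _)).1])
  have ub := upper_b μ hq0 hq1 (fun i j ξ υ => ENNReal.ofReal (b i j ξ υ ^ 2)) (sqm b hb)
    (fun i => by ext; simp [(hs i i (lt_irrefl _)).2.1])
  have uc := upper_c μ hq0 hq1 (fun i j ξ υ => ENNReal.ofReal (c i j ξ υ ^ 2)) (sqm c hc)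
    (fun i => by ext; simp [(hs i i (lt_irrefl _)).2.2.1])
  have ud := upper_d μ hq0 hq1 (fun i j ξ υ => ENNReal.ofReal (d i j ξ υ ^ 2)) (sqm d hd)
    (fun i => by ext; simp [(hs i i (lt_irrefl _)).2.2.2])
  simp_rw [sq_rpow_half hp0.le] at ub
  rw [← hP] at ua ub uc ud
  rw [← hNa] at ua
  rw [← hNb] at ub
  rw [← hNc] at uc
  rw [← hNd] at ud
  set s := Na ^ ((1:ℝ)/2) + Nb ^ (1/p) + Nc ^ (1/p) + Nd ^ (1/p) with hsdef
  have inv : ∀ X : ℝ≥0∞, X ≤ (X ^ (1 / p)) ^ p := by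
    intro X; rw [← ENNReal.rpow_mul, one_div_mul_cancel hp0.ne', ENNReal.rpow_one]
  have ba : Na ^ (p / 2) ≤ s ^ p := by
    calc Na ^ (p / 2) = (Na ^ ((1:ℝ)/2)) ^ p := by rw [← ENNReal.rpow_mul]; congr 1; ring
      _ ≤ s ^ p := by
        gcongr; rw [hsdef, add_assoc, add_assoc]; exact le_self_add
  have bb : Nb ≤ s ^ p := by
    refine (inv _).trans ?_
    gcongr; rw [hsdef, add_assoc, add_assoc]; exact le_self_add.trans le_add_self
  have bc : Nc ≤ s ^ p := by
    refine (inv _).trans ?_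
    gcongr; rw [hsdef]; exact le_add_self.trans le_self_add
  have bd : Nd ≤ s ^ p := by
    refine (inv _).trans ?_
    gcongr; rw [hsdef]; exact le_add_self
  have hmm : ∀ g : Fin n → Fin n → Ω → Ω → ℝ, (∀ i j, Measurable (Function.uncurry (g i j))) →
      Measurable fun x : Fin n → Ω => (∑ i, ∑ j, ENNReal.ofReal (g i j (x i) (x j) ^ 2)) ^ (p / 2) :=
    fun g hg => (Finset.measurable_fun_sum _ fun i _ => Finset.measurable_fun_sum _ fun j _ =>
      meas_ev2 (sqm g hg i j) i j).pow_const _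
  have h4 : (4:ℝ≥0∞) ^ (p / 2) ≤ 4 := by
    calc (4:ℝ≥0∞) ^ (p / 2) ≤ 4 ^ (1:ℝ) := ENNReal.rpow_le_rpow_of_exponent_le (by norm_num) hq1
      _ = 4 := by simp
  have hpt : ∀ x : Fin n → Ω, (∑ i, ∑ j, ENNReal.ofReal (f i j (x i) (x j) ^ 2)) ^ (p / 2)
      ≤ 4 * ((∑ i, ∑ j, ENNReal.ofReal (a i j (x i) (x j) ^ 2)) ^ (p / 2)
        + (∑ i, ∑ j, ENNReal.ofReal (b i j (x i) (x j) ^ 2)) ^ (p / 2)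
        + (∑ i, ∑ j, ENNReal.ofReal (c i j (x i) (x j) ^ 2)) ^ (p / 2)
        + (∑ i, ∑ j, ENNReal.ofReal (d i j (x i) (x j) ^ 2)) ^ (p / 2)) := by
    intro x
    set A := ∑ i, ∑ j, ENNReal.ofReal (a i j (x i) (x j) ^ 2) with hA
    set B := ∑ i, ∑ j, ENNReal.ofReal (b i j (x i) (x j) ^ 2) with hB
    set C := ∑ i, ∑ j, ENNReal.ofReal (c i j (x i) (x j) ^ 2) with hC
    set D := ∑ i, ∑ j, ENNReal.ofReal (d i j (x i) (x j) ^ 2) with hD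
    have h1 : ∑ i, ∑ j, ENNReal.ofReal (f i j (x i) (x j) ^ 2) ≤ 4 * (A + B + C + D) := by
      rw [hA, hB, hC, hD]
      simp only [Finset.mul_sum, ← Finset.sum_add_distrib]
      refine Finset.sum_le_sum fun i _ => Finset.sum_le_sum fun j _ => ?_
      rw [he, ← ENNReal.ofReal_add (by positivity) (by positivity),
        ← ENNReal.ofReal_add (by positivity) (by positivity),
        ← ENNReal.ofReal_add (by positivity) (by positivity),
        show (4:ℝ≥0∞) = ENNReal.ofReal 4 by norm_num, ← ENNReal.ofReal_mul (by norm_num)]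
      refine ENNReal.ofReal_le_ofReal ?_
      generalize a i j (x i) (x j) = t1
      generalize b i j (x i) (x j) = t2
      generalize c i j (x i) (x j) = t3
      generalize d i j (x i) (x j) = t4
      nlinarith [sq_nonneg (t1 - t2), sq_nonneg (t1 - t3), sq_nonneg (t1 - t4), sq_nonneg (t2 - t3),
        sq_nonneg (t2 - t4), sq_nonneg (t3 - t4)]
    have sub := fun u v : ℝ≥0∞ => ENNReal.rpow_add_le_add_rpow u v hq0.le hq1
    calc _ ≤ (4 * (A + B + C + D)) ^ (p / 2) := by gcongr
      _ = 4 ^ (p / 2) * (A + B + C + D) ^ (p / 2) := ENNReal.mul_rpow_of_nonneg _ _ hq0.le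
      _ ≤ 4 * (A ^ (p / 2) + B ^ (p / 2) + C ^ (p / 2) + D ^ (p / 2)) := by
          gcongr
          refine (sub _ _).trans ?_
          gcongr
          refine (sub _ _).trans ?_
          gcongr
          exact sub _ _
  have hE : ∫⁻ x, (∑ i, ∑ j, ENNReal.ofReal (f i j (x i) (x j) ^ 2)) ^ (p / 2) ∂P ≤ 16 * s ^ p := by
    calc _ ≤ _ := lintegral_mono hpt
      _ = 4 * (∫⁻ x, (∑ i, ∑ j, ENNReal.ofReal (a i j (x i) (x j) ^ 2)) ^ (p / 2) ∂P
        + ∫⁻ x, (∑ i, ∑ j, ENNReal.ofReal (b i j (x i) (x j) ^ 2)) ^ (p / 2) ∂P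
        + ∫⁻ x, (∑ i, ∑ j, ENNReal.ofReal (c i j (x i) (x j) ^ 2)) ^ (p / 2) ∂P
        + ∫⁻ x, (∑ i, ∑ j, ENNReal.ofReal (d i j (x i) (x j) ^ 2)) ^ (p / 2) ∂P) := by
          have m1 := hmm a ha
          have m2 := hmm b hb
          have m3 := hmm c hc
          have m4 := hmm d hd
          rw [lintegral_const_mul _ (by fun_prop), lintegral_add_right _ m4,
            lintegral_add_right _ m3, lintegral_add_right _ m2]
      _ ≤ 4 * (s ^ p + s ^ p + s ^ p + s ^ p) := by
          gcongr
          · exact ua.trans ba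
          · exact ub.trans bb
          · exact uc.trans bc
          · exact ud.trans bd
      _ = _ := by ring
  calc _ ≤ (162 * (16 * s ^ p)) ^ (1 / p) := by
        refine ENNReal.rpow_le_rpow ?_ (by positivity)
        exact ((chaos_equiv μ hp hp2 f hm h0 hint hz).2).trans (by gcongr)
    _ = (2592 * s ^ p) ^ (1 / p) := by rw [← mul_assoc]; norm_num
    _ ≤ 2592 * (s ^ p) ^ (1 / p) := rpow_const_le hp (by norm_num) _
    _ = 2592 * s := by rw [← ENNReal.rpow_mul, mul_one_div_cancel hp0.ne', ENNReal.rpow_one]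

end UPPER

section LOWER
variable {Ω : Type u} [MeasurableSpace Ω] (μ : Measure Ω) [IsProbabilityMeasure μ] {n : ℕ}

/-- restriction of a kernel to a set -/
noncomputable def cutOff (f : Fin n → Fin n → Ω → Ω → ℝ) (T : Fin n → Fin n → Set (Ω × Ω)) :
    Fin n → Fin n → Ω → Ω → ℝ := fun i j ξ υ => (T i j).indicator (Function.uncurry (f i j)) (ξ, υ)

lemma cutOff_meas (f : Fin n → Fin n → Ω → Ω → ℝ) (T : Fin n → Fin n → Set (Ω × Ω))
    (hm : ∀ i j, Measurable (Function.uncurry (f i j))) (hT : ∀ i j, MeasurableSet (T i j)) (i j : Fin n) :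
    Measurable (Function.uncurry (cutOff f T i j)) := (hm i j).indicator (hT i j)

lemma cutOff_sq (f : Fin n → Fin n → Ω → Ω → ℝ) (T : Fin n → Fin n → Set (Ω × Ω)) (i j : Fin n) (ξ υ : Ω) :
    ENNReal.ofReal (cutOff f T i j ξ υ ^ 2)
      = (T i j).indicator (fun z => ENNReal.ofReal (f i j z.1 z.2 ^ 2)) (ξ, υ) := by
  unfold cutOff
  by_cases h : (ξ, υ) ∈ T i j
  · rw [Set.indicator_of_mem (by exact h), Set.indicator_of_mem (by exact h)]; rfl
  · rw [Set.indicator_of_notMem (by exact h), Set.indicator_of_notMem (by exact h)]; simp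

lemma lower_bound {p : ℝ} (hp : 1 ≤ p) (hp2 : p ≤ 2) (f : Fin n → Fin n → Ω → Ω → ℝ)
    (hm : ∀ i j, Measurable (Function.uncurry (f i j)))
    (h0 : ∀ i j, ¬ i < j → f i j = 0)
    (hint : ∀ i j, Integrable (Function.uncurry (f i j)) (μ.prod μ))
    (hz : ∀ i j, (∀ᵐ υ ∂μ, ∫ ξ, f i j ξ υ ∂μ = 0) ∧ (∀ᵐ ξ ∂μ, ∫ υ, f i j ξ υ ∂μ = 0)) :
    ∃ a b c d : Fin n → Fin n → Ω → Ω → ℝ,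
    (∀ i j, Measurable (Function.uncurry (a i j))) ∧
    (∀ i j, Measurable (Function.uncurry (b i j))) ∧
    (∀ i j, Measurable (Function.uncurry (c i j))) ∧
    (∀ i j, Measurable (Function.uncurry (d i j))) ∧
    (∀ i j, ¬ i < j → a i j = 0 ∧ b i j = 0 ∧ c i j = 0 ∧ d i j = 0) ∧
    (∀ i j ξ υ, f i j ξ υ = a i j ξ υ + b i j ξ υ + c i j ξ υ + d i j ξ υ) ∧
    (∑ i, ∑ j, ∫⁻ ξ, ∫⁻ υ, ENNReal.ofReal (a i j ξ υ ^ 2) ∂μ ∂μ) ^ ((1:ℝ)/2)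
      + (∑ i, ∑ j, ∫⁻ ξ, ∫⁻ υ, ENNReal.ofReal (|b i j ξ υ| ^ p) ∂μ ∂μ) ^ (1/p)
      + (∑ i, ∫⁻ ξ, (∑ j, ∫⁻ υ, ENNReal.ofReal (c i j ξ υ ^ 2) ∂μ) ^ (p/2) ∂μ) ^ (1/p)
      + (∑ j, ∫⁻ υ, (∑ i, ∫⁻ ξ, ENNReal.ofReal (d i j ξ υ ^ 2) ∂μ) ^ (p/2) ∂μ) ^ (1/p)
      ≤ 2 ^ 60 * (∫⁻ x, ‖∑ i, ∑ j, f i j (x i) (x j)‖ₑ ^ p ∂(Measure.pi fun _ : Fin n => μ)) ^ (1 / p) := by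
  have hp0 : 0 < p := by linarith
  have hq : 1 / 2 ≤ p / 2 := by linarith
  have hq1 : p / 2 ≤ 1 := by linarith
  set I := ∫⁻ x, ‖∑ i, ∑ j, f i j (x i) (x j)‖ₑ ^ p ∂(Measure.pi fun _ : Fin n => μ) with hI
  set F : Fin n → Fin n → Ω × Ω → ℝ≥0∞ := fun i j z => ENNReal.ofReal (f i j z.1 z.2 ^ 2) with hF
  have hFm : ∀ i j, Measurable (F i j) := fun i j => ((hm i j).pow_const 2).ennreal_ofReal
  obtain ⟨E, hE⟩ : ∃ E, E = ∫⁻ x, ∫⁻ y, (∑ j, ∑ i, F i j (x i, y j)) ^ (p / 2)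
      ∂(Measure.pi fun _ : Fin n => μ) ∂(Measure.pi fun _ : Fin n => μ) := ⟨_, rfl⟩
  have hEI : E ≤ 2 ^ 14 * I := by
    rw [hE]
    refine (decoup μ hq hq1 F hFm (fun i j z => ENNReal.ofReal_ne_top)
      (fun i z => by simp [hF, h0 i i (lt_irrefl _)])).trans ?_
    calc _ ≤ 4 * (2106 * I) := by gcongr; exact (chaos_equiv μ hp hp2 f hm h0 hint hz).1
      _ ≤ 2 ^ 14 * I := by rw [← mul_assoc]; gcongr; norm_num
  obtain ⟨R, S1, S2, hR, hS1, hS2, na, nb, nc, nd⟩ := nonneg_decomp μ hq hq1 F hFm E hE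
  refine ⟨cutOff f fun i j => R i j ∩ S1 i j, cutOff f fun i j => (R i j)ᶜ ∩ (S2 i j)ᶜ,
    cutOff f fun i j => R i j ∩ (S1 i j)ᶜ, cutOff f fun i j => (R i j)ᶜ ∩ S2 i j,
    cutOff_meas f _ hm fun i j => (hR i j).inter (hS1 i j),
    cutOff_meas f _ hm fun i j => (hR i j).compl.inter (hS2 i j).compl,
    cutOff_meas f _ hm fun i j => (hR i j).inter (hS1 i j).compl,
    cutOff_meas f _ hm fun i j => (hR i j).compl.inter (hS2 i j), ?_, ?_, ?_⟩
  · intro i j hij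
    have hz0 : ∀ T : Fin n → Fin n → Set (Ω × Ω), cutOff f T i j = 0 := by
      intro T; ext ξ υ
      unfold cutOff
      rw [h0 i j hij]
      exact Set.indicator_apply_eq_zero.2 fun _ => rfl
    exact ⟨hz0 _, hz0 _, hz0 _, hz0 _⟩
  · intro i j ξ υ
    unfold cutOff
    classical
    simp only [Set.indicator_apply, Set.mem_inter_iff, Set.mem_compl_iff, Function.uncurry]
    by_cases h1 : (ξ, υ) ∈ R i j <;> by_cases h2 : (ξ, υ) ∈ S1 i j <;>
      by_cases h3 : (ξ, υ) ∈ S2 i j <;> simp [h1, h2, h3]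
  · simp_rw [← sq_rpow_half hp0.le, cutOff_sq]
    have hEp : E ^ (1 / p) ≤ 2 ^ 14 * I ^ (1 / p) :=
      (ENNReal.rpow_le_rpow hEI (by positivity)).trans (rpow_const_le hp (by norm_num) _)
    have bb : ∀ {X : ℝ≥0∞} {K : ℝ≥0∞}, 1 ≤ K → X ≤ K * E → X ^ (1 / p) ≤ K * (2 ^ 14 * I ^ (1 / p)) := by
      intro X K hK hX
      calc X ^ (1 / p) ≤ (K * E) ^ (1 / p) := ENNReal.rpow_le_rpow hX (by positivity)
        _ ≤ K * E ^ (1 / p) := rpow_const_le hp hK _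
        _ ≤ _ := by gcongr
    have ba : ∀ {X : ℝ≥0∞}, X ≤ 2 ^ 20 * (2 ^ 20 * E) ^ (1 / (p / 2)) →
        X ^ ((1:ℝ) / 2) ≤ 2 ^ 20 * (2 ^ 20 * (2 ^ 14 * I ^ (1 / p))) := by
      intro X hX
      calc X ^ ((1:ℝ) / 2) ≤ (2 ^ 20 * (2 ^ 20 * E) ^ (1 / (p / 2))) ^ ((1:ℝ) / 2) :=
            ENNReal.rpow_le_rpow hX (by positivity)
        _ ≤ 2 ^ 20 * ((2 ^ 20 * E) ^ (1 / (p / 2))) ^ ((1:ℝ) / 2) :=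
            rpow_const_le (p := 2) (by norm_num) (by norm_num) _
        _ = 2 ^ 20 * (2 ^ 20 * E) ^ (1 / p) := by
            rw [← ENNReal.rpow_mul]; congr 2; field_simp
        _ ≤ _ := by gcongr; exact bb (by norm_num) le_rfl
    calc _ ≤ 2 ^ 20 * (2 ^ 20 * (2 ^ 14 * I ^ (1 / p))) + 16 * (2 ^ 14 * I ^ (1 / p))
          + 2 ^ 22 * (2 ^ 14 * I ^ (1 / p)) + 2 ^ 22 * (2 ^ 14 * I ^ (1 / p)) := by
          gcongr ?_ + ?_ + ?_ + ?_
          · exact ba na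
          · exact bb (by norm_num) nb
          · exact bb (by norm_num) nc
          · exact bb (by norm_num) nd
      _ = (2 ^ 20 * 2 ^ 20 * 2 ^ 14 + 16 * 2 ^ 14 + 2 ^ 22 * 2 ^ 14 + 2 ^ 22 * 2 ^ 14) * I ^ (1 / p) := by ring
      _ ≤ _ := by gcongr; norm_num

end LOWER

section PROJ
variable {Ω : Type u} [MeasurableSpace Ω] (μ : Measure Ω) [IsProbabilityMeasure μ] {n : ℕ}

lemma four_pow {r : ℝ} (hr : 1 ≤ r) (hr2 : r ≤ 2) (u v w t : ℝ≥0∞) :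
    (u + v + w + t) ^ r ≤ 4 * (u ^ r + v ^ r + w ^ r + t ^ r) := by
  have h2 : (2:ℝ≥0∞) ^ (r - 1) ≤ 2 := by
    calc (2:ℝ≥0∞) ^ (r - 1) ≤ 2 ^ (1:ℝ) :=
          ENNReal.rpow_le_rpow_of_exponent_le (by norm_num) (by linarith)
      _ = 2 := by simp
  have h : ∀ a b : ℝ≥0∞, (a + b) ^ r ≤ 2 * (a ^ r + b ^ r) := fun a b =>
    (ENNReal.rpow_add_le_mul_rpow_add_rpow a b hr).trans (by gcongr)
  calc (u + v + w + t) ^ r = ((u + v) + (w + t)) ^ r := by rw [add_assoc]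
    _ ≤ 2 * ((u + v) ^ r + (w + t) ^ r) := h _ _
    _ ≤ 2 * (2 * (u ^ r + v ^ r) + 2 * (w ^ r + t ^ r)) := by gcongr <;> exact h _ _
    _ = _ := by ring

lemma minkowski_two {α β : Type*} [MeasurableSpace α] [MeasurableSpace β] (P : Measure α) (Q : Measure β)
    [SFinite P] [SFinite Q] (H : α → β → ℝ≥0∞) (hH : Measurable (Function.uncurry H)) :
    ∫⁻ z, (∫⁻ x, H x z ∂P) ^ (2:ℝ) ∂Q ≤ (∫⁻ x, (∫⁻ z, H x z ^ (2:ℝ) ∂Q) ^ ((1:ℝ) / 2) ∂P) ^ (2:ℝ) := by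
  have hs1 : ∀ z, Measurable fun x => H x z := fun z => hH.comp measurable_prodMk_right
  have hs2 : ∀ x, Measurable fun z => H x z := fun x => hH.comp measurable_prodMk_left
  have hN : Measurable fun x => (∫⁻ z, H x z ^ (2:ℝ) ∂Q) ^ ((1:ℝ) / 2) :=
    (Measurable.lintegral_prod_right' (f := fun w : α × β => H w.1 w.2 ^ (2:ℝ)) (hH.pow_const 2)).pow_const _
  have hG : Measurable fun z => ∫⁻ x, H x z ∂P :=
    Measurable.lintegral_prod_left' (f := fun w : α × β => H w.1 w.2) hH
  calc ∫⁻ z, (∫⁻ x, H x z ∂P) ^ (2:ℝ) ∂Q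
      = ∫⁻ z, ∫⁻ x, H x z * (∫⁻ y, H y z ∂P) ∂P ∂Q := by
        refine lintegral_congr fun z => ?_
        rw [lintegral_mul_const _ (hs1 z)]
        rw [show (2:ℝ) = ((2:ℕ):ℝ) by norm_num, ENNReal.rpow_natCast, sq]
    _ = ∫⁻ x, ∫⁻ z, H x z * (∫⁻ y, H y z ∂P) ∂Q ∂P := by
        refine lintegral_lintegral_swap ?_
        refine Measurable.aemeasurable ?_
        exact (hH.comp measurable_swap).mul (hG.comp measurable_fst)
    _ = ∫⁻ x, ∫⁻ y, ∫⁻ z, H x z * H y z ∂Q ∂P ∂P := by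
        refine lintegral_congr fun x => ?_
        rw [lintegral_lintegral_swap]
        · refine lintegral_congr fun z => ?_
          rw [lintegral_const_mul _ (hs1 z)]
        · refine Measurable.aemeasurable ?_
          exact ((hs2 x).comp measurable_snd).mul hH
    _ ≤ ∫⁻ x, ∫⁻ y, (∫⁻ z, H x z ^ (2:ℝ) ∂Q) ^ ((1:ℝ) / 2) * (∫⁻ z, H y z ^ (2:ℝ) ∂Q) ^ ((1:ℝ) / 2) ∂P ∂P := by
        refine lintegral_mono fun x => lintegral_mono fun y => ?_
        exact ENNReal.lintegral_mul_le_Lp_mul_Lq Q Real.HolderConjugate.two_two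
          (hs2 x).aemeasurable (hs2 y).aemeasurable
    _ = _ := by
        simp_rw [lintegral_const_mul _ hN]
        rw [lintegral_mul_const _ hN]
        rw [show (2:ℝ) = ((2:ℕ):ℝ) by norm_num, ENNReal.rpow_natCast, sq]

/-- four-term majorant of the Hoeffding projection -/
noncomputable def fourMaj (H : Ω → Ω → ℝ≥0∞) (ξ υ : Ω) : ℝ≥0∞ :=
  H ξ υ + ∫⁻ x, H x υ ∂μ + ∫⁻ y, H ξ y ∂μ + ∫⁻ x, ∫⁻ y, H x y ∂μ ∂μ

lemma proj_ab {r : ℝ} (hr : 1 ≤ r) (hr2 : r ≤ 2) (H : Ω → Ω → ℝ≥0∞) (hH : Measurable (Function.uncurry H)) :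
    ∫⁻ ξ, ∫⁻ υ, fourMaj μ H ξ υ ^ r ∂μ ∂μ ≤ 16 * ∫⁻ ξ, ∫⁻ υ, H ξ υ ^ r ∂μ ∂μ := by
  have hs1 : ∀ z, Measurable fun x => H x z := fun z => hH.comp measurable_prodMk_right
  have hs2 : ∀ x, Measurable fun z => H x z := fun x => hH.comp measurable_prodMk_left
  have hHr : Measurable (Function.uncurry fun ξ υ => H ξ υ ^ r) := hH.pow_const r
  have hA : Measurable fun z => ∫⁻ x, H x z ∂μ :=
    Measurable.lintegral_prod_left' (f := fun w : Ω × Ω => H w.1 w.2) hH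
  have hB : Measurable fun x => ∫⁻ z, H x z ∂μ :=
    Measurable.lintegral_prod_right' (f := fun w : Ω × Ω => H w.1 w.2) hH
  have hT : Measurable fun x => ∫⁻ z, H x z ^ r ∂μ :=
    Measurable.lintegral_prod_right' (f := fun w : Ω × Ω => H w.1 w.2 ^ r) hHr
  set J := ∫⁻ ξ, ∫⁻ υ, H ξ υ ^ r ∂μ ∂μ with hJ
  have b2 : ∫⁻ υ, (∫⁻ x, H x υ ∂μ) ^ r ∂μ ≤ J := by
    calc _ ≤ ∫⁻ υ, ∫⁻ x, H x υ ^ r ∂μ ∂μ :=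
          lintegral_mono fun υ => jensen_convex μ (hs1 υ).aemeasurable hr
      _ = J := lintegral_lintegral_swap (hHr.comp measurable_swap).aemeasurable
  have b3 : ∫⁻ ξ, (∫⁻ y, H ξ y ∂μ) ^ r ∂μ ≤ J :=
    lintegral_mono fun ξ => jensen_convex μ (hs2 ξ).aemeasurable hr
  have b4 : (∫⁻ x, ∫⁻ y, H x y ∂μ ∂μ) ^ r ≤ J :=
    (jensen_convex μ hB.aemeasurable hr).trans b3
  calc ∫⁻ ξ, ∫⁻ υ, fourMaj μ H ξ υ ^ r ∂μ ∂μ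
      ≤ ∫⁻ ξ, ∫⁻ υ, 4 * (H ξ υ ^ r + (∫⁻ x, H x υ ∂μ) ^ r + (∫⁻ y, H ξ y ∂μ) ^ r
          + (∫⁻ x, ∫⁻ y, H x y ∂μ ∂μ) ^ r) ∂μ ∂μ :=
        lintegral_mono fun ξ => lintegral_mono fun υ => four_pow hr hr2 _ _ _ _
    _ = ∫⁻ ξ, 4 * (∫⁻ υ, H ξ υ ^ r ∂μ + ∫⁻ υ, (∫⁻ x, H x υ ∂μ) ^ r ∂μ + (∫⁻ y, H ξ y ∂μ) ^ r
          + (∫⁻ x, ∫⁻ y, H x y ∂μ ∂μ) ^ r) ∂μ := by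
        refine lintegral_congr fun ξ => ?_
        have := hs2 ξ
        rw [lintegral_const_mul _ (by fun_prop), lintegral_add_right _ measurable_const,
          lintegral_add_right _ measurable_const, lintegral_add_left (by fun_prop)]
        simp
    _ = 4 * (J + ∫⁻ υ, (∫⁻ x, H x υ ∂μ) ^ r ∂μ + ∫⁻ ξ, (∫⁻ y, H ξ y ∂μ) ^ r ∂μ
          + (∫⁻ x, ∫⁻ y, H x y ∂μ ∂μ) ^ r) := by
        rw [lintegral_const_mul _ (by fun_prop), lintegral_add_right _ measurable_const,
          lintegral_add_left (by fun_prop), lintegral_add_left (by fun_prop)]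
        simp [hJ]
    _ ≤ 4 * (J + J + J + J) := by gcongr
    _ = _ := by ring

lemma proj_c {p : ℝ} (hp : 1 ≤ p) (hp2 : p ≤ 2) (H : Fin n → Ω → Ω → ℝ≥0∞)
    (hH : ∀ j, Measurable (Function.uncurry (H j))) :
    ∫⁻ ξ, (∑ j, ∫⁻ υ, fourMaj μ (H j) ξ υ ^ (2:ℝ) ∂μ) ^ (p / 2) ∂μ
      ≤ 16 * ∫⁻ ξ, (∑ j, ∫⁻ υ, H j ξ υ ^ (2:ℝ) ∂μ) ^ (p / 2) ∂μ := by
  have hq0 : 0 < p / 2 := by linarith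
  have hq1 : p / 2 ≤ 1 := by linarith
  have hs1 : ∀ j z, Measurable fun x => H j x z := fun j z => (hH j).comp measurable_prodMk_right
  have hs2 : ∀ j x, Measurable fun z => H j x z := fun j x => (hH j).comp measurable_prodMk_left
  set N : Ω → ℝ≥0∞ := fun ξ => ∑ j, ∫⁻ υ, H j ξ υ ^ (2:ℝ) ∂μ with hN
  have hNm : Measurable N := Finset.measurable_fun_sum _ fun j _ =>
    Measurable.lintegral_prod_right' (f := fun w : Ω × Ω => H j w.1 w.2 ^ (2:ℝ)) ((hH j).pow_const 2)
  have hA : ∀ j, Measurable fun z => ∫⁻ x, H j x z ∂μ := fun j =>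
    Measurable.lintegral_prod_left' (f := fun w : Ω × Ω => H j w.1 w.2) (hH j)
  set L : ℝ≥0∞ := ∑ j, ∫⁻ υ, (∫⁻ x, H j x υ ∂μ) ^ (2:ℝ) ∂μ with hL
  have hLN : L ≤ (∫⁻ ξ, N ξ ^ ((1:ℝ) / 2) ∂μ) ^ (2:ℝ) := by
    have hHH : Measurable (Function.uncurry fun (ξ : Ω) (z : Fin n × Ω) => H z.1 ξ z.2) := by
      have h1 : Measurable fun w : Fin n × (Ω × Ω) => Function.uncurry (H w.1) w.2 :=
        meas_fin_prod (h := fun j (w : Ω × Ω) => Function.uncurry (H j) w) hH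
      exact h1.comp (by fun_prop : Measurable fun w : Ω × (Fin n × Ω) => (w.2.1, (w.1, w.2.2)))
    have := minkowski_two μ ((Measure.count : Measure (Fin n)).prod μ) (fun ξ z => H z.1 ξ z.2) hHH
    rw [hL, sum_lint_eq μ fun j => (hA j).pow_const 2]
    refine this.trans (le_of_eq ?_)
    congr 1
    refine lintegral_congr fun ξ => ?_
    simp only [hN]
    rw [sum_lint_eq μ fun j => (hs2 j ξ).pow_const 2]
  have hLq : L ^ (p / 2) ≤ ∫⁻ ξ, N ξ ^ (p / 2) ∂μ := by
    calc L ^ (p / 2) ≤ ((∫⁻ ξ, N ξ ^ ((1:ℝ) / 2) ∂μ) ^ (2:ℝ)) ^ (p / 2) := by gcongr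
      _ = (∫⁻ ξ, N ξ ^ ((1:ℝ) / 2) ∂μ) ^ p := by rw [← ENNReal.rpow_mul]; congr 1; ring
      _ ≤ ∫⁻ ξ, (N ξ ^ ((1:ℝ) / 2)) ^ p ∂μ := jensen_convex μ (hNm.pow_const _).aemeasurable hp
      _ = _ := by
        refine lintegral_congr fun ξ => ?_
        rw [← ENNReal.rpow_mul]; congr 1; ring
  have hpt : ∀ ξ, ∑ j, ∫⁻ υ, fourMaj μ (H j) ξ υ ^ (2:ℝ) ∂μ ≤ 8 * (N ξ + L) := by
    intro ξ
    calc _ ≤ ∑ j, 4 * (∫⁻ υ, H j ξ υ ^ (2:ℝ) ∂μ + ∫⁻ υ, (∫⁻ x, H j x υ ∂μ) ^ (2:ℝ) ∂μ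
            + ∫⁻ υ, H j ξ υ ^ (2:ℝ) ∂μ + ∫⁻ υ, (∫⁻ x, H j x υ ∂μ) ^ (2:ℝ) ∂μ) := by
          refine Finset.sum_le_sum fun j _ => ?_
          calc _ ≤ ∫⁻ υ, 4 * (H j ξ υ ^ (2:ℝ) + (∫⁻ x, H j x υ ∂μ) ^ (2:ℝ) + (∫⁻ y, H j ξ y ∂μ) ^ (2:ℝ)
                + (∫⁻ x, ∫⁻ y, H j x y ∂μ ∂μ) ^ (2:ℝ)) ∂μ :=
                lintegral_mono fun υ => four_pow (by norm_num) le_rfl _ _ _ _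
            _ = 4 * (∫⁻ υ, H j ξ υ ^ (2:ℝ) ∂μ + ∫⁻ υ, (∫⁻ x, H j x υ ∂μ) ^ (2:ℝ) ∂μ
                + (∫⁻ y, H j ξ y ∂μ) ^ (2:ℝ) + (∫⁻ x, ∫⁻ y, H j x y ∂μ ∂μ) ^ (2:ℝ)) := by
                have := hs2 j ξ
                have := hA j
                rw [lintegral_const_mul _ (by fun_prop), lintegral_add_right _ measurable_const,
                  lintegral_add_right _ measurable_const, lintegral_add_left (by fun_prop)]
                simp
            _ ≤ _ := by
                gcongr
                · exact jensen_convex μ (hs2 j ξ).aemeasurable (by norm_num)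
                · rw [lintegral_lintegral_swap (hH j).aemeasurable]
                  exact jensen_convex μ (hA j).aemeasurable (by norm_num)
      _ = 8 * (N ξ + L) := by
          rw [← Finset.mul_sum, Finset.sum_add_distrib, Finset.sum_add_distrib, Finset.sum_add_distrib,
            ← hL]
          simp only [hN]
          ring
  have h8 : (8:ℝ≥0∞) ^ (p / 2) ≤ 8 := by
    calc (8:ℝ≥0∞) ^ (p / 2) ≤ 8 ^ (1:ℝ) := ENNReal.rpow_le_rpow_of_exponent_le (by norm_num) hq1
      _ = 8 := by simp
  calc _ ≤ ∫⁻ ξ, 8 * (N ξ ^ (p / 2) + L ^ (p / 2)) ∂μ := by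
        refine lintegral_mono fun ξ => ?_
        calc _ ≤ (8 * (N ξ + L)) ^ (p / 2) := ENNReal.rpow_le_rpow (hpt ξ) hq0.le
          _ = 8 ^ (p / 2) * (N ξ + L) ^ (p / 2) := ENNReal.mul_rpow_of_nonneg _ _ hq0.le
          _ ≤ _ := by gcongr; exact ENNReal.rpow_add_le_add_rpow _ _ hq0.le hq1
    _ = 8 * (∫⁻ ξ, N ξ ^ (p / 2) ∂μ + L ^ (p / 2)) := by
        rw [lintegral_const_mul _ (by fun_prop), lintegral_add_right _ measurable_const]; simp
    _ ≤ 8 * (∫⁻ ξ, N ξ ^ (p / 2) ∂μ + ∫⁻ ξ, N ξ ^ (p / 2) ∂μ) := by gcongr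
    _ = _ := by ring

lemma fourMaj_swap (H : Ω → Ω → ℝ≥0∞) (hH : Measurable (Function.uncurry H)) (ξ υ : Ω) :
    fourMaj μ (fun x y => H y x) ξ υ = fourMaj μ H υ ξ := by
  unfold fourMaj
  rw [lintegral_lintegral_swap (f := fun x y => H y x) (hH.comp measurable_swap).aemeasurable]
  ring

end PROJ

section HOEFF
variable {Ω : Type u} [MeasurableSpace Ω] (μ : Measure Ω) [IsProbabilityMeasure μ] {n : ℕ}

/-- second-order Hoeffding projection -/
noncomputable def hproj (g : Ω → Ω → ℝ) (ξ υ : Ω) : ℝ :=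
  g ξ υ - ∫ x, g x υ ∂μ - ∫ y, g ξ y ∂μ + ∫ x, ∫ y, g x y ∂μ ∂μ

variable {μ}

lemma hproj_meas {g : Ω → Ω → ℝ} (hg : Measurable (Function.uncurry g)) :
    Measurable (Function.uncurry (hproj μ g)) := by
  have h1 : Measurable fun υ => ∫ x, g x υ ∂μ :=
    (StronglyMeasurable.integral_prod_left (f := g) hg.stronglyMeasurable).measurable
  have h2 : Measurable fun ξ => ∫ y, g ξ y ∂μ :=
    (StronglyMeasurable.integral_prod_right (f := g) hg.stronglyMeasurable).measurable
  exact ((hg.sub (h1.comp measurable_snd)).sub (h2.comp measurable_fst)).add measurable_const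

lemma hproj_int {g : Ω → Ω → ℝ} (hi : Integrable (Function.uncurry g) (μ.prod μ)) :
    Integrable (Function.uncurry (hproj μ g)) (μ.prod μ) := by
  have h1 : Integrable (fun υ => ∫ x, g x υ ∂μ) μ := hi.integral_prod_right
  have h2 : Integrable (fun ξ => ∫ y, g ξ y ∂μ) μ := hi.integral_prod_left
  exact ((hi.sub (h1.comp_snd μ)).sub (h2.comp_fst μ)).add (integrable_const _)

lemma int_sub4 {ν : Measure Ω} {u v w z : Ω → ℝ} (hu : Integrable u ν) (hv : Integrable v ν)
    (hw : Integrable w ν) (hz : Integrable z ν) :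
    ∫ x, (u x - v x - w x - z x) ∂ν
      = ∫ x, u x ∂ν - ∫ x, v x ∂ν - ∫ x, w x ∂ν - ∫ x, z x ∂ν := by
  have i1 : Integrable (fun x => u x - v x) ν := hu.sub hv
  have i2 : Integrable (fun x => u x - v x - w x) ν := i1.sub hw
  rw [integral_sub i2 hz, integral_sub i1 hw, integral_sub hu hv]

lemma hproj_mz {g : Ω → Ω → ℝ} (hi : Integrable (Function.uncurry g) (μ.prod μ)) :
    (∀ᵐ υ ∂μ, ∫ ξ, hproj μ g ξ υ ∂μ = 0) ∧ (∀ᵐ ξ ∂μ, ∫ υ, hproj μ g ξ υ ∂μ = 0) := by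
  have h1 : Integrable (fun υ => ∫ x, g x υ ∂μ) μ := hi.integral_prod_right
  have h2 : Integrable (fun ξ => ∫ y, g ξ y ∂μ) μ := hi.integral_prod_left
  constructor
  · filter_upwards [hi.prod_left_ae] with υ hυ
    have hυ' : Integrable (fun ξ => g ξ υ) μ := hυ
    unfold hproj
    have i1 : Integrable (fun ξ => g ξ υ - ∫ x, g x υ ∂μ) μ := hυ'.sub (integrable_const _)
    have i2 : Integrable (fun ξ => g ξ υ - ∫ x, g x υ ∂μ - ∫ y, g ξ y ∂μ) μ := i1.sub h2
    rw [integral_add i2 (integrable_const _), integral_sub i1 h2,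
      integral_sub hυ' (integrable_const _)]
    simp
  · filter_upwards [hi.prod_right_ae] with ξ hξ
    have hξ' : Integrable (fun υ => g ξ υ) μ := hξ
    unfold hproj
    have i1 : Integrable (fun υ => g ξ υ - ∫ x, g x υ ∂μ) μ := hξ'.sub h1
    have i2 : Integrable (fun υ => g ξ υ - ∫ x, g x υ ∂μ - ∫ y, g ξ y ∂μ) μ :=
      i1.sub (integrable_const _)
    rw [integral_add i2 (integrable_const _), integral_sub i1 (integrable_const _),
      integral_sub hξ' h1, integral_integral_swap (f := g) hi]
    simp

lemma hproj_le (g : Ω → Ω → ℝ) (ξ υ : Ω) :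
    ‖hproj μ g ξ υ‖ₑ ≤ fourMaj μ (fun x y => ‖g x y‖ₑ) ξ υ := by
  unfold hproj fourMaj
  refine (enorm_add_le _ _).trans ?_
  gcongr
  · refine (enorm_sub_le).trans ?_
    gcongr
    · refine (enorm_sub_le).trans ?_
      gcongr
      exact enorm_integral_le_lintegral_enorm _
    · exact enorm_integral_le_lintegral_enorm _
  · refine (enorm_integral_le_lintegral_enorm _).trans ?_
    exact lintegral_mono fun x => enorm_integral_le_lintegral_enorm _

lemma ofReal_sq_enorm (t : ℝ) : ENNReal.ofReal (t ^ 2) = ‖t‖ₑ ^ (2:ℝ) := by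
  rw [← ofReal_abs_rpow (by norm_num)]
  norm_num

lemma hproj_ab_bound {r : ℝ} (hr : 1 ≤ r) (hr2 : r ≤ 2) {g : Ω → Ω → ℝ} (hg : Measurable (Function.uncurry g)) :
    ∫⁻ ξ, ∫⁻ υ, ‖hproj μ g ξ υ‖ₑ ^ r ∂μ ∂μ ≤ 16 * ∫⁻ ξ, ∫⁻ υ, ‖g ξ υ‖ₑ ^ r ∂μ ∂μ := by
  refine le_trans ?_ (proj_ab μ hr hr2 (fun x y => ‖g x y‖ₑ) hg.enorm)
  refine lintegral_mono fun ξ => lintegral_mono fun υ => ?_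
  exact ENNReal.rpow_le_rpow (hproj_le g ξ υ) (by linarith)

lemma hproj_c_bound {p : ℝ} (hp : 1 ≤ p) (hp2 : p ≤ 2) {g : Fin n → Ω → Ω → ℝ}
    (hg : ∀ j, Measurable (Function.uncurry (g j))) :
    ∫⁻ ξ, (∑ j, ∫⁻ υ, ENNReal.ofReal (hproj μ (g j) ξ υ ^ 2) ∂μ) ^ (p / 2) ∂μ
      ≤ 16 * ∫⁻ ξ, (∑ j, ∫⁻ υ, ENNReal.ofReal (g j ξ υ ^ 2) ∂μ) ^ (p / 2) ∂μ := by
  simp_rw [ofReal_sq_enorm]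
  refine le_trans ?_ (proj_c μ hp hp2 (fun j x y => ‖g j x y‖ₑ) fun j => (hg j).enorm)
  refine lintegral_mono fun ξ => ENNReal.rpow_le_rpow ?_ (by linarith)
  refine Finset.sum_le_sum fun j _ => lintegral_mono fun υ => ?_
  exact ENNReal.rpow_le_rpow (hproj_le (g j) ξ υ) (by linarith)

lemma hproj_d_bound {p : ℝ} (hp : 1 ≤ p) (hp2 : p ≤ 2) {g : Fin n → Ω → Ω → ℝ}
    (hg : ∀ j, Measurable (Function.uncurry (g j))) :
    ∫⁻ υ, (∑ j, ∫⁻ ξ, ENNReal.ofReal (hproj μ (g j) ξ υ ^ 2) ∂μ) ^ (p / 2) ∂μ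
      ≤ 16 * ∫⁻ υ, (∑ j, ∫⁻ ξ, ENNReal.ofReal (g j ξ υ ^ 2) ∂μ) ^ (p / 2) ∂μ := by
  simp_rw [ofReal_sq_enorm]
  refine le_trans ?_ (proj_c μ hp hp2 (fun j y x => ‖g j x y‖ₑ) fun j => (hg j).enorm.comp measurable_swap)
  refine lintegral_mono fun υ => ENNReal.rpow_le_rpow ?_ (by linarith)
  refine Finset.sum_le_sum fun j _ => lintegral_mono fun ξ => ?_
  refine ENNReal.rpow_le_rpow ((hproj_le (g j) ξ υ).trans (le_of_eq ?_)) (by linarith)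
  exact (fourMaj_swap μ (fun x y => ‖g j x y‖ₑ) (hg j).enorm υ ξ).symm

lemma int_of_c {p : ℝ} (hp : 1 ≤ p) {g : Fin n → Ω → Ω → ℝ}
    (hg : ∀ j, Measurable (Function.uncurry (g j)))
    (hfin : ∫⁻ ξ, (∑ j, ∫⁻ υ, ENNReal.ofReal (g j ξ υ ^ 2) ∂μ) ^ (p / 2) ∂μ < ⊤) (j : Fin n) :
    Integrable (Function.uncurry (g j)) (μ.prod μ) := by
  have hs2 : ∀ x, Measurable fun z => ‖g j x z‖ₑ := fun x => ((hg j).comp measurable_prodMk_left).enorm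
  have hgm : Measurable fun ξ => ∫⁻ υ, ‖g j ξ υ‖ₑ ∂μ :=
    Measurable.lintegral_prod_right' (f := fun w : Ω × Ω => ‖g j w.1 w.2‖ₑ) (hg j).enorm
  refine ⟨(hg j).aestronglyMeasurable, ?_⟩
  rw [hasFiniteIntegral_iff_enorm, lintegral_prod _ (hg j).enorm.aemeasurable]
  have key : (∫⁻ ξ, ∫⁻ υ, ‖g j ξ υ‖ₑ ∂μ ∂μ) ^ p < ⊤ := by
    refine lt_of_le_of_lt ((jensen_convex μ hgm.aemeasurable hp).trans ?_) hfin
    refine lintegral_mono fun ξ => ?_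
    calc (∫⁻ υ, ‖g j ξ υ‖ₑ ∂μ) ^ p = ((∫⁻ υ, ‖g j ξ υ‖ₑ ∂μ) ^ (2:ℝ)) ^ (p / 2) := by
          rw [← ENNReal.rpow_mul]; congr 1; ring
      _ ≤ (∫⁻ υ, ENNReal.ofReal (g j ξ υ ^ 2) ∂μ) ^ (p / 2) := by
          refine ENNReal.rpow_le_rpow ?_ (by linarith)
          simp_rw [ofReal_sq_enorm]
          exact jensen_convex μ (hs2 ξ).aemeasurable (by norm_num)
      _ ≤ _ := by
          refine ENNReal.rpow_le_rpow ?_ (by linarith)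
          exact Finset.single_le_sum (f := fun j => ∫⁻ υ, ENNReal.ofReal (g j ξ υ ^ 2) ∂μ)
            (fun _ _ => zero_le) (Finset.mem_univ j)
  by_contra hc
  rw [not_lt, top_le_iff] at hc
  simp only [Function.uncurry] at hc
  rw [hc, ENNReal.top_rpow_of_pos (by linarith)] at key
  exact lt_irrefl _ key

lemma hproj_self {g : Ω → Ω → ℝ}
    (h1 : ∀ᵐ υ ∂μ, ∫ ξ, g ξ υ ∂μ = 0) (h2 : ∀ᵐ ξ ∂μ, ∫ υ, g ξ υ ∂μ = 0) :
    ∀ᵐ ξ ∂μ, ∀ᵐ υ ∂μ, hproj μ g ξ υ = g ξ υ := by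
  have h3 : ∫ x, ∫ y, g x y ∂μ ∂μ = 0 := integral_eq_zero_of_ae h2
  filter_upwards [h2] with ξ hξ
  filter_upwards [h1] with υ hυ
  unfold hproj
  rw [hξ, hυ, h3]; ring

lemma hproj_lin {f a c d : Ω → Ω → ℝ} (hf : Integrable (Function.uncurry f) (μ.prod μ))
    (ha : Integrable (Function.uncurry a) (μ.prod μ))
    (hc : Integrable (Function.uncurry c) (μ.prod μ)) (hd : Integrable (Function.uncurry d) (μ.prod μ)) :
    ∀ᵐ ξ ∂μ, ∀ᵐ υ ∂μ, hproj μ (fun x y => f x y - a x y - c x y - d x y) ξ υ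
      = hproj μ f ξ υ - hproj μ a ξ υ - hproj μ c ξ υ - hproj μ d ξ υ := by
  have e3 : ∫ x, ∫ y, (f x y - a x y - c x y - d x y) ∂μ ∂μ
      = ∫ x, ∫ y, f x y ∂μ ∂μ - ∫ x, ∫ y, a x y ∂μ ∂μ - ∫ x, ∫ y, c x y ∂μ ∂μ - ∫ x, ∫ y, d x y ∂μ ∂μ := by
    have hf1 : Integrable (fun x => ∫ y, f x y ∂μ) μ := hf.integral_prod_left
    have ha1 : Integrable (fun x => ∫ y, a x y ∂μ) μ := ha.integral_prod_left
    have hc1 : Integrable (fun x => ∫ y, c x y ∂μ) μ := hc.integral_prod_left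
    have hd1 : Integrable (fun x => ∫ y, d x y ∂μ) μ := hd.integral_prod_left
    rw [← int_sub4 hf1 ha1 hc1 hd1]
    refine integral_congr_ae ?_
    filter_upwards [hf.prod_right_ae, ha.prod_right_ae, hc.prod_right_ae, hd.prod_right_ae] with x h1 h2 h3 h4
    exact int_sub4 h1 h2 h3 h4
  filter_upwards [hf.prod_right_ae, ha.prod_right_ae, hc.prod_right_ae, hd.prod_right_ae] with ξ h1 h2 h3 h4
  filter_upwards [hf.prod_left_ae, ha.prod_left_ae, hc.prod_left_ae, hd.prod_left_ae] with υ k1 k2 k3 k4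
  have e1 := int_sub4 h1 h2 h3 h4
  have e2 := int_sub4 k1 k2 k3 k4
  simp only [Function.uncurry] at e1 e2
  unfold hproj
  rw [e1, e2, e3]
  ring

end HOEFF

section MEANZERO
variable {Ω : Type u} [MeasurableSpace Ω] (μ : Measure Ω) [IsProbabilityMeasure μ] {n : ℕ}

lemma lt_top_of_rpow {x : ℝ≥0∞} {r : ℝ} (hr : 0 < r) (h : x ^ r < ⊤) : x < ⊤ := by
  by_contra hc
  rw [not_lt, top_le_iff] at hc
  rw [hc, ENNReal.top_rpow_of_pos hr] at h
  exact lt_irrefl _ h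

lemma mean_zero_decomp {p : ℝ} (hp : 1 ≤ p) (hp2 : p ≤ 2) (f a b c d : Fin n → Fin n → Ω → Ω → ℝ)
    (hm : ∀ i j, Measurable (Function.uncurry (f i j)))
    (h0 : ∀ i j, ¬ i < j → f i j = 0)
    (hint : ∀ i j, Integrable (Function.uncurry (f i j)) (μ.prod μ))
    (hz : ∀ i j, (∀ᵐ υ ∂μ, ∫ ξ, f i j ξ υ ∂μ = 0) ∧ (∀ᵐ ξ ∂μ, ∫ υ, f i j ξ υ ∂μ = 0))
    (ha : ∀ i j, Measurable (Function.uncurry (a i j)))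
    (hb : ∀ i j, Measurable (Function.uncurry (b i j)))
    (hc : ∀ i j, Measurable (Function.uncurry (c i j)))
    (hd : ∀ i j, Measurable (Function.uncurry (d i j)))
    (hs : ∀ i j, ¬ i < j → a i j = 0 ∧ b i j = 0 ∧ c i j = 0 ∧ d i j = 0)
    (he : ∀ i j ξ υ, f i j ξ υ = a i j ξ υ + b i j ξ υ + c i j ξ υ + d i j ξ υ)
    (hfin : (∑ i, ∑ j, ∫⁻ ξ, ∫⁻ υ, ENNReal.ofReal (a i j ξ υ ^ 2) ∂μ ∂μ) ^ ((1:ℝ)/2)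
      + (∑ i, ∑ j, ∫⁻ ξ, ∫⁻ υ, ENNReal.ofReal (|b i j ξ υ| ^ p) ∂μ ∂μ) ^ (1/p)
      + (∑ i, ∫⁻ ξ, (∑ j, ∫⁻ υ, ENNReal.ofReal (c i j ξ υ ^ 2) ∂μ) ^ (p/2) ∂μ) ^ (1/p)
      + (∑ j, ∫⁻ υ, (∑ i, ∫⁻ ξ, ENNReal.ofReal (d i j ξ υ ^ 2) ∂μ) ^ (p/2) ∂μ) ^ (1/p) < ⊤) :
    ∃ s ∈ fourDecompVals μ p f true, s ≤ 16 * (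
      (∑ i, ∑ j, ∫⁻ ξ, ∫⁻ υ, ENNReal.ofReal (a i j ξ υ ^ 2) ∂μ ∂μ) ^ ((1:ℝ)/2)
      + (∑ i, ∑ j, ∫⁻ ξ, ∫⁻ υ, ENNReal.ofReal (|b i j ξ υ| ^ p) ∂μ ∂μ) ^ (1/p)
      + (∑ i, ∫⁻ ξ, (∑ j, ∫⁻ υ, ENNReal.ofReal (c i j ξ υ ^ 2) ∂μ) ^ (p/2) ∂μ) ^ (1/p)
      + (∑ j, ∫⁻ υ, (∑ i, ∫⁻ ξ, ENNReal.ofReal (d i j ξ υ ^ 2) ∂μ) ^ (p/2) ∂μ) ^ (1/p)) := by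
  have hp0 : 0 < p := by linarith
  have hpi : 0 < 1 / p := by positivity
  rw [ENNReal.add_lt_top, ENNReal.add_lt_top, ENNReal.add_lt_top] at hfin
  obtain ⟨⟨⟨fa, -⟩, fc⟩, fd⟩ := hfin
  have fa := lt_top_of_rpow (by norm_num) fa
  have fc := lt_top_of_rpow hpi fc
  have fd := lt_top_of_rpow hpi fd
  -- integrability of the pieces
  have ia : ∀ i j, Integrable (Function.uncurry (a i j)) (μ.prod μ) := by
    intro i j
    refine integrable_of_p (p := 2) _ (ha i j) (by norm_num) ?_
    rw [lintegral_prod _ (((ha i j).abs.pow_const (2:ℝ)).ennreal_ofReal).aemeasurable]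
    refine lt_of_le_of_lt ?_ fa
    have e : ∫⁻ ξ, ∫⁻ υ, ENNReal.ofReal (|Function.uncurry (a i j) (ξ, υ)| ^ (2:ℝ)) ∂μ ∂μ
        = ∫⁻ ξ, ∫⁻ υ, ENNReal.ofReal (a i j ξ υ ^ 2) ∂μ ∂μ := by
      simp [Function.uncurry]
    rw [e]
    refine le_trans ?_ (Finset.single_le_sum (f := fun i => ∑ j, ∫⁻ ξ, ∫⁻ υ,
      ENNReal.ofReal (a i j ξ υ ^ 2) ∂μ ∂μ) (fun _ _ => zero_le) (Finset.mem_univ i))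
    exact Finset.single_le_sum (f := fun j => ∫⁻ ξ, ∫⁻ υ,
      ENNReal.ofReal (a i j ξ υ ^ 2) ∂μ ∂μ) (fun _ _ => zero_le) (Finset.mem_univ j)
  have ic : ∀ i j, Integrable (Function.uncurry (c i j)) (μ.prod μ) := by
    intro i j
    refine int_of_c hp (hc i) (lt_of_le_of_lt ?_ fc) j
    exact Finset.single_le_sum (f := fun i => ∫⁻ ξ, (∑ j, ∫⁻ υ,
      ENNReal.ofReal (c i j ξ υ ^ 2) ∂μ) ^ (p/2) ∂μ) (fun _ _ => zero_le) (Finset.mem_univ i)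
  have id : ∀ i j, Integrable (Function.uncurry (d i j)) (μ.prod μ) := by
    intro i j
    have h := int_of_c (g := fun i υ ξ => d i j ξ υ) hp (fun i => (hd i j).comp measurable_swap)
      (lt_of_le_of_lt (Finset.single_le_sum (f := fun j => ∫⁻ υ, (∑ i, ∫⁻ ξ,
      ENNReal.ofReal (d i j ξ υ ^ 2) ∂μ) ^ (p/2) ∂μ) (fun _ _ => zero_le) (Finset.mem_univ j)) fd) i
    exact h.swap
  have hp00 : hproj μ (0 : Ω → Ω → ℝ) = 0 := by
    funext ξ υ; simp [hproj]
  refine ⟨_, ⟨fun i j => hproj μ (a i j),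
    fun i j ξ υ => f i j ξ υ - hproj μ (a i j) ξ υ - hproj μ (c i j) ξ υ - hproj μ (d i j) ξ υ,
    fun i j => hproj μ (c i j), fun i j => hproj μ (d i j),
    fun i j => hproj_meas (ha i j),
    fun i j => (((hm i j).sub (hproj_meas (ha i j))).sub (hproj_meas (hc i j))).sub (hproj_meas (hd i j)),
    fun i j => hproj_meas (hc i j), fun i j => hproj_meas (hd i j), ?_, ?_, ?_, rfl⟩, ?_⟩
  · intro i j hij
    obtain ⟨h1, h2, h3, h4⟩ := hs i j hij
    simp only [h1, h3, h4, h0 i j hij, hp00]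
    refine ⟨trivial, ?_, trivial, trivial⟩
    funext ξ υ; simp
  · intro i j ξ υ; ring
  · intro _ g hg i j
    simp only [List.mem_cons, List.not_mem_nil, or_false] at hg
    rcases hg with rfl | rfl | rfl | rfl
    · exact hproj_mz (ia i j)
    · have qa := hproj_int (ia i j)
      have qc := hproj_int (ic i j)
      have qd := hproj_int (id i j)
      constructor
      · filter_upwards [(hint i j).prod_left_ae, qa.prod_left_ae, qc.prod_left_ae, qd.prod_left_ae,
          (hz i j).1, (hproj_mz (ia i j)).1, (hproj_mz (ic i j)).1, (hproj_mz (id i j)).1]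
          with υ k1 k2 k3 k4 z1 z2 z3 z4
        have e := int_sub4 k1 k2 k3 k4
        simp only [Function.uncurry] at e
        rw [e, z1, z2, z3, z4]; simp
      · filter_upwards [(hint i j).prod_right_ae, qa.prod_right_ae, qc.prod_right_ae, qd.prod_right_ae,
          (hz i j).2, (hproj_mz (ia i j)).2, (hproj_mz (ic i j)).2, (hproj_mz (id i j)).2]
          with υ k1 k2 k3 k4 z1 z2 z3 z4
        have e := int_sub4 k1 k2 k3 k4
        simp only [Function.uncurry] at e
        rw [e, z1, z2, z3, z4]; simp
    · exact hproj_mz (ic i j)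
    · exact hproj_mz (id i j)
  · rw [mul_add, mul_add, mul_add]
    have h16 : (1 : ℝ≥0∞) ≤ 16 := by norm_num
    refine add_le_add (add_le_add (add_le_add ?_ ?_) ?_) ?_
    · refine le_trans (ENNReal.rpow_le_rpow ?_ (by norm_num)) (rpow_const_le (by norm_num) h16 _)
      simp_rw [Finset.mul_sum]
      refine Finset.sum_le_sum fun i _ => Finset.sum_le_sum fun j _ => ?_
      simp_rw [ofReal_sq_enorm]
      exact hproj_ab_bound (by norm_num) le_rfl (ha i j)
    · refine le_trans (ENNReal.rpow_le_rpow ?_ hpi.le) (rpow_const_le hp h16 _)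
      simp_rw [Finset.mul_sum]
      refine Finset.sum_le_sum fun i _ => Finset.sum_le_sum fun j _ => ?_
      simp_rw [ofReal_abs_rpow hp0.le]
      refine le_trans (le_of_eq ?_) (hproj_ab_bound hp hp2 (hb i j))
      have hbe : b i j = fun x y => f i j x y - a i j x y - c i j x y - d i j x y := by
        funext x y; rw [he i j x y]; ring
      refine lintegral_congr_ae ?_
      filter_upwards [hproj_lin (hint i j) (ia i j) (ic i j) (id i j),
        hproj_self (hz i j).1 (hz i j).2] with ξ k1 k2
      refine lintegral_congr_ae ?_
      filter_upwards [k1, k2] with υ k1 k2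
      rw [hbe, k1, k2]
    · refine le_trans (ENNReal.rpow_le_rpow ?_ hpi.le) (rpow_const_le hp h16 _)
      rw [Finset.mul_sum]
      exact Finset.sum_le_sum fun i _ => hproj_c_bound hp hp2 (hc i)
    · refine le_trans (ENNReal.rpow_le_rpow ?_ hpi.le) (rpow_const_le hp h16 _)
      rw [Finset.mul_sum]
      exact Finset.sum_le_sum fun j _ => hproj_d_bound hp hp2 (fun i => hd i j)

end MEANZERO

/-- **Four-summand decomposition of second-order Hoeffding functions**
(Corollary `4summandmz` of the paper): for `1 ≤ p ≤ 2` and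
`f(x) = ∑_{i<j} f i j (x i) (x j) ∈ V^p_2(Ω^n)` (components mean zero in each variable),
`‖f‖_{L^p(Ω^n)}` is comparable, with absolute constants, to the infimum of the four-norm
sum over all decompositions `f i j = a + b + c + d`; moreover the infimum over
decompositions with all pieces of mean zero in each variable is comparable as well. -/
theorem four_summand_decomposition_mean_zero :
    ∃ c C : ℝ, 0 < c ∧ 0 < C ∧
      ∀ (Ω : Type u) [MeasurableSpace Ω] (μ : Measure Ω) [IsProbabilityMeasure μ]
        (n : ℕ) (p : ℝ), 1 ≤ p → p ≤ 2 →
      ∀ f : Fin n → Fin n → Ω → Ω → ℝ,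
        (∀ i j, Measurable (Function.uncurry (f i j))) →
        (∀ i j, ¬ i < j → f i j = 0) →
        (∀ i j, (∀ᵐ υ ∂μ, ∫ ξ, f i j ξ υ ∂μ = 0) ∧ (∀ᵐ ξ ∂μ, ∫ υ, f i j ξ υ ∂μ = 0)) →
        (∀ i j, (∫⁻ ξ, ∫⁻ υ, ENNReal.ofReal (|f i j ξ υ| ^ p) ∂μ ∂μ) < ⊤) →
        (ENNReal.ofReal c * sInf (fourDecompVals μ p f false)
            ≤ (∫⁻ x : Fin n → Ω, ENNReal.ofReal (|∑ i, ∑ j, f i j (x i) (x j)| ^ p)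
                ∂Measure.pi fun _ => μ) ^ (1/p)) ∧
        ((∫⁻ x : Fin n → Ω, ENNReal.ofReal (|∑ i, ∑ j, f i j (x i) (x j)| ^ p)
              ∂Measure.pi fun _ => μ) ^ (1/p)
            ≤ ENNReal.ofReal C * sInf (fourDecompVals μ p f false)) ∧
        sInf (fourDecompVals μ p f true)
          ≤ ENNReal.ofReal C * sInf (fourDecompVals μ p f false) := by
  refine ⟨1 / 2 ^ 60, 2592, by positivity, by norm_num, ?_⟩
  intro Ω _ μ _ n p hp hp2 f hm h0 hz hfin
  have hp0 : 0 < p := by linarith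
  have hint : ∀ i j, Integrable (Function.uncurry (f i j)) (μ.prod μ) := by
    intro i j
    refine integrable_of_p _ (hm i j) hp ?_
    rw [lintegral_prod _ (((hm i j).abs.pow_const p).ennreal_ofReal).aemeasurable]
    exact hfin i j
  have hC : ENNReal.ofReal 2592 = 2592 := by
    simp
  simp_rw [ofReal_abs_rpow hp0.le (∑ i, ∑ j, f i j _ _)]
  rw [hC]
  refine ⟨?_, ?_, ?_⟩
  · obtain ⟨a, b, c, d, ha, hb, hc, hd, hs, he, hle⟩ := lower_bound μ hp hp2 f hm h0 hint hz
    have hmem := sInf_le (show _ ∈ fourDecompVals μ p f false from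
      ⟨a, b, c, d, ha, hb, hc, hd, hs, he, fun h => absurd h (by simp), rfl⟩)
    have hk : ENNReal.ofReal (1 / 2 ^ 60) * 2 ^ 60 = 1 := by
      have e : (2 ^ 60 : ℝ≥0∞) = ENNReal.ofReal (2 ^ 60) := by
        rw [ENNReal.ofReal_pow (by norm_num)]; simp
      rw [e, ← ENNReal.ofReal_mul (by positivity)]
      norm_num
    refine (mul_le_mul_right (hmem.trans hle) _).trans (le_of_eq ?_)
    rw [← mul_assoc, hk, one_mul]
  · refine le_mul_sInf' (by norm_num) (by norm_num) ?_
    rintro s ⟨a, b, c, d, ha, hb, hc, hd, hs, he, -, rfl⟩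
    exact upper_bound μ hp hp2 f a b c d hm h0 hint hz ha hb hc hd hs he
  · refine le_mul_sInf' (by norm_num) (by norm_num) ?_
    rintro s ⟨a, b, c, d, ha, hb, hc, hd, hs, he, -, rfl⟩
    rcases lt_or_eq_of_le (le_top (a :=
      (∑ i, ∑ j, ∫⁻ ξ, ∫⁻ υ, ENNReal.ofReal (a i j ξ υ ^ 2) ∂μ ∂μ) ^ ((1:ℝ)/2)
      + (∑ i, ∑ j, ∫⁻ ξ, ∫⁻ υ, ENNReal.ofReal (|b i j ξ υ| ^ p) ∂μ ∂μ) ^ (1/p)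
      + (∑ i, ∫⁻ ξ, (∑ j, ∫⁻ υ, ENNReal.ofReal (c i j ξ υ ^ 2) ∂μ) ^ (p/2) ∂μ) ^ (1/p)
      + (∑ j, ∫⁻ υ, (∑ i, ∫⁻ ξ, ENNReal.ofReal (d i j ξ υ ^ 2) ∂μ) ^ (p/2) ∂μ) ^ (1/p))) with h | h
    · obtain ⟨s, hs', hle⟩ := mean_zero_decomp μ hp hp2 f a b c d hm h0 hint hz ha hb hc hd hs he h
      refine (sInf_le hs').trans (hle.trans ?_)
      gcongr
      norm_num
    · rw [h, ENNReal.mul_top (by norm_num)]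
      exact le_top
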